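/- arXiv:2207.04289 — 3 statements merged into one kernel-verified Lean document; each statement's English description precedes it below -/
import Mathlib

section
/- Let F = (f₁,…,f_p) ∈ ℤ[X₁,…,X_n]^p with deg f_j ≤ d for all j, such that the ideal ⟨f₁,…,f_p⟩ ⊆ ℂ[X₁,…,X_n] is radical, every minimal prime over ⟨f₁,…,f_p⟩ has height p (so V(F) is equidimensional of dimension n−p), and jac(F)(x) has rank p at every x ∈ V(F) (so V(F) is smooth). Fix i ∈ {1,…,n−p+1}. Then there exists a nonzero polynomial Δ_{i,1} in the n² indeterminates (𝔄_{j,k})_{1≤j,k≤n} of total degree at most n(d^{5n}+1) such that for every matrix A ∈ ℂ^{n×n} with Δ_{i,1}(A) ≠ 0: (i) A is invertible; (ii) the polar variety W(i,F^A) is either empty or (i−1)-equidimensional, i.e. every minimal prime over the ideal ⟨𝔍(i,F^A)⟩ ⊆ ℂ[X₁,…,X_n] has height n−i+1; and (iii) 0 is a regular value of the n+p−i polynomials (f₁^A,…,f_p^A, the n−i entries of [L₁ ⋯ L_p]·jac(F^A,i)) on the open set {(x,ℓ) ∈ ℂⁿ × ℂ^p : ℓ ≠ 0}. -/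
open MvPolynomial

noncomputable section

/-- The Jacobian matrix of a family of polynomials, evaluated at a point. -/
def jacEval {ι σ : Type*} [Fintype ι] [Fintype σ]
    (G : ι → MvPolynomial σ ℂ) (y : σ → ℂ) : Matrix ι σ ℂ :=
  Matrix.of fun j k => eval y (pderiv k (G j))

/-- `0` is a regular value of `G` on `U`: at every point of `U` where all `G j`
vanish, the Jacobian matrix has full (row) rank. -/
def IsRegularValueOn {ι σ : Type*} [Fintype ι] [Fintype σ]
    (G : ι → MvPolynomial σ ℂ) (U : Set (σ → ℂ)) : Prop :=
  ∀ y ∈ U, (∀ j, eval y (G j) = 0) → (jacEval G y).rank = Fintype.card ι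

/-- The ideal `P` is prime of height `c`. -/
def IdealHeightEq {R : Type*} [CommRing R] (P : Ideal R) (c : ℕ) : Prop :=
  ∃ hP : P.IsPrime, Order.height (⟨P, hP⟩ : PrimeSpectrum R) = (c : ℕ∞)

/-- The complexification of an integer polynomial. -/
def toC {n : ℕ} (f : MvPolynomial (Fin n) ℤ) : MvPolynomial (Fin n) ℂ :=
  map (Int.castRingHom ℂ) f

/-- `f^A = f(A·X)`, the change of variables by the matrix `A`. -/
def changeVars {n : ℕ} (A : Matrix (Fin n) (Fin n) ℂ) (f : MvPolynomial (Fin n) ℂ) :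
    MvPolynomial (Fin n) ℂ :=
  aeval (fun k : Fin n => ∑ m : Fin n, C (A k m) * X m) f

/-- The index (as an element of `Fin n`) of the `c`-th of the last `n - i` variables. -/
def colIdx (n i : ℕ) (c : Fin (n - i)) : Fin n :=
  ⟨i + c, by have := c.isLt; omega⟩

/-- The `c`-th entry of the row vector `[L₁ ⋯ L_p]·jac(G, i)`, as an element of
`ℂ[X₁,…,X_n,L₁,…,L_p]`. -/
def lagEntry {n p : ℕ} (G : Fin p → MvPolynomial (Fin n) ℂ) (i : ℕ) (c : Fin (n - i)) :
    MvPolynomial (Fin n ⊕ Fin p) ℂ :=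
  ∑ k : Fin p, X (Sum.inr k) * rename Sum.inl (pderiv (colIdx n i c) (G k))

/-- The system of `n + p − i` polynomials `(G, [L₁ ⋯ L_p]·jac(G, i))` in
`ℂ[X₁,…,X_n,L₁,…,L_p]`. -/
def hSys {n p : ℕ} (G : Fin p → MvPolynomial (Fin n) ℂ) (i : ℕ) :
    (Fin p ⊕ Fin (n - i)) → MvPolynomial (Fin n ⊕ Fin p) ℂ :=
  Sum.elim (fun j => rename Sum.inl (G j)) (fun c => lagEntry G i c)

/-- The ideal `⟨𝔍(i,G)⟩` generated by `G` and the `p × p` minors of `jac(G, i)`;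
its zero set is the polar variety `W(i, G)`. -/
def polarIdeal {n p : ℕ} (G : Fin p → MvPolynomial (Fin n) ℂ) (i : ℕ) :
    Ideal (MvPolynomial (Fin n) ℂ) :=
  Ideal.span (Set.range G ∪
    {g | ∃ c : Fin p ↪ Fin (n - i),
      g = Matrix.det (Matrix.of fun a b : Fin p => pderiv (colIdx n i (c b)) (G a))})

/-- The rows of `M` are linearly dependent modulo the ideal `Q`. -/
def RowsDep {R : Type*} [CommRing R] {p q : Type*} [Fintype p] (Q : Ideal R)
    (M : Matrix p q R) : Prop :=
  ∃ v : p → R, (∃ a, v a ∉ Q) ∧ ∀ b, ∑ a, v a * M a b ∈ Q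

theorem exists_embedding_det_ne_zero {K : Type*} [Field K] {p : ℕ} {q : Type*} [Fintype q]
    (N : Matrix (Fin p) q K) (h : LinearIndependent K N.row) :
    ∃ c : Fin p ↪ q, (N.submatrix id c).det ≠ 0 := by
  have hr : N.rank = p := by simpa using LinearIndependent.rank_matrix (M := N) h
  obtain ⟨κ, a, ha, hsp, hli⟩ := exists_linearIndependent' K N.col
  have : Finite κ := Finite.of_injective a ha
  have := Fintype.ofFinite κ
  have hc : Fintype.card κ = p := by
    rw [← hr, Matrix.rank_eq_finrank_span_cols, ← hsp, finrank_span_eq_card hli]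
  let e : Fin p ≃ κ := (Fintype.equivFinOfCardEq hc).symm
  refine ⟨⟨a ∘ e, ha.comp e.injective⟩, ?_⟩
  have h2 : LinearIndependent K (N.submatrix id (a ∘ e)).col := by
    have := hli.comp e e.injective
    exact this
  rw [Matrix.linearIndependent_cols_iff_isUnit] at h2
  exact ((Matrix.isUnit_iff_isUnit_det _).1 h2).ne_zero

theorem linearIndependent_of_not_rowsDep {R : Type*} [CommRing R] {p : Type*} [Fintype p]
    {q : Type*} (Q : Ideal R) [Q.IsPrime] (M : Matrix p q R) (hn : ¬ RowsDep Q M) :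
    LinearIndependent (FractionRing (R ⧸ Q)) (M.map fun x =>
      algebraMap (R ⧸ Q) (FractionRing (R ⧸ Q)) (Ideal.Quotient.mk Q x)).row := by
  rw [← LinearIndependent.iff_fractionRing (R ⧸ Q) (FractionRing (R ⧸ Q)),
    Fintype.linearIndependent_iff]
  intro g hg a
  by_contra hga
  choose v hv using fun a => Ideal.Quotient.mk_surjective (g a)
  refine hn ⟨v, ⟨a, fun hva => hga ?_⟩, fun b => ?_⟩
  · rw [← hv]; exact Ideal.Quotient.eq_zero_iff_mem.2 hva
  · rw [← Ideal.Quotient.eq_zero_iff_mem]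
    apply IsFractionRing.injective (R ⧸ Q) (FractionRing (R ⧸ Q))
    have := congrFun hg b
    simpa [Matrix.row, Finset.sum_apply, map_sum, hv, Algebra.smul_def] using this

theorem rowsDep_iff {R : Type*} [CommRing R] {p : ℕ} {q : Type*} [Fintype q]
    (Q : Ideal R) [Q.IsPrime] (M : Matrix (Fin p) q R) :
    RowsDep Q M ↔ ∀ c : Fin p ↪ q, (M.submatrix id c).det ∈ Q := by
  constructor
  · rintro ⟨v, ⟨a, ha⟩, hv⟩ c
    rw [← Ideal.Quotient.eq_zero_iff_mem, RingHom.map_det,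
      ← Matrix.exists_vecMul_eq_zero_iff]
    refine ⟨fun a => Ideal.Quotient.mk Q (v a), fun h => ha ?_, ?_⟩
    · exact Ideal.Quotient.eq_zero_iff_mem.1 (congrFun h a)
    · ext b
      have := Ideal.Quotient.eq_zero_iff_mem.2 (hv (c b))
      simpa [Matrix.vecMul, dotProduct, map_sum] using this
  · intro h
    by_contra hn
    let K := FractionRing (R ⧸ Q)
    let N : Matrix (Fin p) q K := M.map fun x => algebraMap (R ⧸ Q) K (Ideal.Quotient.mk Q x)
    have hli : LinearIndependent K N.row := linearIndependent_of_not_rowsDep Q M hn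
    obtain ⟨c, hc⟩ := exists_embedding_det_ne_zero N hli
    apply hc
    have h0 := Ideal.Quotient.eq_zero_iff_mem.2 (h c)
    have : N.submatrix id c = ((algebraMap (R ⧸ Q) K).comp (Ideal.Quotient.mk Q)).mapMatrix
        (M.submatrix id c) := by ext; rfl
    rw [this, ← RingHom.map_det, RingHom.comp_apply, h0, map_zero]

theorem RowsDep.mono {R : Type*} [CommRing R] {p : ℕ} {q : Type*} [Fintype q]
    {Q Q' : Ideal R} [Q.IsPrime] [Q'.IsPrime] (hQ : Q ≤ Q') {M : Matrix (Fin p) q R}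
    (h : RowsDep Q M) : RowsDep Q' M := by
  rw [rowsDep_iff] at h ⊢
  exact fun c => hQ (h c)

/-- Elimination of a row and a column of `M` using the pivot `M a b`. -/
def pivotMatrix {R : Type*} [CommRing R] {p q : ℕ} (M : Matrix (Fin (p + 1)) (Fin (q + 1)) R)
    (a : Fin (p + 1)) (b : Fin (q + 1)) : Matrix (Fin p) (Fin q) R :=
  Matrix.of fun x y =>
    M a b * M (a.succAbove x) (b.succAbove y) - M (a.succAbove x) b * M a (b.succAbove y)

theorem rowsDep_pivotMatrix_iff {R : Type*} [CommRing R] {p q : ℕ}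
    (M : Matrix (Fin (p + 1)) (Fin (q + 1)) R) (a : Fin (p + 1)) (b : Fin (q + 1))
    (Q : Ideal R) [hQ : Q.IsPrime] (hab : M a b ∉ Q) :
    RowsDep Q (pivotMatrix M a b) ↔ RowsDep Q M := by
  constructor
  · rintro ⟨w, ⟨x, hx⟩, hw⟩
    refine ⟨a.insertNth (-∑ x, w x * M (a.succAbove x) b) (fun x => M a b * w x),
      ⟨a.succAbove x, ?_⟩, fun y => ?_⟩
    · simp only [Fin.insertNth_apply_succAbove]
      exact fun h => (hQ.mem_or_mem h).elim hab hx
    · rw [Fin.sum_univ_succAbove _ a]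
      simp only [Fin.insertNth_apply_succAbove, Fin.insertNth_apply_same]
      refine Fin.succAboveCases b ?_ (fun y => ?_) y
      · convert Q.zero_mem
        rw [neg_mul, Finset.sum_mul, neg_add_eq_zero]
        exact Finset.sum_congr rfl fun _ _ => by ring
      · convert hw y using 1
        rw [neg_mul, Finset.sum_mul, neg_add_eq_sub, ← Finset.sum_sub_distrib]
        exact Finset.sum_congr rfl fun _ _ => by simp only [pivotMatrix, Matrix.of_apply]; ring
  · rintro ⟨v, ⟨z, hz⟩, hv⟩
    have hb := hv b
    rw [Fin.sum_univ_succAbove _ a] at hb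
    refine ⟨fun x => v (a.succAbove x), ?_, fun y => ?_⟩
    · by_contra! hcon
      have h1 : v a * M a b ∈ Q := by
        refine (Q.add_mem_iff_left (Q.sum_mem fun x _ => ?_)).1 hb
        exact Q.mul_mem_right _ (hcon x)
      have h2 := (hQ.mem_or_mem h1).resolve_right hab
      exact hz (Fin.succAboveCases a h2 hcon z)
    · have hy := hv (b.succAbove y)
      rw [Fin.sum_univ_succAbove _ a] at hy
      have := Q.sub_mem (Q.mul_mem_left (M a b) hy) (Q.mul_mem_left (M a (b.succAbove y)) hb)
      convert this using 1
      simp only [mul_add, Finset.mul_sum]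
      rw [show ∀ u v w x : R, u + v - (w + x) = (u - w) + (v - x) by intros; ring,
        ← Finset.sum_sub_distrib, show M a b * (v a * M a (b.succAbove y)) -
          M a (b.succAbove y) * (v a * M a b) = 0 by ring, zero_add]
      exact Finset.sum_congr rfl fun _ _ => by simp only [pivotMatrix, Matrix.of_apply]; ring

/-- If `𝔫` is minimal over `J + (t)` then a prime strictly below `𝔫` containing `J` is minimal
among those. -/
theorem eq_of_le_of_lt_of_mem_minimalPrimes {R : Type*} [CommRing R] [IsNoetherianRing R]
    {Q P N : Ideal R} [Q.IsPrime] [P.IsPrime] [N.IsPrime] (hQP : Q ≤ P) (hPN : P < N) (t : R)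
    (h : N ∈ (Q ⊔ Ideal.span {t}).minimalPrimes) : Q = P := by
  by_contra hne
  have h1 := Ideal.map_height_le_one_of_mem_minimalPrimes h
  have hker : RingHom.ker (Ideal.Quotient.mk Q) = Q := Ideal.mk_ker
  have hPp : (P.map (Ideal.Quotient.mk Q)).IsPrime :=
    Ideal.map_isPrime_of_surjective Ideal.Quotient.mk_surjective (hker.trans_le hQP)
  have hNp : (N.map (Ideal.Quotient.mk Q)).IsPrime :=
    Ideal.map_isPrime_of_surjective Ideal.Quotient.mk_surjective
      (hker.trans_le (hQP.trans hPN.le))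
  have hcomap : ∀ I : Ideal R, Q ≤ I →
      (I.map (Ideal.Quotient.mk Q)).comap (Ideal.Quotient.mk Q) = I := fun I hI => by
    rw [Ideal.comap_map_of_surjective _ Ideal.Quotient.mk_surjective, ← RingHom.ker_eq_comap_bot,
      hker, sup_eq_left.2 hI]
  have hlt : P.map (Ideal.Quotient.mk Q) < N.map (Ideal.Quotient.mk Q) := by
    refine lt_of_le_of_ne (Ideal.map_mono hPN.le) fun he => hPN.ne ?_
    rw [← hcomap P hQP, he, hcomap N (hQP.trans hPN.le)]
  have h2 := (Ideal.height_add_one_le_of_lt_of_isPrime hlt).trans h1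
  have h3 : (P.map (Ideal.Quotient.mk Q)).height = 0 := by
    have : (P.map (Ideal.Quotient.mk Q)).height + 1 ≤ 0 + 1 := by simpa using h2
    exact le_antisymm ((ENat.add_le_add_iff_right (by simp)).1 this) bot_le
  rw [Ideal.height_eq_zero_iff_eq_bot] at h3
  apply hne
  rw [← hcomap P hQP, h3, ← RingHom.ker_eq_comap_bot, hker]

theorem height_le_height_map_C {R : Type*} [CommRing R] [IsNoetherianRing R]
    (P : Ideal R) [P.IsPrime] : P.height ≤ (P.map Polynomial.C).height := by
  have : (P.map Polynomial.C).IsPrime := Ideal.isPrime_map_C_of_isPrime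
  have : (P.map (algebraMap R (Polynomial R))).IsPrime := this
  have : (P.map (algebraMap R (Polynomial R))).LiesOver P := by
    refine ⟨le_antisymm Ideal.le_comap_map fun x hx => ?_⟩
    have := Ideal.mem_map_C_iff.1 (Ideal.mem_comap.1 hx) 0
    simpa using this
  have h := Ideal.height_eq_height_add_of_liesOver_of_hasGoingDown P
    (P.map (algebraMap R (Polynomial R)))
  exact (le_self_add).trans h.ge

theorem height_add_le_of_minimal_rowsDep.{u} (p : ℕ) : ∀ {R : Type u} [CommRing R]
    [IsNoetherianRing R] (q : ℕ) (_ : p ≤ q + 1) (M : Matrix (Fin p) (Fin q) R) (s : Finset R)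
    (P : Ideal R) [P.IsPrime] (_ : (s : Set R) ⊆ P) (_ : RowsDep P M)
    (_ : ∀ Q : Ideal R, Q.IsPrime → (s : Set R) ⊆ Q → RowsDep Q M → Q ≤ P → Q = P),
    P.height + p ≤ s.card + q + 1 := by
  induction p with
  | zero =>
    rintro R _ _ q - M s P _ - ⟨v, ⟨a, -⟩, -⟩ -
    exact a.elim0
  | succ p ih =>
    have pivot : ∀ {R : Type u} [CommRing R]
        [IsNoetherianRing R] (q : ℕ) (_ : p ≤ q) (M : Matrix (Fin (p + 1)) (Fin q) R)
        (s : Finset R)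
        (P : Ideal R) [P.IsPrime] (_ : (s : Set R) ⊆ P) (_ : RowsDep P M)
        (_ : ∀ Q : Ideal R, Q.IsPrime → (s : Set R) ⊆ Q → RowsDep Q M → Q ≤ P → Q = P)
        (a b) (_ : M a b ∉ P),
        P.height + (p + 1 : ℕ) ≤ s.card + q + 1 := by
      intro R _ _ q hpq M s P _ hs hP hmin a b hab
      obtain _ | q := q
      · exact b.elim0
      have := ih q (by omega) (pivotMatrix M a b) s P hs
        ((rowsDep_pivotMatrix_iff M a b P hab).2 hP) fun Q hQ hsQ hQd hQP =>
          hmin Q hQ hsQ ((rowsDep_pivotMatrix_iff M a b Q fun h => hab (hQP h)).1 hQd) hQP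
      push_cast
      rw [← add_assoc, ← add_assoc]
      gcongr
    intro R _ _ q hpq M s P _ hs hP hmin
    by_cases hM : ∃ a b, M a b ∉ P
    · obtain ⟨a, b, hab⟩ := hM
      exact pivot q (by omega) M s P hs hP hmin a b hab
    push Not at hM
    obtain _ | p := p
    · classical
      have : P ∈ (Ideal.span ((s ∪ Finset.univ.image (M 0) : Finset R) : Set R)).minimalPrimes := by
        refine ⟨⟨inferInstance, ?_⟩, fun Q ⟨hQ, hQs⟩ hQP => ?_⟩
        · rw [Ideal.span_le]
          intro x hx
          simp only [Finset.coe_union, Finset.coe_image, Set.mem_union] at hx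
          obtain hx | ⟨b, -, rfl⟩ := hx
          · exact hs hx
          · exact hM _ _
        · rw [Ideal.span_le] at hQs
          refine (hmin Q hQ (fun x hx => hQs (by simp [Finset.mem_coe.1 hx]))
            ⟨1, ⟨0, fun h => hQ.ne_top ((Ideal.eq_top_iff_one _).2 h)⟩, fun b => ?_⟩ hQP).ge
          simp only [Finset.univ_unique, Fin.default_eq_zero, Pi.one_apply, one_mul, Finset.sum_singleton]
          exact hQs (by simp)
      have h2 := Ideal.height_le_card_of_mem_minimalPrimes_span_finset this
      have h3 : (s ∪ Finset.univ.image (M 0)).card ≤ s.card + q := by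
        refine (Finset.card_union_le _ _).trans ?_
        gcongr
        exact Finset.card_image_le.trans (by simp)
      have h4 := h2.trans (Nat.cast_le.2 h3)
      push_cast at h4 ⊢
      gcongr
    · obtain _ | q := q
      · omega
      classical
      let M' : Matrix (Fin (p + 2)) (Fin (q + 1)) (Polynomial R) :=
        M.map Polynomial.C + Matrix.single 0 0 Polynomial.X
      let N : Ideal (Polynomial R) := P.comap (Polynomial.evalRingHom 0)
      have hXN : Polynomial.X ∈ N := by simp [N, Ideal.mem_comap]
      have hPN : P.map Polynomial.C < N := by
        refine lt_of_le_of_ne ?_ ?_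
        · rw [Ideal.map_le_iff_le_comap]
          intro x hx
          simpa [N, Ideal.mem_comap] using hx
        · intro h
          rw [← h, Ideal.mem_map_C_iff] at hXN
          have := hXN 1
          simp only [Polynomial.coeff_X_one] at this
          exact (inferInstance : P.IsPrime).ne_top ((Ideal.eq_top_iff_one _).2 this)
      have hprime : (P.map Polynomial.C).IsPrime := Ideal.isPrime_map_C_of_isPrime
      have hNprime : N.IsPrime := Ideal.IsPrime.comap _
      have key := pivot (q + 1) (by omega) M' (s.image Polynomial.C) (P.map Polynomial.C) ?_ ?_ ?_
        0 0 ?_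
      · refine le_trans ?_ (key.trans ?_)
        · gcongr
          exact height_le_height_map_C P
        · gcongr
          exact Finset.card_image_le
      · intro x hx
        simp only [Finset.coe_image, Set.mem_image] at hx
        obtain ⟨y, hy, rfl⟩ := hx
        exact Ideal.mem_map_of_mem _ (hs hy)
      · refine ⟨Pi.single 1 1, ⟨1, ?_⟩, fun b => ?_⟩
        · simp only [Pi.single_eq_same]
          exact fun h => hprime.ne_top ((Ideal.eq_top_iff_one _).2 h)
        · rw [Finset.sum_eq_single 1 (fun a _ ha => by simp [ha]) (by simp)]
          simp only [Pi.single_eq_same, one_mul, M', Matrix.add_apply, Matrix.map_apply]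
          rw [Matrix.single_apply_of_ne _ _ _ _ _ (by simp), add_zero]
          exact Ideal.mem_map_of_mem _ (hM _ _)
      · intro Q hQ hsQ hQM hQP
        refine eq_of_le_of_lt_of_mem_minimalPrimes hQP hPN Polynomial.X
          ⟨⟨hNprime, sup_le (hQP.trans hPN.le) ?_⟩, fun N' ⟨hN', hQN'⟩ hN'N => ?_⟩
        · rwa [Ideal.span_singleton_le_iff_mem]
        · rw [sup_le_iff, Ideal.span_singleton_le_iff_mem] at hQN'
          have hdep : RowsDep N' M' := hQM.mono hQN'.1
          have hCc : ∀ f : Polynomial R, f - Polynomial.C (f.eval 0) ∈ N' := by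
            intro f
            obtain ⟨g, hg⟩ := Polynomial.X_sub_C_dvd_sub_C_eval (p := f) (a := (0 : R))
            rw [hg, map_zero, sub_zero]
            exact N'.mul_mem_right _ hQN'.2
          have hcc : ∀ f : Polynomial R, f ∈ N' ↔ f.eval 0 ∈ N'.comap Polynomial.C := by
            intro f
            have := N'.add_mem_iff_right (b := Polynomial.C (f.eval 0)) (hCc f)
            rwa [sub_add_cancel] at this
          have hP0 : N'.comap Polynomial.C = P := by
            refine hmin _ (Ideal.IsPrime.comap _) (fun x hx => ?_) ?_ (fun x hx => ?_)
            · rw [SetLike.mem_coe, Ideal.mem_comap]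
              exact hQN'.1 (hsQ (by simpa using hx))
            · obtain ⟨v, ⟨a, ha⟩, hv⟩ := hdep
              refine ⟨fun a => (v a).eval 0, ⟨a, fun h => ha ((hcc _).2 h)⟩, fun b => ?_⟩
              have := (hcc _).1 (hv b)
              rw [Polynomial.eval_finsetSum] at this
              convert this using 2 with a
              rw [Polynomial.eval_mul]
              congr 1
              simp only [M', Matrix.add_apply, Matrix.map_apply, Matrix.single_apply]
              split_ifs <;> simp
            · have := hN'N hx
              simpa [N, Ideal.mem_comap] using this
          intro f hf
          rw [hcc, hP0]
          exact hf
      · simp only [M', Matrix.add_apply, Matrix.map_apply, Matrix.single_apply_same]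
        intro h
        rw [Ideal.mem_map_C_iff] at h
        have := h 1
        simp only [Polynomial.coeff_add, Polynomial.coeff_C_succ, Polynomial.coeff_X_one,
          zero_add] at this
        exact (inferInstance : P.IsPrime).ne_top ((Ideal.eq_top_iff_one _).2 this)

theorem exists_zero_of_notMem_prime {σ : Type*} [Finite σ] (P : Ideal (MvPolynomial σ ℂ))
    [P.IsPrime] {g : MvPolynomial σ ℂ} (hg : g ∉ P) :
    ∃ z : σ → ℂ, (∀ f ∈ P, eval z f = 0) ∧ eval z g ≠ 0 := by
  by_contra! h
  apply hg
  rw [← IsPrime.vanishingIdeal_zeroLocus (K := ℂ) P, mem_vanishingIdeal_iff]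
  intro z hz
  rw [mem_zeroLocus_iff] at hz
  simpa [aeval_eq_eval] using h z fun f hf => by simpa [aeval_eq_eval] using hz f hf

theorem height_of_isMaximal_fin (M : ℕ) : ∀ (P : Ideal (MvPolynomial (Fin M) ℂ)) [P.IsMaximal],
    P.height = M := by
  induction M with
  | zero =>
    intro P hP
    have h := Ideal.height_le_ringKrullDim_of_isPrime (I := P)
    rw [MvPolynomial.ringKrullDim_of_isNoetherianRing] at h
    simp only [ringKrullDim_eq_zero_of_field, Nat.card_eq_fintype_card, Fintype.card_fin,
      Nat.cast_zero, add_zero] at h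
    have h' : P.height ≤ 0 := by exact_mod_cast h
    simpa using h'
  | succ M ih =>
    intro P hP
    let e := (finSuccEquiv ℂ M).toRingEquiv
    let P' : Ideal (Polynomial (MvPolynomial (Fin M) ℂ)) := P.map e
    have hP' : P'.IsMaximal := Ideal.map_isMaximal_of_equiv e
    let p : Ideal (MvPolynomial (Fin M) ℂ) := P'.comap Polynomial.C
    have hp : p.IsMaximal := Polynomial.isMaximal_comap_C_of_isJacobsonRing P'
    have : P'.LiesOver p := ⟨rfl⟩
    have h := Polynomial.height_eq_height_add_one p P'
    rw [ih p] at h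
    rw [← e.height_map P, h]
    simp

theorem height_of_isMaximal {σ : Type*} [Fintype σ] (P : Ideal (MvPolynomial σ ℂ))
    [P.IsMaximal] : P.height = Fintype.card σ := by
  let e := (renameEquiv ℂ (Fintype.equivFin σ)).toRingEquiv
  have : (P.map e).IsMaximal := Ideal.map_isMaximal_of_equiv e
  rw [← e.height_map P, height_of_isMaximal_fin]

/-- Away from the other components of a set of parameters of `Q`, adding `s.card` equations to `Q`
raises the height by at most `s.card`. -/
theorem exists_notMem_forall_height_le {R : Type*} [CommRing R] [IsNoetherianRing R]
    (Q : Ideal R) [Q.IsPrime] : ∃ g ∉ Q, ∀ (N : Ideal R) (s : Finset R), g ∉ N →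
      N ∈ (Q ⊔ Ideal.span s).minimalPrimes → N.height ≤ Q.height + s.card := by
  classical
  obtain ⟨t, ht, htc⟩ := Q.exists_finset_card_eq_height_of_isNoetherianRing
  have hfin := (Ideal.span (t : Set R)).finite_minimalPrimes_of_isNoetherianRing
  have hex : ∃ g ∉ Q, ∀ Q' ∈ (Ideal.span (t : Set R)).minimalPrimes, Q' ≠ Q → g ∈ Q' := by
    have : ∀ Q' : Ideal R, ∃ g ∉ Q, Q' ∈ (Ideal.span (t : Set R)).minimalPrimes → Q' ≠ Q →
        g ∈ Q' := by
      intro Q'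
      by_cases h : Q' ∈ (Ideal.span (t : Set R)).minimalPrimes ∧ Q' ≠ Q
      · have : ¬ Q' ≤ Q := fun hle => h.2 (le_antisymm hle (ht.2 h.1.1 hle))
        obtain ⟨g, hg, hgQ⟩ := SetLike.not_le_iff_exists.1 this
        exact ⟨g, hgQ, fun _ _ => hg⟩
      · exact ⟨1, fun h1 => (inferInstance : Q.IsPrime).ne_top ((Ideal.eq_top_iff_one _).2 h1),
          fun h1 h2 => (h ⟨h1, h2⟩).elim⟩
    choose g hg hgm using this
    refine ⟨∏ Q' ∈ hfin.toFinset, g Q', fun h => ?_, fun Q' hQ' hne => ?_⟩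
    · obtain ⟨Q', -, hQ'⟩ := Ideal.IsPrime.prod_mem_iff.1 h
      exact hg Q' hQ'
    · exact Ideal.mem_of_dvd _ (Finset.dvd_prod_of_mem g (hfin.mem_toFinset.2 hQ')) (hgm Q' hQ' hne)
  obtain ⟨g, hgQ, hg⟩ := hex
  refine ⟨g, hgQ, fun N s hgN hN => ?_⟩
  have hmin : N ∈ (Ideal.span ((t ∪ s : Finset R) : Set R)).minimalPrimes := by
    rw [Finset.coe_union, Ideal.span_union]
    refine ⟨⟨hN.1.1, sup_le (ht.1.2.trans (le_sup_left.trans hN.1.2))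
      (le_sup_right.trans hN.1.2)⟩, fun N' ⟨hN', hle⟩ hN'N => hN.2 ⟨hN', ?_⟩ hN'N⟩
    rw [sup_le_iff] at hle ⊢
    refine ⟨?_, hle.2⟩
    obtain ⟨Q', hQ', hQ'N⟩ := Ideal.exists_minimalPrimes_le hle.1
    by_cases hne : Q' = Q
    · exact hne ▸ hQ'N
    · exact (hgN (hN'N (hQ'N (hg Q' hQ' hne)))).elim
  refine (Ideal.height_le_card_of_mem_minimalPrimes_span_finset hmin).trans ?_
  rw [← htc]
  exact_mod_cast Finset.card_union_le t s

theorem exists_algebraicIndependent_quotient {σ : Type*} [Fintype σ]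
    (P : Ideal (MvPolynomial σ ℂ)) [P.IsPrime] :
    ∃ (m : ℕ) (b : Fin m → MvPolynomial σ ℂ ⧸ P), AlgebraicIndependent ℂ b ∧
      (Fintype.card σ : ℕ∞) ≤ P.height + m := by
  classical
  obtain ⟨m, φ, hinj, hint⟩ := exists_integral_inj_algHom_of_fg ℂ (MvPolynomial σ ℂ ⧸ P)
  obtain ⟨g, hgP, hg⟩ := exists_notMem_forall_height_le P
  obtain ⟨z, hz, hgz⟩ := exists_zero_of_notMem_prime P hgP
  have hφ : φ = aeval fun j => φ (X j) := by ext j; simp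
  refine ⟨m, fun j => φ (X j), ?_, ?_⟩
  · rw [AlgebraicIndependent, ← hφ]; exact hinj
  let N : Ideal (MvPolynomial σ ℂ) := RingHom.ker (eval z)
  have hNmax : N.IsMaximal := RingHom.ker_isMaximal_of_surjective _ fun c => ⟨C c, by simp⟩
  have hPN : P ≤ N := fun f hf => hz f hf
  choose b hb using fun j => Ideal.Quotient.mk_surjective (φ (X j))
  let s : Finset (MvPolynomial σ ℂ) := Finset.univ.image fun j => b j - C (eval z (b j))
  have hs : s.card ≤ m := Finset.card_image_le.trans (by simp)
  have hmin : N ∈ (P ⊔ Ideal.span (s : Set (MvPolynomial σ ℂ))).minimalPrimes := by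
    refine ⟨⟨inferInstance, sup_le hPN ?_⟩, fun N' ⟨hN', hle⟩ hN'N => ?_⟩
    · rw [Ideal.span_le]
      intro x hx
      simp only [s, Finset.coe_image, Set.mem_image] at hx
      obtain ⟨j, -, rfl⟩ := hx
      simp [N, RingHom.mem_ker]
    · rw [sup_le_iff, Ideal.span_le] at hle
      have hker : RingHom.ker (Ideal.Quotient.mk P) ≤ N' := Ideal.mk_ker.trans_le hle.1
      have hpr : (N'.map (Ideal.Quotient.mk P)).IsPrime :=
        Ideal.map_isPrime_of_surjective Ideal.Quotient.mk_surjective hker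
      have hcm : ((N'.map (Ideal.Quotient.mk P)).comap φ.toRingHom).IsMaximal := by
        have hw : (RingHom.ker (eval fun j => eval z (b j)) : Ideal (MvPolynomial (Fin m) ℂ)).IsMaximal :=
          RingHom.ker_isMaximal_of_surjective _ fun c => ⟨C c, by simp⟩
        have hle2 : RingHom.ker (eval fun j => eval z (b j)) ≤
            (N'.map (Ideal.Quotient.mk P)).comap φ.toRingHom := by
          intro f hf
          rw [RingHom.mem_ker] at hf
          rw [Ideal.mem_comap]
          have h1 : φ f = Ideal.Quotient.mk P (aeval b f) := by
            have : φ = (Ideal.Quotient.mkₐ ℂ P).comp (aeval b) := by ext j; simp [hb]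
            rw [this]; rfl
          change φ f ∈ _
          rw [h1]
          apply Ideal.mem_map_of_mem
          rw [← Ideal.Quotient.eq_zero_iff_mem]
          have h2 : Ideal.Quotient.mk N' (aeval b f) =
              Ideal.Quotient.mk N' (aeval (fun j => C (eval z (b j))) f) := by
            have : (Ideal.Quotient.mkₐ ℂ N').comp (aeval b) =
                (Ideal.Quotient.mkₐ ℂ N').comp (aeval (fun j => C (eval z (b j)))) := by
              ext j
              simp only [AlgHom.comp_apply, aeval_X, Ideal.Quotient.mkₐ_eq_mk]
              rw [Ideal.Quotient.eq]
              exact hle.2 (by simp [s])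
            exact congrArg (fun ψ => ψ f) this
          rw [h2]
          have h3 : aeval (fun j => (C (eval z (b j)) : MvPolynomial σ ℂ)) f =
              C (eval (fun j => eval z (b j)) f) := by
            have : (aeval (fun j => (C (eval z (b j)) : MvPolynomial σ ℂ))) =
                (Algebra.ofId ℂ (MvPolynomial σ ℂ)).comp (aeval (fun j => eval z (b j))) := by
              ext j; simp [Algebra.ofId_apply, algebraMap_eq]
            rw [this, AlgHom.comp_apply, aeval_eq_eval]
            rfl
          rw [h3, hf, map_zero, map_zero]
        have := hw.eq_of_le (Ideal.IsPrime.comap _).ne_top hle2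
        rw [← this]; exact hw
      have hmax : (N'.map (Ideal.Quotient.mk P)).IsMaximal :=
        Ideal.isMaximal_of_isIntegral_of_isMaximal_comap' φ.toRingHom hint _ hcm
      have hN'max : N'.IsMaximal := by
        have := Ideal.comap_isMaximal_of_surjective (Ideal.Quotient.mk P)
          Ideal.Quotient.mk_surjective (K := N'.map (Ideal.Quotient.mk P))
        rwa [Ideal.comap_map_of_surjective _ Ideal.Quotient.mk_surjective,
          ← RingHom.ker_eq_comap_bot, sup_eq_left.2 hker] at this
      exact (hN'max.eq_of_le hNmax.ne_top hN'N).ge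
  have := hg N s (by simpa [N, RingHom.mem_ker] using hgz) hmin
  rw [height_of_isMaximal] at this
  refine this.trans ?_
  gcongr

theorem exists_derivation_of_formallyEtale (R S T : Type*) [CommRing R] [CommRing S] [CommRing T]
    [Algebra R S] [Algebra R T] [Algebra S T] [IsScalarTower R S T] [Algebra.FormallyEtale S T]
    (d : Derivation R S T) : ∃ D : Derivation R T T, ∀ s, D (algebraMap S T s) = d s := by
  let ψ : Ω[T⁄R] →ₗ[T] T := (d.liftKaehlerDifferential.liftBaseChange T) ∘ₗ
    (KaehlerDifferential.tensorKaehlerEquivOfFormallyEtale R S T).symm.toLinearMap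
  refine ⟨ψ.compDer (KaehlerDifferential.D R T), fun s => ?_⟩
  simp only [ψ, Derivation.coe_comp, LinearMap.coe_comp, Function.comp_apply]
  change (d.liftKaehlerDifferential.liftBaseChange T)
    ((KaehlerDifferential.tensorKaehlerEquivOfFormallyEtale R S T).symm
      (KaehlerDifferential.D R T (algebraMap S T s))) = _
  rw [KaehlerDifferential.tensorKaehlerEquivOfFormallyEtale_symm_D_algebraMap]
  simp

theorem formallyEtale_of_isAlgebraic.{u} (S K : Type u) [CommRing S] [IsDomain S] [CharZero S]
    [Field K] [Algebra S K] [FaithfulSMul S K] [Algebra.IsAlgebraic S K] :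
    Algebra.FormallyEtale S K := by
  let L := FractionRing S
  let _ : Algebra L K := FractionRing.liftAlgebra S K
  have : IsScalarTower S L K := FractionRing.isScalarTower_liftAlgebra S K
  have : CharZero L := charZero_of_injective_algebraMap (IsFractionRing.injective S L)
  have : Algebra.IsAlgebraic L K := Algebra.IsAlgebraic.extendScalars (IsFractionRing.injective S L)
  have : Algebra.FormallyEtale L K := Algebra.FormallyEtale.of_isSeparable L K
  have : Algebra.FormallyEtale S L := Algebra.FormallyEtale.of_isLocalization (nonZeroDivisors S)
  exact Algebra.FormallyEtale.comp S L K

/-- In characteristic zero, a derivation may be prescribed on an algebraically independent family. -/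
theorem exists_derivation_of_algebraicIndependent.{u} {ι : Type*} {k : Type} {K : Type u} [Field k]
    [CharZero k] [Field K] [Algebra k K] {b : ι → K} (hb : AlgebraicIndependent k b) (w : ι → K) :
    ∃ D : Derivation k K K, ∀ j, D (b j) = w j := by
  classical
  obtain ⟨s, hs, htb⟩ := exists_isTranscendenceBasis_superset hb.coe_range
  let φ : MvPolynomial s k →ₐ[k] K := aeval (fun x : s => (x : K))
  have hφ : Function.Injective φ := htb.1
  let _ : Algebra (MvPolynomial s k) K := φ.toRingHom.toAlgebra
  have : FaithfulSMul (MvPolynomial s k) K := (faithfulSMul_iff_algebraMap_injective _ K).2 hφ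
  have hST : IsScalarTower k (MvPolynomial s k) K := IsScalarTower.of_algebraMap_eq fun x => by
    change _ = φ _
    rw [AlgHom.commutes]
  have halg : Algebra.IsAlgebraic (MvPolynomial s k) K := by
    have h1 := htb.isAlgebraic
    exact Algebra.IsAlgebraic.of_ringHom_of_comp_eq htb.1.aevalEquiv.toRingEquiv (RingHom.id K)
      htb.1.aevalEquiv.surjective Function.injective_id (RingHom.ext fun x => by
        change ((htb.1.aevalEquiv x : Algebra.adjoin k _) : K) = φ x
        simp [φ])
  have : Algebra.FormallyEtale (MvPolynomial s k) K := formallyEtale_of_isAlgebraic _ K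
  let v : s → K := fun x => if h : ∃ j, b j = x then w h.choose else 0
  obtain ⟨D, hD⟩ := exists_derivation_of_formallyEtale k (MvPolynomial s k) K (mkDerivation k v)
  refine ⟨D, fun j => ?_⟩
  have hmem : b j ∈ s := hs ⟨j, rfl⟩
  have h1 := hD (X ⟨b j, hmem⟩)
  have h2 : algebraMap (MvPolynomial s k) K (X ⟨b j, hmem⟩) = b j := by
    change φ _ = _
    simp [φ]
  rw [h2, mkDerivation_X] at h1
  rw [h1]
  have hex : ∃ j', b j' = b j := ⟨j, rfl⟩
  simp only [v, dif_pos hex]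
  congr 1
  exact hb.injective hex.choose_spec

theorem derivation_aeval {k K σ : Type*} [Field k] [Field K] [Algebra k K] [Fintype σ]
    (D : Derivation k K K) (x : σ → K) (f : MvPolynomial σ k) :
    D (aeval x f) = ∑ j, aeval x (pderiv j f) * D (x j) := by
  classical
  induction f using MvPolynomial.induction_on with
  | C a => simp
  | add f g hf hg => simp [hf, hg, add_mul, Finset.sum_add_distrib]
  | mul_X f i hf =>
    have hX : ∑ j, aeval x f * aeval x (pderiv j (X i : MvPolynomial σ k)) * D (x j) =
        aeval x f * D (x i) := by
      rw [Finset.sum_eq_single i (fun j _ hj => by simp [pderiv_X, hj.symm])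
        (by simp)]
      simp
    simp only [map_mul, aeval_X, Derivation.leibniz, hf, smul_eq_mul, map_add, add_mul,
      Finset.sum_add_distrib, hX, Finset.mul_sum]
    congr 1
    exact Finset.sum_congr rfl fun _ _ => by ring

/-- The truncated Jacobian matrix `jac(G, i)`. -/
abbrev polarJac {n p : ℕ} (G : Fin p → MvPolynomial (Fin n) ℂ) (i : ℕ) :
    Matrix (Fin p) (Fin (n - i)) (MvPolynomial (Fin n) ℂ) :=
  Matrix.of fun a b => pderiv (colIdx n i b) (G a)

theorem polarIdeal_le_iff {n p : ℕ} (G : Fin p → MvPolynomial (Fin n) ℂ) (i : ℕ)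
    (Q : Ideal (MvPolynomial (Fin n) ℂ)) [Q.IsPrime] :
    polarIdeal G i ≤ Q ↔ (∀ j, G j ∈ Q) ∧ RowsDep Q (polarJac G i) := by
  rw [polarIdeal, Ideal.span_le, Set.union_subset_iff, Set.range_subset_iff, rowsDep_iff]
  refine and_congr Iff.rfl ⟨fun h c => h ⟨c, rfl⟩, ?_⟩
  rintro h _ ⟨c, rfl⟩
  exact h c

theorem height_le_of_mem_minimalPrimes_polarIdeal {n p : ℕ} (G : Fin p → MvPolynomial (Fin n) ℂ)
    (i : ℕ) (hi : p ≤ n - i + 1) {P : Ideal (MvPolynomial (Fin n) ℂ)}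
    (hP : P ∈ (polarIdeal G i).minimalPrimes) : P.height ≤ (n - i + 1 : ℕ) := by
  classical
  have hPp : P.IsPrime := hP.1.1
  have hPle := (polarIdeal_le_iff G i P).1 hP.1.2
  have h := height_add_le_of_minimal_rowsDep p (n - i) hi (polarJac G i) (Finset.univ.image G) P
    (by simpa [Set.range_subset_iff] using hPle.1) hPle.2 fun Q hQ hsQ hQd hQP =>
      le_antisymm hQP (hP.2 ⟨hQ, (polarIdeal_le_iff G i Q).2
        ⟨fun j => hsQ (by simp), hQd⟩⟩ hQP)
  have hc : (Finset.univ.image G).card ≤ p := Finset.card_image_le.trans (by simp)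
  have h2 : P.height + p ≤ (n - i + 1 : ℕ) + p := by
    refine h.trans ?_
    have : (Finset.univ.image G).card + (n - i) + 1 ≤ n - i + 1 + p := by omega
    exact_mod_cast this
  exact (ENat.add_le_add_iff_right (by simp)).1 h2

theorem pderiv_inr_rename_inl {n p : ℕ} (k : Fin p) (f : MvPolynomial (Fin n) ℂ) :
    pderiv (Sum.inr k) (rename (Sum.inl : Fin n → Fin n ⊕ Fin p) f) = 0 := by
  classical
  refine pderiv_eq_zero_of_notMem_vars fun h => ?_
  have := vars_rename _ _ h
  simp at this

theorem pderiv_inr_lagEntry {n p : ℕ} (G : Fin p → MvPolynomial (Fin n) ℂ) (i : ℕ)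
    (c : Fin (n - i)) (k : Fin p) :
    pderiv (Sum.inr k) (lagEntry G i c) = rename Sum.inl (pderiv (colIdx n i c) (G k)) := by
  classical
  simp [lagEntry, Derivation.leibniz, pderiv_inr_rename_inl, pderiv_X, Pi.single_apply]

theorem le_height_of_isRegularValueOn {n p : ℕ} (G : Fin p → MvPolynomial (Fin n) ℂ)
    (i : ℕ) (hreg : IsRegularValueOn (hSys G i) {z | z ∘ Sum.inr ≠ 0})
    (P : Ideal (MvPolynomial (Fin n) ℂ)) [P.IsPrime] (hP : polarIdeal G i ≤ P) :
    ((n - i + 1 : ℕ) : ℕ∞) ≤ P.height := by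
  classical
  obtain ⟨hG, ℓ, ⟨a, ha⟩, hℓ⟩ := (polarIdeal_le_iff G i P).1 hP
  let K := FractionRing (MvPolynomial (Fin n) ℂ ⧸ P)
  let π : MvPolynomial (Fin n) ℂ →ₐ[ℂ] K :=
    (IsScalarTower.toAlgHom ℂ (MvPolynomial (Fin n) ℂ ⧸ P) K).comp (Ideal.Quotient.mkₐ ℂ P)
  have hπ : ∀ f, π f = 0 ↔ f ∈ P := fun f => by
    change algebraMap (MvPolynomial (Fin n) ℂ ⧸ P) K (Ideal.Quotient.mk P f) = 0 ↔ _
    rw [FaithfulSMul.algebraMap_eq_zero_iff, Ideal.Quotient.eq_zero_iff_mem]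
  have hπX : ∀ f, π f = aeval (fun k => π (X k)) f := fun f => by
    have : π = aeval fun k => π (X k) := by ext; simp
    exact congrArg (fun ψ => ψ f) this
  let y : Fin n ⊕ Fin p → MvPolynomial (Fin n) ℂ := Sum.elim X ℓ
  let ξ : Fin n ⊕ Fin p → K := fun k => π (y k)
  have hξ : ∀ f, aeval ξ f = π (aeval y f) := fun f => by
    have : aeval ξ = π.comp (aeval y) := by ext; simp [ξ]
    rw [this]; rfl
  have hyren : ∀ f, aeval y (rename Sum.inl f) = f := fun f => by
    rw [aeval_rename]
    simp [y, Function.comp_def]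
  have hsysP : ∀ j, aeval y (hSys G i j) ∈ P := by
    rintro (j | c)
    · change aeval y (rename Sum.inl (G j)) ∈ P
      rw [hyren]
      exact hG j
    · change aeval y (lagEntry G i c) ∈ P
      simp only [lagEntry, map_sum, map_mul, aeval_X, hyren]
      exact hℓ c
  let Jr : Matrix (Fin p ⊕ Fin (n - i)) (Fin n ⊕ Fin p) (MvPolynomial (Fin n) ℂ) :=
    Matrix.of fun j k => aeval y (pderiv k (hSys G i j))
  have hdep : ¬ RowsDep P Jr := by
    rintro ⟨v, ⟨b, hb⟩, hv⟩
    obtain ⟨z, hz, hzne⟩ := exists_zero_of_notMem_prime P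
      (fun h => ((inferInstance : P.IsPrime).mem_or_mem h).elim ha hb : ℓ a * v b ∉ P)
    rw [map_mul, mul_ne_zero_iff] at hzne
    let w : Fin n ⊕ Fin p → ℂ := fun k => eval z (y k)
    have hw : ∀ f, eval w f = eval z (aeval y f) := fun f => by
      have : aeval w = (aeval z).comp (aeval y) := by
        ext k; simp [w, aeval_eq_eval]
      have h2 := congrArg (fun ψ => ψ f) this
      simpa [aeval_eq_eval] using h2
    have hrank := hreg w (fun h => hzne.1 (by simpa [w, y] using congrFun h a))
      fun j => by rw [hw]; exact hz _ (hsysP j)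
    have hli : LinearIndependent ℂ (jacEval (hSys G i) w).row := by
      rw [linearIndependent_iff_card_eq_finrank_span, ← hrank, Matrix.rank_eq_finrank_span_row]
      rfl
    refine hzne.2 (Fintype.linearIndependent_iff.1 hli (fun j => eval z (v j)) ?_ b)
    ext k
    have := hz _ (hv k)
    simpa [Finset.sum_apply, jacEval, hw, Jr, Matrix.row] using this
  have hliK := linearIndependent_of_not_rowsDep P Jr hdep
  let JK : Matrix (Fin p ⊕ Fin (n - i)) (Fin n ⊕ Fin p) K :=
    Matrix.of fun j k => aeval ξ (pderiv k (hSys G i j))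
  have hJK : JK = Jr.map fun x => algebraMap (MvPolynomial (Fin n) ℂ ⧸ P) K
      (Ideal.Quotient.mk P x) := by
    ext j k
    exact hξ _
  have hrank : JK.rank = p + (n - i) := by
    have := LinearIndependent.rank_matrix (M := JK) (by rw [hJK]; exact hliK)
    simpa using this
  obtain ⟨m, b, hb, hcard⟩ := exists_algebraicIndependent_quotient P
  have hbK : AlgebraicIndependent ℂ fun j => algebraMap (MvPolynomial (Fin n) ℂ ⧸ P) K (b j) :=
    hb.map' (f := IsScalarTower.toAlgHom ℂ (MvPolynomial (Fin n) ℂ ⧸ P) K)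
      (IsFractionRing.injective _ K)
  choose D hD using fun l : Fin m => exists_derivation_of_algebraicIndependent hbK (Pi.single l 1)
  let u : Option (Fin m) → Fin n ⊕ Fin p → K := fun o =>
    o.elim (Sum.elim 0 fun j => π (ℓ j)) fun l k => D l (ξ k)
  have hu : ∀ o, u o ∈ LinearMap.ker JK.mulVecLin := by
    intro o
    rw [LinearMap.mem_ker]
    ext j
    simp only [Matrix.mulVecLin_apply, Matrix.mulVec, dotProduct, Pi.zero_apply]
    obtain _ | l := o
    · simp only [u, Option.elim_none, Fintype.sum_sum_type, Sum.elim_inl, Sum.elim_inr,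
        Pi.zero_apply, mul_zero, Finset.sum_const_zero, zero_add, JK, Matrix.of_apply]
      have hlag : ∀ j, π (∑ k, aeval y (pderiv (Sum.inr k) (hSys G i j)) * ℓ k) = 0 := by
        rintro (j | c)
        · have hz : ∀ k : Fin p, pderiv (Sum.inr k) (hSys G i (Sum.inl j)) = 0 := fun k =>
            pderiv_inr_rename_inl k (G j)
          simp only [hz, map_zero, zero_mul, Finset.sum_const_zero]
        · have hz : ∀ k : Fin p, pderiv (Sum.inr k) (hSys G i (Sum.inr c)) =
              rename Sum.inl (pderiv (colIdx n i c) (G k)) := fun k => pderiv_inr_lagEntry G i c k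
          rw [hπ]
          simp only [hz, hyren]
          exact (congrArg (· ∈ P) (Finset.sum_congr rfl fun k _ => mul_comm _ _)).mp (hℓ c)
      have h1 := hlag j
      rw [map_sum] at h1
      simp only [map_mul, ← hξ] at h1
      exact h1
    · have h1 := derivation_aeval (D l) ξ (hSys G i j)
      rw [hξ, (hπ _).2 (hsysP j), map_zero] at h1
      exact h1.symm
  have hli : LinearIndependent K u := by
    rw [Fintype.linearIndependent_iff]
    intro c hc
    have hcl : ∀ l, c (some l) = 0 := by
      intro l
      let E : Derivation ℂ K K := ∑ l, c (some l) • D l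
      have hE : ∀ x, E x = ∑ l, c (some l) * D l x := fun x => by
        have h1 := congrFun (map_sum (Derivation.coeFnAddMonoidHom (R := ℂ) (A := K) (M := K))
          (fun l => c (some l) • D l) Finset.univ) x
        rw [Finset.sum_apply] at h1
        exact h1
      have hEx : ∀ k, E (π (X k)) = 0 := by
        intro k
        have := congrFun hc (Sum.inl k)
        rw [hE]
        simpa [Fintype.sum_option, u, Finset.sum_apply, ξ, y] using this
      have hEf : ∀ f, E (π f) = 0 := fun f => by
        rw [hπX, derivation_aeval]
        simp [hEx]
      obtain ⟨f, hf⟩ := Ideal.Quotient.mk_surjective (b l)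
      have h1 := hEf f
      rw [show π f = algebraMap (MvPolynomial (Fin n) ℂ ⧸ P) K (b l) by rw [← hf]; rfl, hE] at h1
      simpa [hD, Pi.single_apply] using h1
    rintro (_ | l)
    · have := congrFun hc (Sum.inr a)
      simp only [Fintype.sum_option, hcl, zero_smul, Finset.sum_const_zero, add_zero, u,
        Option.elim_none, Pi.smul_apply, Sum.elim_inr, smul_eq_mul, Pi.zero_apply,
        mul_eq_zero] at this
      exact this.resolve_right fun h => ha ((hπ _).1 h)
    · exact hcl l
  have hker := LinearMap.finrank_range_add_finrank_ker JK.mulVecLin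
  have hle : m + 1 ≤ Module.finrank K (LinearMap.ker JK.mulVecLin) := by
    have h2 : LinearIndependent K fun o => (⟨u o, hu o⟩ : LinearMap.ker JK.mulVecLin) :=
      LinearIndependent.of_comp (LinearMap.ker JK.mulVecLin).subtype hli
    simpa using h2.fintype_card_le_finrank
  rw [← Matrix.rank, hrank] at hker
  simp only [Module.finrank_fintype_fun_eq_card, Fintype.card_sum, Fintype.card_fin] at hker
  have hmn : n - i + 1 + m ≤ n := by omega
  rw [Fintype.card_fin] at hcard
  have h3 : ((n - i + 1 : ℕ) : ℕ∞) + m ≤ P.height + m := le_trans (by exact_mod_cast hmn) hcard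
  exact (ENat.add_le_add_iff_right (by simp)).1 h3

theorem choose_succ_add_le (k E d : ℕ) :
    (k + 1 + (E + d)).choose (k + 1) ≤ d * (k + (E + d)).choose k + (k + 1 + E).choose (k + 1) := by
  induction d with
  | zero => simp
  | succ d ih =>
    have h1 : (k + 1 + (E + (d + 1))).choose (k + 1) =
        (k + (E + (d + 1))).choose k + (k + 1 + (E + d)).choose (k + 1) := by
      rw [show k + 1 + (E + (d + 1)) = (k + (E + (d + 1))) + 1 by ring, Nat.choose_succ_succ',
        show k + (E + (d + 1)) = k + 1 + (E + d) by ring]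
    have h2 : (k + (E + d)).choose k ≤ (k + (E + (d + 1))).choose k :=
      Nat.choose_le_choose _ (by omega)
    have h3 := Nat.mul_le_mul_left d h2
    rw [h1]
    linarith

theorem choose_succ_le_of_lt (k : ℕ) {E d : ℕ} (h : E < d) :
    (k + 1 + E).choose (k + 1) ≤ d * (k + E).choose k := by
  have h1 := choose_succ_add_le k 0 E
  have h2 : 1 ≤ (k + E).choose k := Nat.choose_pos (by omega)
  simp only [zero_add, add_zero, Nat.choose_self] at h1
  nlinarith

/-- Growth of a double sequence of Hilbert functions along a chain of hypersurface sections of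
bidegree `(1, d)`. -/
theorem mul_choose_le_pow_mul_of_hilbert_chain {c d e κ B : ℕ} (H : ℕ → ℕ → ℕ → ℕ)
    (h0 : ∀ D E, e ≤ D → B * (κ + E).choose κ ≤ H 0 D E)
    (hmono : ∀ s < c, ∀ D E, H s D E ≤ H (s + 1) D E)
    (hstep : ∀ s < c, ∀ D E, H s (D + 1) (E + d) + H (s + 1) D E ≤ H (s + 1) (D + 1) (E + d))
    (s : ℕ) (hs : s ≤ c) (x : ℕ) : ∀ E D, E < d * (x + 1) → e + x ≤ D →
      B * (κ + s + E).choose (κ + s) ≤ d ^ s * H s D E := by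
  induction s generalizing x with
  | zero => intro E D _ hD; simpa using h0 D E (by omega)
  | succ s ih =>
    induction x with
    | zero =>
      intro E D hE hD
      calc B * (κ + (s + 1) + E).choose (κ + (s + 1))
          ≤ B * (d * (κ + s + E).choose (κ + s)) :=
            Nat.mul_le_mul_left _ (choose_succ_le_of_lt (κ + s) (by simpa using hE))
        _ = d * (B * (κ + s + E).choose (κ + s)) := by ring
        _ ≤ d * (d ^ s * H s D E) := Nat.mul_le_mul_left _ (ih (by omega) 0 E D hE hD)
        _ ≤ d * (d ^ s * H (s + 1) D E) := by gcongr; exact hmono s (by omega) D E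
        _ = d ^ (s + 1) * H (s + 1) D E := by ring
    | succ x ihx =>
      intro E D hE hD
      rcases lt_or_ge E (d * (x + 1)) with hlt | hge
      · exact ihx E D hlt (by omega)
      · obtain ⟨E, rfl⟩ : ∃ E', E = E' + d := ⟨E - d, by
          have : d ≤ d * (x + 1) := Nat.le_mul_of_pos_right _ (by omega)
          omega⟩
        obtain ⟨D, rfl⟩ : ∃ D', D = D' + 1 := ⟨D - 1, by omega⟩
        have h1 := ihx E D (by rw [mul_add] at hE; omega) (by omega)
        have h2 := ih (by omega) (x + 1) (E + d) (D + 1) hE hD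
        have h3 := hstep s (by omega) D E
        calc B * (κ + (s + 1) + (E + d)).choose (κ + (s + 1))
            ≤ B * (d * (κ + s + (E + d)).choose (κ + s) +
                (κ + (s + 1) + E).choose (κ + (s + 1))) :=
              Nat.mul_le_mul_left _ (choose_succ_add_le (κ + s) E d)
          _ = d * (B * (κ + s + (E + d)).choose (κ + s)) +
                B * (κ + (s + 1) + E).choose (κ + (s + 1)) := by ring
          _ ≤ d * (d ^ s * H s (D + 1) (E + d)) + d ^ (s + 1) * H (s + 1) D E := by gcongr
          _ = d ^ (s + 1) * (H s (D + 1) (E + d) + H (s + 1) D E) := by ring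
          _ ≤ d ^ (s + 1) * H (s + 1) (D + 1) (E + d) := by gcongr

theorem pow_mul_ascFactorial_le (a x N : ℕ) :
    a ^ N * (a + x).ascFactorial N ≤ (a + x) ^ N * a.ascFactorial N := by
  induction N with
  | zero => simp
  | succ N ih =>
    rw [Nat.ascFactorial_succ, Nat.ascFactorial_succ, pow_succ, pow_succ]
    have h : a * (a + x + N) ≤ (a + x) * (a + N) := by nlinarith
    calc a ^ N * a * ((a + x + N) * (a + x).ascFactorial N)
        = (a * (a + x + N)) * (a ^ N * (a + x).ascFactorial N) := by ring
      _ ≤ ((a + x) * (a + N)) * ((a + x) ^ N * a.ascFactorial N) := Nat.mul_le_mul h ih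
      _ = _ := by ring

theorem succ_pow_lt_three_mul_pow {N : ℕ} (hN : 0 < N) : (N + 1) ^ N < 3 * N ^ N := by
  have hN' : (0 : ℝ) < N := by exact_mod_cast hN
  have h1 : (1 + 1 / (N : ℝ)) ^ N ≤ Real.exp 1 := by
    calc (1 + 1 / (N : ℝ)) ^ N ≤ (Real.exp (1 / N)) ^ N := by
          gcongr
          linarith [Real.add_one_le_exp (1 / (N : ℝ))]
      _ = Real.exp 1 := by
          rw [← Real.exp_nat_mul]
          field_simp
  have h2 : (1 + 1 / (N : ℝ)) ^ N < 3 := h1.trans_lt (Real.exp_one_lt_d9.trans (by norm_num))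
  have h3 : ((N : ℝ) + 1) ^ N = (1 + 1 / (N : ℝ)) ^ N * (N : ℝ) ^ N := by
    rw [← mul_pow]
    congr 1
    field_simp
  have h4 : ((N : ℝ) + 1) ^ N < 3 * (N : ℝ) ^ N := by
    rw [h3]
    gcongr
  exact_mod_cast h4

theorem choose_add_lt_three_mul_choose {N x e : ℕ} (hN : 0 < N) (hx : 0 < x)
    (he : e + 1 = N * x) : (N + (e + x)).choose N < 3 * (N + e).choose N := by
  have h1 := pow_mul_ascFactorial_le (e + 1) x N
  have h2 : e + 1 + x = (N + 1) * x := by rw [he]; ring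
  rw [show e + 1 + x = (e + x) + 1 by ring, Nat.ascFactorial_eq_factorial_mul_choose,
    Nat.ascFactorial_eq_factorial_mul_choose, show e + x + 1 = (N + 1) * x by rw [← h2]; ring, he,
    mul_pow, mul_pow, add_comm (e + x) N, add_comm e N] at h1
  have h3 : N ^ N * (N + (e + x)).choose N ≤ (N + 1) ^ N * (N + e).choose N := by
    refine le_of_mul_le_mul_left (a := x ^ N * N.factorial) ?_ (by positivity)
    calc _ = N ^ N * x ^ N * (N.factorial * (N + (e + x)).choose N) := by ring
      _ ≤ _ := h1
      _ = _ := by ring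
  have h4 : 0 < (N + e).choose N := Nat.choose_pos (by omega)
  have h5 := Nat.mul_lt_mul_of_pos_right (succ_pow_lt_three_mul_pow hN) h4
  refine Nat.lt_of_mul_lt_mul_left (a := N ^ N) (h3.trans_lt ?_)
  calc _ < _ := h5
    _ = _ := by ring

/-- No double sequence of Hilbert functions can grow as in a chain of `c` sections of bidegree
`(1, d)` starting in degree `e + 1 = N * (3 * (M + 1) * d ^ (c - 1))`. -/
theorem not_hilbert_chain {N M c d e κ : ℕ} (hN : 0 < N) (hd : 0 < d) (hc : 0 < c)
    (hκ : κ + c = M + 1) (he : e + 1 = N * (3 * (M + 1) * d ^ (c - 1))) (H : ℕ → ℕ → ℕ → ℕ)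
    (h0 : ∀ D E, e ≤ D → (N + e).choose N * (κ + E).choose κ ≤ H 0 D E)
    (hmono : ∀ s < c, ∀ D E, H s D E ≤ H (s + 1) D E)
    (hstep : ∀ s < c, ∀ D E, H s (D + 1) (E + d) + H (s + 1) D E ≤ H (s + 1) (D + 1) (E + d))
    (htop : ∀ D E, H c D E ≤ (N + D).choose N * (M + E).choose M) : False := by
  set x := 3 * (M + 1) * d ^ (c - 1) with hx
  have hxpos : 0 < x := by positivity
  have h1 := mul_choose_le_pow_mul_of_hilbert_chain H h0 hmono hstep c le_rfl x (d * x)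
    (e + x) (by nlinarith) le_rfl
  have h2 := h1.trans (Nat.mul_le_mul_left _ (htop (e + x) (d * x)))
  rw [hκ] at h2
  have h3 := choose_add_lt_three_mul_choose hN hxpos he
  have h4 : (M + 1) * (M + 1 + d * x).choose (M + 1) = (M + 1 + d * x) * (M + d * x).choose M := by
    have := Nat.add_one_mul_choose_eq (M + d * x) M
    rw [show M + 1 + d * x = M + d * x + 1 by ring, this]
    ring
  have hpos : 0 < (M + d * x).choose M := Nat.choose_pos (by omega)
  have hpos2 : 0 < (N + e).choose N := Nat.choose_pos (by omega)
  have hdc : d * x = 3 * (M + 1) * d ^ c := by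
    obtain ⟨c, rfl⟩ : ∃ c', c = c' + 1 := ⟨c - 1, by omega⟩
    rw [hx, Nat.add_sub_cancel, pow_succ]; ring
  have h5 : (N + e).choose N * (M + 1 + d * x) ≤ (M + 1) * d ^ c * (N + (e + x)).choose N := by
    refine le_of_mul_le_mul_right (a := (M + d * x).choose M) ?_ hpos
    calc _ = (N + e).choose N * ((M + 1) * (M + 1 + d * x).choose (M + 1)) := by rw [h4]; ring
      _ = (M + 1) * ((N + e).choose N * (M + 1 + d * x).choose (M + 1)) := by ring
      _ ≤ (M + 1) * (d ^ c * ((N + (e + x)).choose N * (M + d * x).choose M)) := by gcongr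
      _ = _ := by ring
  have h6 : 0 < (M + 1) * d ^ c := by positivity
  have h7 := Nat.mul_lt_mul_of_pos_left h3 h6
  rw [hdc] at h5
  nlinarith

/-- The exponents of total degree at most `D`. -/
def degLE (τ : Type*) [Fintype τ] [DecidableEq τ] (D : ℕ) : Finset (τ →₀ ℕ) :=
  (Finset.range (D + 1)).biUnion fun k => Finset.finsuppAntidiag Finset.univ k

theorem mem_degLE {τ : Type*} [Fintype τ] [DecidableEq τ] {D : ℕ} {s : τ →₀ ℕ} :
    s ∈ degLE τ D ↔ ∑ t, s t ≤ D := by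
  simp [degLE, Finset.mem_finsuppAntidiag]

theorem card_degLE (τ : Type*) [Fintype τ] [DecidableEq τ] (D : ℕ) :
    (degLE τ D).card = (Fintype.card τ + D).choose (Fintype.card τ) := by
  rw [degLE, Finset.card_biUnion]
  · simp only [Finset.card_finsuppAntidiag_nat_eq_multichoose, Finset.card_univ]
    rw [Nat.sum_range_multichoose, add_comm]
  · intro a _ b _ hab
    rw [Function.onFun, Finset.disjoint_left]
    intro s hs hs'
    rw [Finset.mem_finsuppAntidiag] at hs hs'
    exact hab (hs.1.symm.trans hs'.1)

section Bidegree

variable {τ σ : Type*} [Fintype τ] [Fintype σ]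

/-- Polynomials of degree at most `D` in the variables `τ` and at most `E` in the variables `σ`. -/
def bidegLE (τ σ : Type*) [Fintype τ] [Fintype σ] (D E : ℕ) :
    Submodule ℂ (MvPolynomial (τ ⊕ σ) ℂ) :=
  restrictSupport ℂ {s | ∑ t, s (Sum.inl t) ≤ D ∧ ∑ j, s (Sum.inr j) ≤ E}

theorem bidegLE_mono {D E D' E' : ℕ} (hD : D ≤ D') (hE : E ≤ E') :
    bidegLE τ σ D E ≤ bidegLE τ σ D' E' :=
  restrictSupport_mono ℂ fun _ hs => ⟨hs.1.trans hD, hs.2.trans hE⟩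

theorem monomial_mem_bidegLE {D E : ℕ} {s : τ ⊕ σ →₀ ℕ} (a : ℂ) (hD : ∑ t, s (Sum.inl t) ≤ D)
    (hE : ∑ j, s (Sum.inr j) ≤ E) : monomial s a ∈ bidegLE τ σ D E :=
  (monomial_mem_restrictSupport ℂ).2 (Or.inl ⟨hD, hE⟩)

theorem mul_mem_bidegLE {D E D' E' : ℕ} {f g : MvPolynomial (τ ⊕ σ) ℂ}
    (hf : f ∈ bidegLE τ σ D E) (hg : g ∈ bidegLE τ σ D' E') :
    f * g ∈ bidegLE τ σ (D + D') (E + E') := by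
  have h := Submodule.mul_mem_mul hf hg
  rw [bidegLE, bidegLE, ← restrictSupport_add] at h
  refine restrictSupport_mono ℂ ?_ h
  rintro _ ⟨s, hs, t, ht, rfl⟩
  simp only [Set.mem_ofPred_eq, Finsupp.add_apply, Finset.sum_add_distrib]
  exact ⟨add_le_add hs.1 ht.1, add_le_add hs.2 ht.2⟩

theorem one_mem_bidegLE : 1 ∈ bidegLE τ σ 0 0 :=
  monomial_mem_bidegLE (s := 0) 1 (by simp) (by simp)

theorem prod_mem_bidegLE {ι : Type*} (A : Finset ι) (f : ι → MvPolynomial (τ ⊕ σ) ℂ)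
    (E : ι → ℕ) (hf : ∀ k ∈ A, f k ∈ bidegLE τ σ 0 (E k)) :
    ∏ k ∈ A, f k ∈ bidegLE τ σ 0 (∑ k ∈ A, E k) := by
  classical
  induction A using Finset.induction_on with
  | empty => simpa using one_mem_bidegLE
  | insert a A ha ih =>
    rw [Finset.prod_insert ha, Finset.sum_insert ha]
    simpa using mul_mem_bidegLE (hf a (by simp)) (ih fun k hk => hf k (by simp [hk]))

theorem X_inl_mem_bidegLE (t : τ) : X (Sum.inl t) ∈ bidegLE τ σ 1 0 := by
  classical
  exact monomial_mem_bidegLE 1 (by simp [Finsupp.single_apply]) (by simp)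

theorem X_inr_mem_bidegLE (t : σ) : X (Sum.inr t) ∈ bidegLE τ σ 0 1 := by
  classical
  exact monomial_mem_bidegLE 1 (by simp) (by simp [Finsupp.single_apply])

theorem rename_inl_mem_bidegLE {D : ℕ} {f : MvPolynomial τ ℂ} (hf : f.totalDegree ≤ D) :
    rename Sum.inl f ∈ bidegLE τ σ D 0 := by
  classical
  rw [bidegLE, mem_restrictSupport_iff]
  intro s hs
  have hs' := support_rename_of_injective (p := f) (Sum.inl_injective (α := τ) (β := σ)) ▸ hs
  obtain ⟨r, hr, rfl⟩ := Finset.mem_image.1 (Finset.mem_coe.1 hs')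
  refine ⟨?_, ?_⟩
  · simp only [Finsupp.mapDomain_apply Sum.inl_injective]
    refine le_trans (le_of_eq ?_) ((le_totalDegree hr).trans hf)
    rw [Finsupp.sum_fintype _ _ fun _ => rfl]
  · refine le_of_eq (Finset.sum_eq_zero fun j _ => Finsupp.mapDomain_of_notMem_range _ _ (by simp))

theorem rename_inr_mem_bidegLE {E : ℕ} {f : MvPolynomial σ ℂ} (hf : f.totalDegree ≤ E) :
    rename Sum.inr f ∈ bidegLE τ σ 0 E := by
  classical
  rw [bidegLE, mem_restrictSupport_iff]
  intro s hs
  have hs' := support_rename_of_injective (p := f) (Sum.inr_injective (α := τ) (β := σ)) ▸ hs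
  obtain ⟨r, hr, rfl⟩ := Finset.mem_image.1 (Finset.mem_coe.1 hs')
  refine ⟨?_, ?_⟩
  · refine le_of_eq (Finset.sum_eq_zero fun j _ => Finsupp.mapDomain_of_notMem_range _ _ (by simp))
  · simp only [Finsupp.mapDomain_apply Sum.inr_injective]
    refine le_trans (le_of_eq ?_) ((le_totalDegree hr).trans hf)
    rw [Finsupp.sum_fintype _ _ fun _ => rfl]

theorem finite_bidegLE_aux (D E : ℕ) :
    ∃ _ : Finite {s : τ ⊕ σ →₀ ℕ | ∑ t, s (Sum.inl t) ≤ D ∧ ∑ j, s (Sum.inr j) ≤ E},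
      Nat.card {s : τ ⊕ σ →₀ ℕ | ∑ t, s (Sum.inl t) ≤ D ∧ ∑ j, s (Sum.inr j) ≤ E} ≤
        (Fintype.card τ + D).choose (Fintype.card τ) *
          (Fintype.card σ + E).choose (Fintype.card σ) := by
  classical
  let φ : {s : τ ⊕ σ →₀ ℕ | ∑ t, s (Sum.inl t) ≤ D ∧ ∑ j, s (Sum.inr j) ≤ E} →
      degLE τ D × degLE σ E := fun s =>
    (⟨s.1.comapDomain Sum.inl Sum.inl_injective.injOn, mem_degLE.2 (by simpa using s.2.1)⟩,
      ⟨s.1.comapDomain Sum.inr Sum.inr_injective.injOn, mem_degLE.2 (by simpa using s.2.2)⟩)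
  have hφ : Function.Injective φ := by
    intro s s' h
    simp only [φ, Prod.mk.injEq, Subtype.mk.injEq] at h
    ext k
    obtain k | k := k
    · simpa using DFunLike.congr_fun h.1 k
    · simpa using DFunLike.congr_fun h.2 k
  refine ⟨Finite.of_injective φ hφ, (Nat.card_le_card_of_injective φ hφ).trans (le_of_eq ?_)⟩
  rw [Nat.card_prod, Nat.card_eq_fintype_card, Nat.card_eq_fintype_card, Fintype.card_coe,
    Fintype.card_coe, card_degLE, card_degLE]

instance finite_bidegLE (D E : ℕ) : Module.Finite ℂ (bidegLE τ σ D E) := by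
  obtain ⟨_, -⟩ := finite_bidegLE_aux (τ := τ) (σ := σ) D E
  exact Module.Finite.of_basis (basisRestrictSupport ℂ _)

theorem finrank_bidegLE_le (D E : ℕ) : Module.finrank ℂ (bidegLE τ σ D E) ≤
    (Fintype.card τ + D).choose (Fintype.card τ) *
      (Fintype.card σ + E).choose (Fintype.card σ) := by
  obtain ⟨_, h⟩ := finite_bidegLE_aux (τ := τ) (σ := σ) D E
  refine le_of_eq_of_le ?_ h
  exact Module.finrank_eq_nat_card_basis (basisRestrictSupport ℂ _)

/-- The bigraded Hilbert function of an ideal. -/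
def hilb (I : Ideal (MvPolynomial (τ ⊕ σ) ℂ)) (D E : ℕ) : ℕ :=
  Module.finrank ℂ ((bidegLE τ σ D E).map (Ideal.Quotient.mkₐ ℂ I).toLinearMap)

theorem hilb_le (I : Ideal (MvPolynomial (τ ⊕ σ) ℂ)) (D E : ℕ) : hilb I D E ≤
    (Fintype.card τ + D).choose (Fintype.card τ) *
      (Fintype.card σ + E).choose (Fintype.card σ) :=
  (Submodule.finrank_map_le _ _).trans (finrank_bidegLE_le D E)

theorem map_factor_bidegLE {I J : Ideal (MvPolynomial (τ ⊕ σ) ℂ)} (hIJ : I ≤ J) (D E : ℕ) :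
    ((bidegLE τ σ D E).map (Ideal.Quotient.mkₐ ℂ I).toLinearMap).map
      (Ideal.Quotient.factorₐ ℂ hIJ).toLinearMap =
      (bidegLE τ σ D E).map (Ideal.Quotient.mkₐ ℂ J).toLinearMap := by
  rw [← Submodule.map_comp]
  rfl

theorem hilb_anti {I J : Ideal (MvPolynomial (τ ⊕ σ) ℂ)} (hIJ : I ≤ J) (D E : ℕ) :
    hilb J D E ≤ hilb I D E := by
  rw [hilb, ← map_factor_bidegLE hIJ]
  exact Submodule.finrank_map_le _ _

theorem hilb_add_le {I J : Ideal (MvPolynomial (τ ⊕ σ) ℂ)} (hIJ : I ≤ J) {d e : ℕ}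
    {q : MvPolynomial (τ ⊕ σ) ℂ} (hqJ : q ∈ J) (hq : q ∈ bidegLE τ σ e d)
    (hreg : ∀ f, q * f ∈ I → f ∈ I) (D E : ℕ) :
    hilb J (D + e) (E + d) + hilb I D E ≤ hilb I (D + e) (E + d) := by
  set W := (bidegLE τ σ (D + e) (E + d)).map (Ideal.Quotient.mkₐ ℂ I).toLinearMap with hW
  set φ := (Ideal.Quotient.factorₐ ℂ hIJ).toLinearMap with hφ
  set V := (bidegLE τ σ D E).map (Ideal.Quotient.mkₐ ℂ I).toLinearMap with hV
  have h1 := LinearMap.finrank_range_add_finrank_ker (φ.domRestrict W)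
  rw [LinearMap.range_domRestrict, map_factor_bidegLE] at h1
  rw [hilb, hilb, hilb, ← hW, ← hV, ← h1]
  refine Nat.add_le_add_left ?_ _
  let ψ : (MvPolynomial (τ ⊕ σ) ℂ ⧸ I) →ₗ[ℂ] (MvPolynomial (τ ⊕ σ) ℂ ⧸ I) :=
    LinearMap.mulLeft ℂ (Ideal.Quotient.mk I q)
  have hψ : ∀ f, ψ (Ideal.Quotient.mk I f) = Ideal.Quotient.mk I (q * f) := fun f =>
    (map_mul (Ideal.Quotient.mk I) q f).symm
  have hψW : ∀ v : V, ψ v ∈ W := by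
    rintro ⟨_, f, hf, rfl⟩
    refine ⟨q * f, ?_, (hψ f).symm⟩
    rw [add_comm D, add_comm E]
    exact mul_mem_bidegLE hq hf
  have hψφ : ∀ v, φ (ψ v) = 0 := by
    intro v
    obtain ⟨f, rfl⟩ := Ideal.Quotient.mk_surjective v
    rw [hψ]
    exact Ideal.Quotient.eq_zero_iff_mem.2 (J.mul_mem_right f hqJ)
  let χ : V →ₗ[ℂ] LinearMap.ker (φ.domRestrict W) :=
    LinearMap.codRestrict _ (LinearMap.codRestrict W (ψ.domRestrict V) hψW) fun v => hψφ v
  refine LinearMap.finrank_le_finrank_of_injective (f := χ) ?_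
  rw [injective_iff_map_eq_zero]
  intro v hv
  have h2 : ψ v = 0 := congrArg (fun w => ((w : W) : MvPolynomial (τ ⊕ σ) ℂ ⧸ I))
    (congrArg Subtype.val hv)
  ext
  obtain ⟨f, hf⟩ := Ideal.Quotient.mk_surjective (v : MvPolynomial (τ ⊕ σ) ℂ ⧸ I)
  rw [← hf, hψ, Ideal.Quotient.eq_zero_iff_mem] at h2
  rw [← hf]
  exact Ideal.Quotient.eq_zero_iff_mem.2 (hreg f h2)

theorem choose_mul_choose_le_hilb {κ e : ℕ} {I : Ideal (MvPolynomial (τ ⊕ σ) ℂ)}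
    (u : Fin κ → MvPolynomial (τ ⊕ σ) ℂ) (hu : ∀ k, u k ∈ bidegLE τ σ 0 1)
    (hind : ∀ (A : Finset (Fin κ →₀ ℕ)) (P : (Fin κ →₀ ℕ) → MvPolynomial τ ℂ),
      ∑ α ∈ A, rename Sum.inl (P α) * ∏ k, u k ^ α k ∈ I → ∀ α ∈ A, rename Sum.inl (P α) ∈ I)
    (hI : ∀ f : MvPolynomial τ ℂ, f.totalDegree ≤ e → rename Sum.inl f ∈ I → f = 0)
    {D : ℕ} (hD : e ≤ D) (E : ℕ) :
    (Fintype.card τ + e).choose (Fintype.card τ) * (κ + E).choose κ ≤ hilb I D E := by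
  classical
  let m : (τ →₀ ℕ) × (Fin κ →₀ ℕ) → MvPolynomial (τ ⊕ σ) ℂ := fun s =>
    rename Sum.inl (monomial s.1 1) * ∏ k, u k ^ s.2 k
  have htot : ∀ s ∈ degLE τ e, ∀ a : ℂ, (monomial s a).totalDegree ≤ e := fun s hs a => by
    refine (totalDegree_monomial_le _ _).trans ?_
    rw [Finsupp.sum_fintype _ _ fun _ => rfl]
    exact mem_degLE.1 hs
  have hm : ∀ s : degLE τ e × degLE (Fin κ) E, m (s.1, s.2) ∈ bidegLE τ σ D E := by
    rintro ⟨⟨s, hs⟩, ⟨α, hα⟩⟩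
    have h1 : ∏ k, u k ^ α k ∈ bidegLE τ σ 0 E := by
      refine bidegLE_mono le_rfl (mem_degLE.1 hα)
        (prod_mem_bidegLE Finset.univ _ (fun k => α k) fun k _ => ?_)
      have := prod_mem_bidegLE (Finset.range (α k)) (fun _ => u k) (fun _ => 1) fun _ _ => hu k
      simpa using this
    have h2 := mul_mem_bidegLE (rename_inl_mem_bidegLE (σ := σ) (htot s hs 1)) h1
    exact bidegLE_mono (by omega) (by omega) h2
  let v : degLE τ e × degLE (Fin κ) E →
      (bidegLE τ σ D E).map (Ideal.Quotient.mkₐ ℂ I).toLinearMap := fun s =>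
    ⟨Ideal.Quotient.mkₐ ℂ I (m (s.1, s.2)), Submodule.mem_map_of_mem (hm s)⟩
  have hv : LinearIndependent ℂ v := by
    rw [Fintype.linearIndependent_iff]
    intro c hc
    let c' : (τ →₀ ℕ) → (Fin κ →₀ ℕ) → ℂ := fun s α =>
      if h : s ∈ degLE τ e ∧ α ∈ degLE (Fin κ) E then c (⟨s, h.1⟩, ⟨α, h.2⟩) else 0
    let P : (Fin κ →₀ ℕ) → MvPolynomial τ ℂ := fun α => ∑ s ∈ degLE τ e, monomial s (c' s α)
    have hmem : ∑ α ∈ degLE (Fin κ) E, rename Sum.inl (P α) * ∏ k, u k ^ α k ∈ I := by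
      rw [← Ideal.Quotient.eq_zero_iff_mem]
      have h1 : Ideal.Quotient.mkₐ ℂ I (∑ s : degLE τ e × degLE (Fin κ) E,
          c s • m (s.1, s.2)) = 0 := by
        rw [map_sum]
        simp only [map_smul]
        have := congrArg Subtype.val hc
        simpa [v] using this
      refine Eq.trans (congrArg (Ideal.Quotient.mk I) ?_) h1
      rw [Fintype.sum_prod_type_right, ← Finset.sum_coe_sort]
      refine Finset.sum_congr rfl fun α _ => ?_
      simp only [P]
      rw [map_sum, Finset.sum_mul, ← Finset.sum_coe_sort]
      refine Finset.sum_congr rfl fun s _ => ?_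
      have h2 : c' s α = c (s, α) := by simp [c']
      have h3 : monomial (s : τ →₀ ℕ) (c (s, α)) = c (s, α) • monomial (s : τ →₀ ℕ) (1 : ℂ) := by
        rw [smul_monomial, smul_eq_mul, mul_one]
      rw [h2, h3, map_smul, smul_mul_assoc]
    have hP := hind _ P hmem
    rintro ⟨⟨s, hs⟩, ⟨α, hα⟩⟩
    have h0 : P α = 0 := hI _
      (totalDegree_finsetSum_le fun s hs => htot s hs _) (hP α hα)
    have := congrArg (coeff s) h0
    simpa [P, coeff_sum, coeff_monomial, hs, c', hα] using this
  have := hv.fintype_card_le_finrank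
  rw [Fintype.card_prod, Fintype.card_coe, Fintype.card_coe, card_degLE, card_degLE,
    Fintype.card_fin] at this
  exact this

end Bidegree

theorem Submodule.exists_mem_forall_notMem {ι k M : Type*} [Field k] [Infinite k] [Finite ι]
    [AddCommGroup M] [Module k M] (V : Submodule k M) (W : ι → Submodule k M)
    (h : ∀ i, ∃ v ∈ V, v ∉ W i) : ∃ v ∈ V, ∀ i, v ∉ W i := by
  by_contra! hcon
  obtain ⟨i, hi⟩ := Subspace.exists_eq_top_of_iUnion_eq_univ
    (p := fun i => (W i).comap V.subtype) (by
      rw [Set.eq_univ_iff_forall]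
      rintro ⟨v, hv⟩
      obtain ⟨i, hi⟩ := hcon v hv
      exact Set.mem_iUnion.2 ⟨i, hi⟩)
  obtain ⟨v, hv, hvi⟩ := h i
  have : (⟨v, hv⟩ : V) ∈ (W i).comap V.subtype := hi ▸ trivial
  exact hvi this

theorem exists_mem_forall_notMem_of_finite {k R : Type*} [Field k] [Infinite k] [CommRing R]
    [Algebra k R] (V : Submodule k R) {T : Set (Ideal R)} (hT : T.Finite)
    (h : ∀ Q ∈ T, ∃ v ∈ V, v ∉ Q) : ∃ v ∈ V, ∀ Q ∈ T, v ∉ Q := by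
  have := hT.to_subtype
  obtain ⟨v, hv, hvT⟩ := Submodule.exists_mem_forall_notMem V
    (fun Q : T => (Q : Ideal R).restrictScalars k) fun Q => h Q Q.2
  exact ⟨v, hv, fun Q hQ => hvT ⟨Q, hQ⟩⟩

/-- A finite set of minimal primes of height `c` of an ideal generated by a vector space `V` can be
cut out, step by step, by `c` general elements of `V`. -/
theorem exists_regular_chain {k R : Type*} [Field k] [Infinite k] [CommRing R] [IsNoetherianRing R]
    [Algebra k R] (V : Submodule k R) {S : Set (Ideal R)} {c : ℕ}
    (hS : ∀ P ∈ S, P ∈ (Ideal.span (V : Set R)).minimalPrimes) (hSc : ∀ P ∈ S, P.height = c) :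
    ∃ (I : ℕ → Ideal R) (q : ℕ → R), I c = sInf S ∧ ∀ k < c, I k ≤ I (k + 1) ∧ q k ∈ V ∧
      q k ∈ I (k + 1) ∧ ∀ f, q k * f ∈ I k → f ∈ I k := by
  classical
  let T : Ideal R → Set (Ideal R) := fun J => {Q | Q ∈ J.minimalPrimes ∧ ∃ P ∈ S, Q ≤ P}
  let Good : ℕ → Ideal R → Prop := fun k J => J ≤ Ideal.span (V : Set R) ∧
    (∃ s : Finset R, s.card ≤ k ∧ J = Ideal.span s) ∧ ∀ Q ∈ T J, Q.height = k
  have hle : ∀ (k : ℕ) (J : Ideal R) (s : Finset R), s.card ≤ k → J = Ideal.span s →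
      ∀ Q ∈ J.minimalPrimes, Q.height ≤ k := by
    rintro k J s hs rfl Q hQ
    exact (Ideal.height_le_card_of_mem_minimalPrimes_span_finset hQ).trans (by exact_mod_cast hs)
  have hTmem : ∀ (J Q P : Ideal R), Q.IsPrime → J ≤ Q → P ∈ S → Q ≤ P → ∃ Q' ∈ T J, Q' ≤ Q := by
    intro J Q P _ hJQ hP hQP
    obtain ⟨Q', hQ', hle'⟩ := Ideal.exists_minimalPrimes_le hJQ
    exact ⟨Q', ⟨hQ', P, hP, hle'.trans hQP⟩, hle'⟩
  have hstep : ∀ (k : ℕ) (J : Ideal R), ∃ q, k < c → Good k J →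
      q ∈ V ∧ (∀ Q ∈ T J, q ∉ Q) ∧ Good (k + 1) (J ⊔ Ideal.span {q}) := by
    intro k J
    by_cases hk : k < c ∧ Good k J
    swap
    · exact ⟨0, fun h1 h2 => (hk ⟨h1, h2⟩).elim⟩
    obtain ⟨hk, hJ, ⟨s, hs, hJs⟩, hT⟩ := hk
    have hfin : (T J).Finite :=
      (Ideal.finite_minimalPrimes_of_isNoetherianRing R J).subset fun Q hQ => hQ.1
    obtain ⟨q, hqV, hq⟩ := exists_mem_forall_notMem_of_finite V hfin (by
      rintro Q ⟨hQ, P, hP, hQP⟩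
      by_contra! hcon
      have hspan : Ideal.span (V : Set R) ≤ Q := Ideal.span_le.2 hcon
      have heq : Q = P := le_antisymm hQP ((hS P hP).2 ⟨hQ.1.1, hspan⟩ hQP)
      have h1 := hT Q ⟨hQ, P, hP, hQP⟩
      rw [heq, hSc P hP] at h1
      have : c = k := by exact_mod_cast h1
      omega)
    refine ⟨q, fun _ _ => ⟨hqV, hq, ?_, ?_, ?_⟩⟩
    · exact sup_le hJ ((Ideal.span_singleton_le_iff_mem _).2 (Ideal.subset_span hqV))
    · refine ⟨insert q s, (Finset.card_insert_le _ _).trans (by omega), ?_⟩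
      rw [hJs, Finset.coe_insert, Ideal.span_insert, sup_comm]
    · rintro Q ⟨hQ, P, hP, hQP⟩
      have hQp : Q.IsPrime := hQ.1.1
      refine le_antisymm (hle (k + 1) _ (insert q s)
        ((Finset.card_insert_le _ _).trans (by omega)) ?_ Q hQ) ?_
      · rw [hJs, Finset.coe_insert, Ideal.span_insert, sup_comm]
      · obtain ⟨Q', hQ', hlt⟩ := hTmem J Q P hQp (le_sup_left.trans hQ.1.2) hP hQP
        have hqQ : q ∈ Q := hQ.1.2 (Ideal.mem_sup_right (Ideal.mem_span_singleton_self q))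
        have hlt' : Q' < Q := lt_of_le_of_ne hlt fun h => hq Q' hQ' (h ▸ hqQ)
        have hQ'p : Q'.IsPrime := hQ'.1.1.1
        have := Ideal.height_add_one_le_of_lt_of_isPrime hlt'
        rw [hT Q' hQ'] at this
        exact_mod_cast this
  choose q hq using hstep
  let J : ℕ → Ideal R := fun k => Nat.rec ⊥ (fun k J => J ⊔ Ideal.span {q k J}) k
  have hJsucc : ∀ k, J (k + 1) = J k ⊔ Ideal.span {q k (J k)} := fun k => rfl
  have hgood : ∀ k ≤ c, Good k (J k) := by
    intro k
    induction k with
    | zero =>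
      intro _
      refine ⟨bot_le, ⟨∅, by simp, by simp [J]⟩, fun Q hQ => ?_⟩
      exact le_antisymm (hle 0 _ ∅ (by simp) (by simp [J]) Q hQ.1) (by simp)
    | succ k ih => exact fun hk => (hq k (J k) (by omega) (ih (by omega))).2.2
  refine ⟨fun k => sInf (T (J k)), fun k => q k (J k), ?_, fun k hk => ?_⟩
  · have hTc := hgood c le_rfl
    have heq : ∀ Q P, Q ∈ T (J c) → P ∈ S → Q ≤ P → Q = P := by
      intro Q P hQ hP hQP
      have hQp : Q.IsPrime := hQ.1.1.1
      have hPp : P.IsPrime := (hS P hP).1.1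
      by_contra hne
      have := Ideal.height_add_one_le_of_lt_of_isPrime (lt_of_le_of_ne hQP hne)
      rw [hTc.2.2 Q hQ, hSc P hP] at this
      have : c + 1 ≤ c := by exact_mod_cast this
      omega
    have hTS : T (J c) = S := by
      ext Q
      constructor
      · intro hQ
        obtain ⟨P, hP, hQP⟩ := hQ.2
        exact heq Q P hQ hP hQP ▸ hP
      · intro hP
        obtain ⟨Q', hQ', hle'⟩ := hTmem (J c) Q Q (hS Q hP).1.1
          (hTc.1.trans (hS Q hP).1.2) hP le_rfl
        exact heq Q' Q hQ' hP hle' ▸ hQ'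
    exact congrArg sInf hTS
  · obtain ⟨hqV, hqT, hgood'⟩ := hq k (J k) hk (hgood k hk.le)
    refine ⟨?_, hqV, ?_, ?_⟩
    · refine le_sInf fun Q hQ => ?_
      obtain ⟨P, hP, hQP⟩ := hQ.2
      obtain ⟨Q', hQ', hle'⟩ := hTmem (J k) Q P hQ.1.1.1
        (le_trans (hJsucc k ▸ le_sup_left) hQ.1.1.2) hP hQP
      exact (sInf_le hQ').trans hle'
    · rw [Submodule.mem_sInf]
      intro Q hQ
      refine hQ.1.1.2 ?_
      rw [hJsucc]
      exact Ideal.mem_sup_right (Ideal.mem_span_singleton_self _)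
    · intro f hf
      rw [Submodule.mem_sInf] at hf ⊢
      intro Q hQ
      have hQp : Ideal.IsPrime Q := hQ.1.1.1
      exact (hQp.mem_or_mem (hf Q hQ)).resolve_left (hqT Q hQ)

theorem exists_transcendental_generator {k K τ σ : Type} [Field k] [Field K] [Algebra k K]
    [Finite τ] (t : τ → K) (x : σ → K)
    (hgen : ∀ z : K, ∃ a b : MvPolynomial (τ ⊕ σ) k,
      z = aeval (Sum.elim t x) a / aeval (Sum.elim t x) b)
    (ht : ¬ AlgebraicIndependent k t) {m j : ℕ} {b : Fin m → K} (hb : AlgebraicIndependent k b)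
    (u : Fin j → K) (hm : Nat.card τ + j ≤ m) :
    ∃ s, Transcendental (Algebra.adjoin (Algebra.adjoin k (Set.range t)) (Set.range u)) (x s) := by
  classical
  by_contra! hcon
  have := Fintype.ofFinite τ
  set A := Algebra.adjoin (Algebra.adjoin k (Set.range t)) (Set.range u) with hA
  have hx : ∀ s, IsAlgebraic A (x s) := fun s => not_not.1 (hcon s)
  have htA : ∀ s, IsAlgebraic A (t s) := fun s => by
    have h1 : t s ∈ Algebra.adjoin k (Set.range t) := Algebra.subset_adjoin ⟨s, rfl⟩
    have h2 : t s ∈ A := A.algebraMap_mem ⟨t s, h1⟩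
    exact isAlgebraic_algebraMap (⟨t s, h2⟩ : A)
  have hpol : ∀ a : MvPolynomial (τ ⊕ σ) k, IsAlgebraic A (aeval (Sum.elim t x) a) := by
    intro a
    induction a using MvPolynomial.induction_on with
    | C c =>
      rw [aeval_C]
      have h1 : algebraMap k K c ∈ A :=
        A.algebraMap_mem ⟨_, (Algebra.adjoin k (Set.range t)).algebraMap_mem c⟩
      exact isAlgebraic_algebraMap (⟨_, h1⟩ : A)
    | add p q hp hq => rw [map_add]; exact hp.add hq
    | mul_X p s hp =>
      rw [map_mul, aeval_X]
      refine hp.mul ?_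
      obtain s | s := s
      · exact htA s
      · exact hx s
  have halg : Algebra.IsAlgebraic A K := ⟨fun z => by
    obtain ⟨a, b, rfl⟩ := hgen z
    rw [div_eq_mul_inv]
    exact (hpol a).mul (hpol b).inv⟩
  have halg' : Algebra.IsAlgebraic (Algebra.adjoin k (Set.range t ∪ Set.range u)) K := by
    rw [Algebra.adjoin_union_eq_adjoin_adjoin]
    exact halg
  obtain ⟨s, hs, hbasis⟩ := exists_isTranscendenceBasis_subset (R := k) (Set.range t ∪ Set.range u)
  have hfin : s.Finite := ((Set.finite_range t).union (Set.finite_range u)).subset hs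
  have h1 : m ≤ s.ncard := by
    have h2 := hb.lift_cardinalMk_le_trdeg
    rw [← hbasis.cardinalMk_eq_trdeg] at h2
    have := hfin.fintype
    simp only [Cardinal.mk_fintype, Cardinal.lift_natCast, Nat.cast_le, Fintype.card_fin] at h2
    rwa [← Nat.card_eq_fintype_card, Nat.card_coe_set_eq] at h2
  have h2 : s.ncard ≤ (s ∩ Set.range t).ncard + (s ∩ Set.range u).ncard := by
    refine le_trans (Set.ncard_le_ncard ?_ ((hfin.inter_of_left _).union (hfin.inter_of_left _)))
      (Set.ncard_union_le _ _)
    intro z hz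
    exact (hs hz).imp (fun h => ⟨hz, h⟩) fun h => ⟨hz, h⟩
  have h3 : (s ∩ Set.range u).ncard ≤ j := by
    refine (Set.ncard_le_ncard Set.inter_subset_right (Set.finite_range u)).trans ?_
    rw [← Set.image_univ]
    exact (Set.ncard_image_le Set.finite_univ).trans (by simp [Set.ncard_univ])
  have h4 : (Set.range t).ncard ≤ Nat.card τ := by
    rw [← Set.image_univ]
    exact (Set.ncard_image_le Set.finite_univ).trans (by simp [Set.ncard_univ])
  have h5 : (s ∩ Set.range t).ncard ≤ (Set.range t).ncard :=
    Set.ncard_le_ncard Set.inter_subset_right (Set.finite_range t)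
  have h6 : s ∩ Set.range t = Set.range t :=
    Set.eq_of_subset_of_ncard_le Set.inter_subset_right (by omega) (Set.finite_range t)
  have hinj : Function.Injective t := by
    rw [← Set.injOn_univ]
    refine Set.injOn_of_ncard_image_eq ?_ Set.finite_univ
    rw [Set.image_univ, Set.ncard_univ]
    omega
  have hts : ∀ i, t i ∈ s := fun i => (h6.ge ⟨i, rfl⟩).1
  exact ht (hbasis.1.comp (fun i => (⟨t i, hts i⟩ : s)) fun a b hab =>
    hinj (congrArg Subtype.val hab))

/-- The canonical map to the residue field of a prime of a polynomial ring. -/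
def toResidue {ρ : Type} (P : Ideal (MvPolynomial ρ ℂ)) :
    MvPolynomial ρ ℂ →ₐ[ℂ] FractionRing (MvPolynomial ρ ℂ ⧸ P) :=
  (IsScalarTower.toAlgHom ℂ (MvPolynomial ρ ℂ ⧸ P) (FractionRing (MvPolynomial ρ ℂ ⧸ P))).comp
    (Ideal.Quotient.mkₐ ℂ P)

theorem toResidue_eq_aeval {ρ : Type} (P : Ideal (MvPolynomial ρ ℂ)) (f : MvPolynomial ρ ℂ) :
    toResidue P f = aeval (fun k => toResidue P (X k)) f := by
  have : toResidue P = aeval fun k => toResidue P (X k) := by ext; simp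
  exact congrArg (fun ψ => ψ f) this

section Residue

variable {ρ : Type} (P : Ideal (MvPolynomial ρ ℂ)) [P.IsPrime]

theorem toResidue_eq_zero_iff {f : MvPolynomial ρ ℂ} : toResidue P f = 0 ↔ f ∈ P := by
  change algebraMap (MvPolynomial ρ ℂ ⧸ P) (FractionRing (MvPolynomial ρ ℂ ⧸ P))
    (Ideal.Quotient.mk P f) = 0 ↔ _
  rw [FaithfulSMul.algebraMap_eq_zero_iff, Ideal.Quotient.eq_zero_iff_mem]

theorem exists_eq_toResidue_div (z : FractionRing (MvPolynomial ρ ℂ ⧸ P)) :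
    ∃ a b, z = toResidue P a / toResidue P b := by
  obtain ⟨a, b, -, rfl⟩ := IsFractionRing.div_surjective (A := MvPolynomial ρ ℂ ⧸ P) z
  obtain ⟨a, rfl⟩ := Ideal.Quotient.mk_surjective a
  obtain ⟨b, rfl⟩ := Ideal.Quotient.mk_surjective b
  exact ⟨a, b, rfl⟩

theorem exists_algebraicIndependent_residue [Fintype ρ] :
    ∃ (m : ℕ) (b : Fin m → FractionRing (MvPolynomial ρ ℂ ⧸ P)), AlgebraicIndependent ℂ b ∧
      (Fintype.card ρ : ℕ∞) ≤ P.height + m := by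
  obtain ⟨m, b, hb, hcard⟩ := exists_algebraicIndependent_quotient P
  exact ⟨m, _, hb.map' (f := IsScalarTower.toAlgHom ℂ (MvPolynomial ρ ℂ ⧸ P)
    (FractionRing (MvPolynomial ρ ℂ ⧸ P))) (IsFractionRing.injective _ _), hcard⟩

end Residue

/-- Elements whose classes modulo `P` are independent over the algebra generated by the
variables `τ`. -/
def FibreIndep {τ σ ι : Type} (P : Ideal (MvPolynomial (τ ⊕ σ) ℂ)) [P.IsPrime]
    (u : ι → MvPolynomial (τ ⊕ σ) ℂ) : Prop :=
  AlgebraicIndependent (Algebra.adjoin ℂ (Set.range fun t => toResidue P (X (Sum.inl t))))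
    fun k => toResidue P (u k)

theorem FibreIndep.mem_of_sum_mem {τ σ : Type} {κ : ℕ} {P : Ideal (MvPolynomial (τ ⊕ σ) ℂ)}
    [P.IsPrime] {u : Fin κ → MvPolynomial (τ ⊕ σ) ℂ} (hu : FibreIndep P u)
    (A : Finset (Fin κ →₀ ℕ)) (f : (Fin κ →₀ ℕ) → MvPolynomial τ ℂ)
    (h : ∑ α ∈ A, rename Sum.inl (f α) * ∏ k, u k ^ α k ∈ P) :
    ∀ α ∈ A, rename Sum.inl (f α) ∈ P := by
  classical
  let T := Algebra.adjoin ℂ (Set.range fun t => toResidue P (X (Sum.inl t)))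
  have hT : ∀ g : MvPolynomial τ ℂ, toResidue P (rename Sum.inl g) ∈ T := by
    intro g
    rw [toResidue_eq_aeval, aeval_rename]
    rw [show T = _ from Algebra.adjoin_range_eq_range_aeval ℂ _]
    exact ⟨g, rfl⟩
  let c : (Fin κ →₀ ℕ) → T := fun α => ⟨_, hT (f α)⟩
  have h0 : (∑ α ∈ A, monomial α (c α) : MvPolynomial (Fin κ) T) = 0 := by
    refine (algebraicIndependent_iff.1 hu) _ ?_
    rw [map_sum, ← (toResidue_eq_zero_iff P).2 h, map_sum]
    refine Finset.sum_congr rfl fun α _ => ?_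
    rw [aeval_monomial, map_mul, map_prod, Finsupp.prod_fintype _ _ (by simp)]
    simp only [map_pow]
    rfl
  intro α hα
  have h1 := congrArg (coeff α) h0
  simp only [coeff_sum, coeff_monomial, Finset.sum_ite_eq', hα, if_true, coeff_zero] at h1
  exact (toResidue_eq_zero_iff P).1 (congrArg Subtype.val h1)

theorem exists_transcendental_residue {τ σ : Type} [Fintype τ] [Fintype σ]
    (P : Ideal (MvPolynomial (τ ⊕ σ) ℂ)) [P.IsPrime] {c j : ℕ} (hc : P.height ≤ c)
    (hτ : ∃ f : MvPolynomial τ ℂ, f ≠ 0 ∧ rename Sum.inl f ∈ P) (hj : j + c ≤ Fintype.card σ)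
    (u : Fin j → MvPolynomial (τ ⊕ σ) ℂ) :
    ∃ s : σ, Transcendental (Algebra.adjoin
      (Algebra.adjoin ℂ (Set.range fun t => toResidue P (X (Sum.inl t))))
      (Set.range fun k => toResidue P (u k))) (toResidue P (X (Sum.inr s))) := by
  obtain ⟨m, b, hb, hm⟩ := exists_algebraicIndependent_residue P
  have hm' : Fintype.card τ + Fintype.card σ ≤ c + m := by
    rw [Fintype.card_sum] at hm
    have := hm.trans (add_le_add_left hc (m : ℕ∞))
    exact_mod_cast this
  refine exists_transcendental_generator (k := ℂ) (fun t => toResidue P (X (Sum.inl t)))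
    (fun s => toResidue P (X (Sum.inr s))) (fun z => ?_) (fun hind => ?_) hb _
    (by rw [Nat.card_eq_fintype_card]; omega)
  · obtain ⟨a, b, rfl⟩ := exists_eq_toResidue_div P z
    refine ⟨a, b, ?_⟩
    have : (Sum.elim (fun t => toResidue P (X (Sum.inl t)))
        fun s => toResidue P (X (Sum.inr s))) = fun k => toResidue P (X k) := by
      ext (k | k) <;> rfl
    rw [this, ← toResidue_eq_aeval, ← toResidue_eq_aeval]
  · obtain ⟨f, hf0, hf⟩ := hτ
    refine hf0 ((algebraicIndependent_iff.1 hind) f ?_)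
    rw [← toResidue_eq_zero_iff P, toResidue_eq_aeval, aeval_rename] at hf
    exact hf

theorem exists_fibreIndep {τ σ : Type} [Fintype τ] [Fintype σ]
    {S : Set (Ideal (MvPolynomial (τ ⊕ σ) ℂ))} (hS : S.Finite) (hprime : ∀ P ∈ S, P.IsPrime)
    {c : ℕ} (hc : ∀ P ∈ S, P.height ≤ c)
    (hτ : ∀ P ∈ S, ∃ f : MvPolynomial τ ℂ, f ≠ 0 ∧ rename Sum.inl f ∈ P)
    (κ : ℕ) (hκ : κ + c ≤ Fintype.card σ + 1) :
    ∃ u : Fin κ → MvPolynomial (τ ⊕ σ) ℂ, (∀ k, u k ∈ bidegLE τ σ 0 1) ∧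
      ∀ P (hP : P ∈ S), haveI := hprime P hP; FibreIndep P u := by
  induction κ with
  | zero =>
    refine ⟨Fin.elim0, fun k => k.elim0, fun P hP => ?_⟩
    have := hprime P hP
    exact (algebraicIndependent_empty_type_iff).2 (FaithfulSMul.algebraMap_injective _ _)
  | succ κ ih =>
    obtain ⟨u, hu, hind⟩ := ih (by omega)
    have := hS.to_subtype
    have hp : ∀ P : S, P.1.IsPrime := fun P => hprime P P.2
    let A := fun P : S => Algebra.adjoin
      (Algebra.adjoin ℂ (Set.range fun t => toResidue P.1 (X (Sum.inl t))))
      (Set.range fun k => toResidue P.1 (u k))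
    let W : S → Submodule ℂ (MvPolynomial (τ ⊕ σ) ℂ) := fun P =>
      { carrier := {r | IsAlgebraic (A P) (toResidue P.1 r)}
        add_mem' := fun {a b} ha hb => by
          have := hp P
          rw [Set.mem_ofPred_eq, map_add]
          exact ha.add hb
        zero_mem' := by
          have := hp P
          rw [Set.mem_ofPred_eq, map_zero]
          exact isAlgebraic_zero
        smul_mem' := fun a r hr => by
          have := hp P
          rw [Set.mem_ofPred_eq, map_smul, Algebra.smul_def]
          refine IsAlgebraic.mul ?_ hr
          exact isAlgebraic_algebraMap (⟨_, (A P).algebraMap_mem ⟨_, Subalgebra.algebraMap_mem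
            (Algebra.adjoin ℂ (Set.range fun t => toResidue P.1 (X (Sum.inl t)))) a⟩⟩ : A P) }
    obtain ⟨w, hw, hwW⟩ := Submodule.exists_mem_forall_notMem (bidegLE τ σ 0 1) W fun P => by
      have := hp P
      obtain ⟨s, hs⟩ := exists_transcendental_residue P.1 (hc P P.2) (hτ P P.2)
        (by omega : κ + c ≤ _) u
      exact ⟨X (Sum.inr s), X_inr_mem_bidegLE s, hs⟩
    have helim : ∀ k, (fun k => (_root_.finSuccEquiv κ k).elim w u) k =
        (_root_.finSuccEquiv κ k).elim w u := fun _ => rfl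
    refine ⟨fun k => (_root_.finSuccEquiv κ k).elim w u, fun k => ?_, fun P hP => ?_⟩
    · rw [helim]
      cases _root_.finSuccEquiv κ k with
      | none => exact hw
      | some k => exact hu k
    · have := hprime P hP
      have h1 := (AlgebraicIndependent.option_iff_transcendental (hind P hP) (toResidue P w)).2
        (hwW ⟨P, hP⟩)
      have h2 := h1.comp (_root_.finSuccEquiv κ) (_root_.finSuccEquiv κ).injective
      unfold FibreIndep
      convert h2 using 1
      ext k
      rw [Function.comp_apply, helim]
      cases _root_.finSuccEquiv κ k <;> rfl

theorem exists_eliminant_of_height_eq {τ σ : Type} [Fintype τ] [Fintype σ] [Nonempty τ] {d c : ℕ}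
    (hd : 0 < d) (hc0 : 0 < c) (hc : c ≤ Fintype.card σ)
    {V : Submodule ℂ (MvPolynomial (τ ⊕ σ) ℂ)} (hV : V ≤ bidegLE τ σ 1 d)
    {S : Set (Ideal (MvPolynomial (τ ⊕ σ) ℂ))}
    (hS : ∀ P ∈ S, P ∈ (Ideal.span (V : Set (MvPolynomial (τ ⊕ σ) ℂ))).minimalPrimes)
    (hSc : ∀ P ∈ S, P.height = c)
    (hτ : ∀ P ∈ S, ∃ f : MvPolynomial τ ℂ, f ≠ 0 ∧ rename Sum.inl f ∈ P) :
    ∃ Δ : MvPolynomial τ ℂ, Δ ≠ 0 ∧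
      Δ.totalDegree ≤ Fintype.card τ * (3 * (Fintype.card σ + 1) * d ^ (c - 1)) ∧
      ∀ P ∈ S, rename Sum.inl Δ ∈ P := by
  by_contra! hcon
  have hN : 0 < Fintype.card τ := Fintype.card_pos
  obtain ⟨e, he⟩ : ∃ e, e + 1 = Fintype.card τ * (3 * (Fintype.card σ + 1) * d ^ (c - 1)) :=
    ⟨_, Nat.sub_add_cancel (Nat.one_le_iff_ne_zero.2 (by positivity))⟩
  obtain ⟨κ, hκ⟩ : ∃ κ, κ + c = Fintype.card σ + 1 := ⟨Fintype.card σ + 1 - c, by omega⟩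
  have hfin : S.Finite := (Ideal.finite_minimalPrimes_of_isNoetherianRing _ _).subset hS
  have hprime : ∀ P ∈ S, P.IsPrime := fun P hP => (hS P hP).1.1
  obtain ⟨I, q, hIc, hI⟩ := exists_regular_chain V hS hSc
  obtain ⟨u, hu, hind⟩ := exists_fibreIndep hfin hprime (fun P hP => (hSc P hP).le) hτ κ hκ.le
  refine not_hilbert_chain hN hd hc0 hκ he (fun s => hilb (I (c - s))) (fun D E hD => ?_)
    (fun s hs D E => ?_) (fun s hs D E => ?_) (fun D E => hilb_le _ _ _)
  · simp only [Nat.sub_zero, hIc]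
    refine choose_mul_choose_le_hilb u hu (fun A f h α hα => ?_) (fun f hf hfI => ?_) hD E
    · rw [Ideal.mem_sInf] at h ⊢
      intro P hP
      have := hprime P hP
      exact (hind P hP).mem_of_sum_mem A f (h hP) α hα
    · by_contra hf0
      obtain ⟨P, hP, hfP⟩ := hcon f hf0 (by omega)
      exact hfP ((Ideal.mem_sInf.1 hfI) hP)
  · obtain ⟨h1, -⟩ := hI (c - (s + 1)) (by omega)
    rw [show c - (s + 1) + 1 = c - s by omega] at h1
    exact hilb_anti h1 D E
  · obtain ⟨h1, h2, h3, h4⟩ := hI (c - (s + 1)) (by omega)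
    rw [show c - (s + 1) + 1 = c - s by omega] at h1 h3
    exact hilb_add_le h1 h3 (hV h2) h4 D E

theorem sum_pow_sub_one_le {d : ℕ} (hd : 2 ≤ d) {M : ℕ} (hM : 0 < M) :
    ∑ c ∈ Finset.Icc 1 M, d ^ (c - 1) ≤ 2 * d ^ (M - 1) := by
  induction M, hM using Nat.le_induction with
  | base => simp
  | succ M hM ih =>
    rw [Finset.sum_Icc_succ_top (by omega)]
    obtain ⟨m, rfl⟩ : ∃ m, M = m + 1 := ⟨M - 1, by omega⟩
    simp only [Nat.add_sub_cancel] at ih ⊢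
    have : 2 * d ^ m ≤ d ^ (m + 1) := by rw [pow_succ, mul_comm]; gcongr
    omega

/-- A system with as many equations as fibre variables, affine in the base variables: the primes
over it that do not dominate the base lie over a common hypersurface of bounded degree. -/
theorem exists_eliminant {τ σ ι : Type} [Fintype τ] [Fintype σ] [Nonempty τ] [Fintype ι]
    {d : ℕ} (hd : 2 ≤ d) (hσ : 0 < Fintype.card σ) (hι : Fintype.card ι ≤ Fintype.card σ)
    (G : ι → MvPolynomial (τ ⊕ σ) ℂ) (hG : ∀ k, G k ∈ bidegLE τ σ 1 d)
    {S : Set (Ideal (MvPolynomial (τ ⊕ σ) ℂ))}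
    (hS : ∀ P ∈ S, P ∈ (Ideal.span (Set.range G)).minimalPrimes)
    (hτ : ∀ P ∈ S, ∃ f : MvPolynomial τ ℂ, f ≠ 0 ∧ rename Sum.inl f ∈ P) :
    ∃ Δ : MvPolynomial τ ℂ, Δ ≠ 0 ∧
      Δ.totalDegree ≤ 6 * Fintype.card τ * (Fintype.card σ + 1) * d ^ (Fintype.card σ - 1) ∧
      ∀ P ∈ S, rename Sum.inl Δ ∈ P := by
  classical
  have hspan : Ideal.span (Submodule.span ℂ (Set.range G) : Set (MvPolynomial (τ ⊕ σ) ℂ)) =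
      Ideal.span (Set.range G) := by
    refine le_antisymm (Ideal.span_le.2 ?_) (Ideal.span_mono Submodule.subset_span)
    exact Submodule.span_le (p := (Ideal.span (Set.range G)).restrictScalars ℂ).2
      Ideal.subset_span
  have key : ∀ c ∈ Finset.Icc 1 (Fintype.card σ), ∃ Δ : MvPolynomial τ ℂ, Δ ≠ 0 ∧
      Δ.totalDegree ≤ Fintype.card τ * (3 * (Fintype.card σ + 1) * d ^ (c - 1)) ∧
      ∀ P ∈ S, P.height = c → rename Sum.inl Δ ∈ P := by
    intro c hc
    rw [Finset.mem_Icc] at hc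
    obtain ⟨Δ, h0, hdeg, h⟩ := exists_eliminant_of_height_eq (S := {P ∈ S | P.height = c})
      (by omega) hc.1 hc.2 (Submodule.span_le.2 (Set.range_subset_iff.2 hG))
      (fun P hP => hspan ▸ hS P hP.1) (fun P hP => hP.2) fun P hP => hτ P hP.1
    exact ⟨Δ, h0, hdeg, fun P hP hPc => h P ⟨hP, hPc⟩⟩
  choose! Δ h0 hdeg hΔ using key
  refine ⟨∏ c ∈ Finset.Icc 1 (Fintype.card σ), Δ c, Finset.prod_ne_zero_iff.2 h0, ?_, ?_⟩
  · refine (totalDegree_finsetProd _ _).trans ((Finset.sum_le_sum hdeg).trans ?_)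
    rw [← Finset.mul_sum, ← Finset.mul_sum]
    calc _ ≤ Fintype.card τ * (3 * (Fintype.card σ + 1) * (2 * d ^ (Fintype.card σ - 1))) := by
          gcongr
          exact sum_pow_sub_one_le hd hσ
      _ = _ := by ring
  · intro P hP
    have hPp : P.IsPrime := (hS P hP).1.1
    have hht : P.height ≤ Fintype.card σ := by
      have h := Ideal.height_le_card_of_mem_minimalPrimes_span_finset (s := Finset.univ.image G)
        (p := P) (by simpa using hS P hP)
      refine h.trans ?_
      exact_mod_cast Finset.card_image_le.trans hι
    obtain ⟨c, hc⟩ := ENat.ne_top_iff_exists.1 (ne_top_of_le_ne_top (by simp) hht)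
    rw [← hc] at hht
    have hc1 : c ≠ 0 := by
      rintro rfl
      obtain ⟨f, hf0, hf⟩ := hτ P hP
      have hbot : P = ⊥ := by
        rw [← Ideal.height_eq_zero_iff_eq_bot]
        exact hc.symm
      rw [hbot, Ideal.mem_bot] at hf
      exact hf0 (rename_injective _ Sum.inl_injective (by simpa using hf))
    have hmem : c ∈ Finset.Icc 1 (Fintype.card σ) :=
      Finset.mem_Icc.2 ⟨by omega, by exact_mod_cast hht⟩
    rw [← Finset.prod_erase_mul _ _ hmem, map_mul]
    exact P.mul_mem_left _ (hΔ c hmem P hP hc.symm)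

theorem sum_variation_eq_zero {K α β γ : Type*} [CommRing K] [Fintype α] [Fintype β] [Fintype γ]
    {P : β → α → K} {H : β → α → α → K} {a da : α → γ → K} {dy : α → K} {ℓ dℓ μ : β → K} {ν : γ → K}
    (h₁ : ∀ j, ∑ m, P j m * dy m = 0)
    (h₂ : ∀ c, ∑ j, ∑ m, (dℓ j * a m c * P j m + ℓ j * da m c * P j m +
      ℓ j * a m c * ∑ m', H j m m' * dy m') = 0)
    (h₃ : ∀ j, ∑ c, ∑ m, ν c * a m c * P j m = 0)
    (h₄ : ∀ m', ∑ j, μ j * P j m' + ∑ j, ∑ c, ∑ m, ℓ j * ν c * a m c * H j m m' = 0) :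
    ∑ c, ∑ j, ∑ m, ν c * ℓ j * da m c * P j m = 0 := by
  have e₂ : ∑ c, ν c * ∑ j, ∑ m, (dℓ j * a m c * P j m + ℓ j * da m c * P j m +
      ℓ j * a m c * ∑ m', H j m m' * dy m') = 0 := by simp [h₂]
  have e₃ : ∑ j, dℓ j * ∑ c, ∑ m, ν c * a m c * P j m = 0 := by simp [h₃]
  have e₁ : ∑ j, μ j * ∑ m, P j m * dy m = 0 := by simp [h₁]
  have e₄ : ∑ m', dy m' * (∑ j, μ j * P j m' + ∑ j, ∑ c, ∑ m, ℓ j * ν c * a m c * H j m m') = 0 := by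
    simp [h₄]
  have s₃ : ∑ j, dℓ j * ∑ c, ∑ m, ν c * a m c * P j m =
      ∑ c, ∑ j, ∑ m, ν c * (dℓ j * a m c * P j m) := by
    rw [Finset.sum_comm]
    refine Finset.sum_congr rfl fun j _ => ?_
    simp only [Finset.mul_sum]
    exact Finset.sum_congr rfl fun c _ => Finset.sum_congr rfl fun m _ => by ring
  have s₁ : ∑ m', dy m' * ∑ j, μ j * P j m' = ∑ j, μ j * ∑ m, P j m * dy m := by
    simp only [Finset.mul_sum]
    rw [Finset.sum_comm]
    exact Finset.sum_congr rfl fun j _ => Finset.sum_congr rfl fun m _ => by ring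
  have s₄ : ∑ m', dy m' * ∑ j, ∑ c, ∑ m, ℓ j * ν c * a m c * H j m m' =
      ∑ c, ∑ j, ∑ m, ν c * (ℓ j * a m c * ∑ m', H j m m' * dy m') := by
    simp only [Finset.mul_sum]
    rw [Finset.sum_comm]
    rw [Finset.sum_comm (s := (Finset.univ : Finset γ))]
    refine Finset.sum_congr rfl fun j _ => ?_
    rw [Finset.sum_comm]
    refine Finset.sum_congr rfl fun c _ => ?_
    rw [Finset.sum_comm]
    exact Finset.sum_congr rfl fun m _ => Finset.sum_congr rfl fun m' _ => by ring
  simp only [mul_add, Finset.sum_add_distrib] at e₄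
  rw [s₁, e₁, s₄, zero_add] at e₄
  rw [s₃] at e₃
  simp only [Finset.mul_sum] at e₃ e₄
  simp only [Finset.mul_sum, mul_add, Finset.sum_add_distrib] at e₂
  rw [e₃, e₄, zero_add, add_zero] at e₂
  simpa only [mul_assoc] using e₂

/-- The index type of the fibre variables `y`, `ℓ`, `ν`, `μ` of the critical system. -/
abbrev CritVar (n p r : ℕ) : Type := Fin n ⊕ Fin p ⊕ Fin r ⊕ Fin p

/-- The ring of the critical system. -/
abbrev CritRing (n p r : ℕ) : Type := MvPolynomial ((Fin n × Fin r) ⊕ CritVar n p r) ℂ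

section CritSys

variable {n p r : ℕ}

/-- A polynomial in the variables `y`. -/
def critLift (p r : ℕ) (g : MvPolynomial (Fin n) ℂ) : CritRing n p r :=
  rename Sum.inr (rename Sum.inl g)

/-- The entries of the base matrix. -/
def critA (m : Fin n) (c : Fin r) : CritRing n p r := X (Sum.inl (m, c))

/-- The variables `ℓ`. -/
def critL (j : Fin p) : CritRing n p r := X (Sum.inr (Sum.inr (Sum.inl j)))

/-- The variables `ν`. -/
def critN (c : Fin r) : CritRing n p r := X (Sum.inr (Sum.inr (Sum.inr (Sum.inl c))))

/-- The variables `μ`. -/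
def critM (j : Fin p) : CritRing n p r := X (Sum.inr (Sum.inr (Sum.inr (Sum.inr j))))

/-- The equations satisfied by the points `(y, ℓ)` at which the Lagrange system of `f` along the
columns of `a` is degenerate, `(μ, ν)` being a left kernel vector of its Jacobian matrix. -/
def critSys (f : Fin p → MvPolynomial (Fin n) ℂ) (r : ℕ) :
    Fin p ⊕ Fin r ⊕ Fin p ⊕ Fin n → CritRing n p r
  | Sum.inl j => critLift p r (f j)
  | Sum.inr (Sum.inl c) => ∑ j, ∑ m, critL j * critA m c * critLift p r (pderiv m (f j))
  | Sum.inr (Sum.inr (Sum.inl j)) =>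
      ∑ c, ∑ m, critN c * critA m c * critLift p r (pderiv m (f j))
  | Sum.inr (Sum.inr (Sum.inr m')) => ∑ j, critM j * critLift p r (pderiv m' (f j)) +
      ∑ j, ∑ c, ∑ m, critL j * critN c * critA m c * critLift p r (pderiv m' (pderiv m (f j)))

theorem totalDegree_pderiv_le (g : MvPolynomial (Fin n) ℂ) (k : Fin n) :
    (pderiv k g).totalDegree ≤ g.totalDegree - 1 := by
  classical
  conv_lhs => rw [g.as_sum, map_sum]
  refine totalDegree_finsetSum_le fun s hs => ?_
  rw [pderiv_monomial]
  obtain h0 | h0 := Nat.eq_zero_or_pos (s k)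
  · simp [h0]
  refine (totalDegree_monomial_le _ _).trans ?_
  have h1 : (s - Finsupp.single k 1).degree + 1 = s.degree := by
    have hle : Finsupp.single k 1 ≤ s := Finsupp.single_le_iff.2 h0
    have h := congrArg Finsupp.degree (tsub_add_cancel_of_le hle)
    rwa [map_add, Finsupp.degree_single] at h
  have h2 : s.degree ≤ g.totalDegree := le_totalDegree hs
  change (s - Finsupp.single k 1).degree ≤ _
  omega

theorem critSys_mem_bidegLE (f : Fin p → MvPolynomial (Fin n) ℂ) (r : ℕ) {d : ℕ} (hd : 2 ≤ d)
    (hf : ∀ j, (f j).totalDegree ≤ d) (k) :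
    critSys f r k ∈ bidegLE (Fin n × Fin r) (CritVar n p r) 1 d := by
  have hlift : ∀ (g : MvPolynomial (Fin n) ℂ) {e : ℕ}, g.totalDegree ≤ e →
      critLift p r g ∈ bidegLE (Fin n × Fin r) (CritVar n p r) 0 e := fun g e hg =>
    rename_inr_mem_bidegLE ((totalDegree_rename_le _ _).trans hg)
  have hf1 : ∀ j m, (pderiv m (f j)).totalDegree ≤ d - 1 := fun j m =>
    (totalDegree_pderiv_le _ _).trans (Nat.sub_le_sub_right (hf j) 1)
  have hf2 : ∀ j m m', (pderiv m' (pderiv m (f j))).totalDegree ≤ d - 2 := fun j m m' =>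
    (totalDegree_pderiv_le _ _).trans (by have := hf1 j m; omega)
  have hA : ∀ m c, (critA m c : CritRing n p r) ∈ bidegLE (Fin n × Fin r) (CritVar n p r) 1 0 :=
    fun m c => X_inl_mem_bidegLE _
  have hL : ∀ j, (critL j : CritRing n p r) ∈ bidegLE (Fin n × Fin r) (CritVar n p r) 0 1 :=
    fun j => X_inr_mem_bidegLE _
  have hN : ∀ j, (critN j : CritRing n p r) ∈ bidegLE (Fin n × Fin r) (CritVar n p r) 0 1 :=
    fun j => X_inr_mem_bidegLE _
  have hM : ∀ j, (critM j : CritRing n p r) ∈ bidegLE (Fin n × Fin r) (CritVar n p r) 0 1 :=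
    fun j => X_inr_mem_bidegLE _
  obtain j | c | j | m' := k
  · exact bidegLE_mono (by omega) le_rfl (hlift _ (hf j))
  · refine Submodule.sum_mem _ fun j _ => Submodule.sum_mem _ fun m _ => ?_
    exact bidegLE_mono (by omega) (by omega)
      (mul_mem_bidegLE (mul_mem_bidegLE (hL j) (hA m c)) (hlift _ (hf1 j m)))
  · refine Submodule.sum_mem _ fun c _ => Submodule.sum_mem _ fun m _ => ?_
    exact bidegLE_mono (by omega) (by omega)
      (mul_mem_bidegLE (mul_mem_bidegLE (hN c) (hA m c)) (hlift _ (hf1 j m)))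
  · refine Submodule.add_mem _ (Submodule.sum_mem _ fun j _ => ?_) (Submodule.sum_mem _ fun j _ =>
      Submodule.sum_mem _ fun c _ => Submodule.sum_mem _ fun m _ => ?_)
    · exact bidegLE_mono (by omega) (by omega) (mul_mem_bidegLE (hM j) (hlift _ (hf1 j m')))
    · exact bidegLE_mono (by omega) (by omega) (mul_mem_bidegLE (mul_mem_bidegLE
        (mul_mem_bidegLE (hL j) (hN c)) (hA m c)) (hlift _ (hf2 j m m')))

/-- Sard: a prime over the critical system at whose generic point `ν` and `Jᵀℓ` are nonzero
does not dominate the base. -/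
theorem exists_rename_inl_mem_of_critSys (f : Fin p → MvPolynomial (Fin n) ℂ)
    (P : Ideal (CritRing n p r)) [P.IsPrime] (hP : ∀ k, critSys f r k ∈ P) {c : Fin r} {b : Fin n}
    (hcb : critN c * ∑ j, critL j * critLift p r (pderiv b (f j)) ∉ P) :
    ∃ g : MvPolynomial (Fin n × Fin r) ℂ, g ≠ 0 ∧ rename Sum.inl g ∈ P := by
  classical
  by_contra! hcon
  let K := FractionRing (CritRing n p r ⧸ P)
  have hind : AlgebraicIndependent ℂ fun t : Fin n × Fin r => toResidue P (X (Sum.inl t)) := by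
    rw [algebraicIndependent_iff]
    intro g hg
    by_contra hg0
    refine hcon g hg0 ?_
    rw [← toResidue_eq_zero_iff P, toResidue_eq_aeval, aeval_rename]
    exact hg
  obtain ⟨D, hD⟩ := exists_derivation_of_algebraicIndependent hind (Pi.single (b, c) 1)
  let y : Fin n → K := fun m => toResidue P (X (Sum.inr (Sum.inl m)))
  have hy : ∀ g, toResidue P (critLift p r g) = aeval y g := fun g => by
    rw [critLift, toResidue_eq_aeval, aeval_rename, aeval_rename]
    rfl
  have hDg : ∀ g, D (aeval y g) = ∑ m, aeval y (pderiv m g) * D (y m) := derivation_aeval D y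
  have hz : ∀ k, toResidue P (critSys f r k) = 0 := fun k => (toResidue_eq_zero_iff P).2 (hP k)
  have hvar := sum_variation_eq_zero (P := fun j m => aeval y (pderiv m (f j)))
    (H := fun j m m' => aeval y (pderiv m' (pderiv m (f j))))
    (a := fun m c => toResidue P (critA m c)) (da := fun m c => D (toResidue P (critA m c)))
    (dy := fun m => D (y m)) (ℓ := fun j => toResidue P (critL j))
    (dℓ := fun j => D (toResidue P (critL j)))
    (μ := fun j => toResidue P (critM j)) (ν := fun c => toResidue P (critN c))
    (fun j => by
      have h := hz (Sum.inl j)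
      rw [critSys, hy] at h
      rw [← hDg, h, map_zero])
    (fun c' => by
      have h := congrArg D (hz (Sum.inr (Sum.inl c')))
      simp only [critSys, map_sum, map_mul, hy, map_zero, Derivation.leibniz, smul_eq_mul, hDg] at h
      rw [← h]
      exact Finset.sum_congr rfl fun j _ => Finset.sum_congr rfl fun m _ => by ring)
    (fun j => by
      have h := hz (Sum.inr (Sum.inr (Sum.inl j)))
      simpa only [critSys, map_sum, map_mul, hy] using h)
    (fun m' => by
      have h := hz (Sum.inr (Sum.inr (Sum.inr m')))
      simpa only [critSys, map_sum, map_mul, map_add, hy] using h)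
  refine hcb ((toResidue_eq_zero_iff P).1 ?_)
  have hda : ∀ m c', D (toResidue P (critA m c')) = if c' = c then if m = b then 1 else 0 else 0 := by
    intro m c'
    refine (hD (m, c')).trans ?_
    simp only [Pi.single_apply, Prod.mk.injEq]
    split_ifs <;> simp_all
  simp only [hda, mul_ite, ite_mul, mul_one, mul_zero, zero_mul, Finset.sum_ite_irrel,
    Finset.sum_const_zero, Finset.sum_ite_eq', Finset.mem_univ, if_true] at hvar
  rw [← hvar]
  simp only [map_mul, map_sum, hy, Finset.mul_sum, mul_assoc]

end CritSys

theorem exists_critSys_eliminant {n p r d : ℕ} (hn : 0 < n) (hr : 0 < r) (hd : 2 ≤ d)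
    (f : Fin p → MvPolynomial (Fin n) ℂ) (hf : ∀ j, (f j).totalDegree ≤ d) :
    ∃ Δ : MvPolynomial (Fin n × Fin r) ℂ, Δ ≠ 0 ∧
      Δ.totalDegree ≤ 6 * (n * r) * (n + p + r + p + 1) * d ^ (n + p + r + p - 1) ∧
      ∀ z : (Fin n × Fin r) ⊕ CritVar n p r → ℂ, (∀ k, eval z (critSys f r k) = 0) →
        (∃ c b, eval z (critN c * ∑ j, critL j * critLift p r (pderiv b (f j))) ≠ 0) →
        eval (z ∘ Sum.inl) Δ = 0 := by
  have : Nonempty (Fin n × Fin r) := ⟨(⟨0, hn⟩, ⟨0, hr⟩)⟩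
  have hcard : Fintype.card (CritVar n p r) = n + p + r + p := by
    simp only [Fintype.card_sum, Fintype.card_fin]; ring
  obtain ⟨Δ, h0, hdeg, hΔ⟩ := exists_eliminant (τ := Fin n × Fin r) (σ := CritVar n p r) hd
    (by omega) (by simp only [Fintype.card_sum, Fintype.card_fin]; omega) (critSys f r)
    (critSys_mem_bidegLE f r hd hf)
    (S := {P | P ∈ (Ideal.span (Set.range (critSys f r))).minimalPrimes ∧
      ∃ c b, critN c * ∑ j, critL j * critLift p r (pderiv b (f j)) ∉ P})
    (fun P hP => hP.1) (fun P hP => by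
      obtain ⟨hmin, c, b, hcb⟩ := hP
      have := hmin.1.1
      exact exists_rename_inl_mem_of_critSys f P (fun k => hmin.1.2 (Ideal.subset_span ⟨k, rfl⟩))
        hcb)
  refine ⟨Δ, h0, by simpa [hcard] using hdeg, ?_⟩
  rintro z hz ⟨c, b, hcb⟩
  have hker : Ideal.span (Set.range (critSys f r)) ≤ RingHom.ker (eval z) := by
    rw [Ideal.span_le, Set.range_subset_iff]
    exact hz
  have hprime : (RingHom.ker (eval z)).IsPrime := RingHom.ker_isPrime _
  obtain ⟨P, hP, hPle⟩ := Ideal.exists_minimalPrimes_le hker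
  have := hPle (hΔ P ⟨hP, c, b, fun h => hcb (hPle h)⟩)
  rwa [RingHom.mem_ker, eval_rename] at this

theorem critical_degree_bound {n p r d : ℕ} (hp : p < n) (hr : r < n) (hr0 : 0 < r) (hd : 2 ≤ d) :
    6 * (n * r) * (n + p + r + p + 1) * d ^ (n + p + r + p - 1) ≤ n * d ^ (5 * n) := by
  have hnum : ∀ m, 6 * (m + 1) * (4 * m + 6) ≤ 2 ^ (m + 6) := by
    intro m
    by_cases hm : m < 4
    · interval_cases m <;> norm_num
    · induction m, (not_lt.1 hm) using Nat.le_induction with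
      | base => norm_num
      | succ m hm4 ih =>
        have := ih (by omega)
        rw [show m + 1 + 6 = (m + 6) + 1 by ring, pow_succ]
        nlinarith
  obtain ⟨m, rfl⟩ : ∃ m, n = m + 2 := ⟨n - 2, by omega⟩
  calc _ ≤ 6 * ((m + 2) * (m + 1)) * (4 * m + 6) * d ^ (4 * m + 4) := by
        refine Nat.mul_le_mul (Nat.mul_le_mul ?_ (by omega))
          (Nat.pow_le_pow_right (by omega) (by omega))
        exact Nat.mul_le_mul_left _ (Nat.mul_le_mul_left _ (by omega))
    _ = (m + 2) * (6 * (m + 1) * (4 * m + 6)) * d ^ (4 * m + 4) := by ring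
    _ ≤ (m + 2) * d ^ (m + 6) * d ^ (4 * m + 4) := by
        gcongr
        exact (hnum m).trans (Nat.pow_le_pow_left hd _)
    _ = (m + 2) * d ^ (5 * (m + 2)) := by rw [mul_assoc, ← pow_add]; congr 2; ring

theorem eval_changeVars {n : ℕ} (A : Matrix (Fin n) (Fin n) ℂ) (f : MvPolynomial (Fin n) ℂ)
    (x : Fin n → ℂ) : eval x (changeVars A f) = eval (A.mulVec x) f := by
  rw [changeVars, ← aeval_eq_eval, ← aeval_eq_eval]
  change (aeval x).comp (aeval _) f = _
  congr 1
  ext k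
  simp [Matrix.mulVec, dotProduct]

theorem pderiv_changeVars {n : ℕ} (A : Matrix (Fin n) (Fin n) ℂ) (f : MvPolynomial (Fin n) ℂ)
    (k : Fin n) :
    pderiv k (changeVars A f) = ∑ m, C (A m k) * changeVars A (pderiv m f) := by
  classical
  induction f using MvPolynomial.induction_on with
  | C a => simp [changeVars]
  | add f g hf hg =>
    have hadd : ∀ f g, changeVars A (f + g) = changeVars A f + changeVars A g := fun f g =>
      map_add _ f g
    simp only [hadd, map_add, hf, hg, mul_add, Finset.sum_add_distrib]
  | mul_X f j hf =>
    have hmul : ∀ f g, changeVars A (f * g) = changeVars A f * changeVars A g := fun f g =>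
      map_mul _ f g
    have hadd : ∀ f g, changeVars A (f + g) = changeVars A f + changeVars A g := fun f g =>
      map_add _ f g
    have hX : ∀ j, changeVars A (X j) = ∑ m, C (A j m) * X m := fun j => by simp [changeVars]
    have h1 : pderiv k (changeVars A (X j)) = C (A j k) := by
      simp [hX, Derivation.leibniz, pderiv_X, Pi.single_apply]
    have h2 : ∀ m, changeVars A (pderiv m (X j)) = if m = j then 1 else 0 := fun m => by
      obtain rfl | h := eq_or_ne m j
      · simp [changeVars]
      · rw [if_neg h, pderiv_X_of_ne h.symm]
        exact map_zero _
    simp only [hmul, Derivation.leibniz, smul_eq_mul, hadd, h1, h2, hf, mul_add,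
      Finset.sum_add_distrib, mul_ite, mul_one, mul_zero, Finset.sum_ite_eq', Finset.mem_univ,
      if_true, Finset.mul_sum]
    congr 1
    · ring
    · exact Finset.sum_congr rfl fun m _ => by ring

/-- `(y, ℓ)` is a zero of the Lagrange system of `f` along the columns of `a`, and `(μ, ν)`
lies in the left kernel of the Jacobian matrix of this system at `(y, ℓ)`. -/
structure IsCritical {n p r : ℕ} (f : Fin p → MvPolynomial (Fin n) ℂ) (a : Fin n → Fin r → ℂ)
    (y : Fin n → ℂ) (ℓ : Fin p → ℂ) (ν : Fin r → ℂ) (μ : Fin p → ℂ) : Prop where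
  zero : ∀ j, eval y (f j) = 0
  lag : ∀ c, ∑ j, ∑ m, ℓ j * a m c * eval y (pderiv m (f j)) = 0
  ker : ∀ j, ∑ c, ∑ m, ν c * a m c * eval y (pderiv m (f j)) = 0
  hess : ∀ m', ∑ j, μ j * eval y (pderiv m' (f j)) +
    ∑ j, ∑ c, ∑ m, ℓ j * ν c * a m c * eval y (pderiv m' (pderiv m (f j))) = 0

/-- The point of the total space of the critical system with the given coordinates. -/
def critPoint {n p r : ℕ} (a : Fin n → Fin r → ℂ) (y : Fin n → ℂ) (ℓ : Fin p → ℂ) (ν : Fin r → ℂ)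
    (μ : Fin p → ℂ) : (Fin n × Fin r) ⊕ CritVar n p r → ℂ :=
  Sum.elim (fun t => a t.1 t.2) (Sum.elim y (Sum.elim ℓ (Sum.elim ν μ)))

theorem eval_critLift {n p r : ℕ} (a : Fin n → Fin r → ℂ) (y : Fin n → ℂ) (ℓ : Fin p → ℂ)
    (ν : Fin r → ℂ) (μ : Fin p → ℂ) (g : MvPolynomial (Fin n) ℂ) :
    eval (critPoint a y ℓ ν μ) (critLift p r g) = eval y g := by
  rw [critLift, eval_rename, eval_rename]
  rfl

theorem eval_critA {n p r : ℕ} (a : Fin n → Fin r → ℂ) (y : Fin n → ℂ) (ℓ : Fin p → ℂ)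
    (ν : Fin r → ℂ) (μ : Fin p → ℂ) (m : Fin n) (c : Fin r) :
    eval (critPoint a y ℓ ν μ) (critA m c) = a m c :=
  eval_X _

theorem eval_critL {n p r : ℕ} (a : Fin n → Fin r → ℂ) (y : Fin n → ℂ) (ℓ : Fin p → ℂ)
    (ν : Fin r → ℂ) (μ : Fin p → ℂ) (j : Fin p) :
    eval (critPoint a y ℓ ν μ) (critL j) = ℓ j :=
  eval_X _

theorem eval_critN {n p r : ℕ} (a : Fin n → Fin r → ℂ) (y : Fin n → ℂ) (ℓ : Fin p → ℂ)
    (ν : Fin r → ℂ) (μ : Fin p → ℂ) (c : Fin r) :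
    eval (critPoint a y ℓ ν μ) (critN c) = ν c :=
  eval_X _

theorem eval_critM {n p r : ℕ} (a : Fin n → Fin r → ℂ) (y : Fin n → ℂ) (ℓ : Fin p → ℂ)
    (ν : Fin r → ℂ) (μ : Fin p → ℂ) (j : Fin p) :
    eval (critPoint a y ℓ ν μ) (critM j) = μ j :=
  eval_X _

theorem IsCritical.eval_critSys {n p r : ℕ} {f : Fin p → MvPolynomial (Fin n) ℂ}
    {a : Fin n → Fin r → ℂ} {y : Fin n → ℂ} {ℓ : Fin p → ℂ} {ν : Fin r → ℂ} {μ : Fin p → ℂ}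
    (h : IsCritical f a y ℓ ν μ) (k) :
    eval (critPoint a y ℓ ν μ) (critSys f r k) = 0 := by
  obtain j | c | j | m' := k
  · rw [critSys, eval_critLift]
    exact h.zero j
  · simpa [critSys, eval_critLift, eval_critL, eval_critA] using h.lag c
  · simpa [critSys, eval_critLift, eval_critN, eval_critA] using h.ker j
  · simpa [critSys, eval_critLift, eval_critL, eval_critN, eval_critA, eval_critM] using h.hess m'

theorem exists_isCritical_of_not_isRegularValueOn {n p i : ℕ} (f : Fin p → MvPolynomial (Fin n) ℂ)
    {A : Matrix (Fin n) (Fin n) ℂ} (hA : IsUnit A)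
    (h : ¬ IsRegularValueOn (hSys (fun j => changeVars A (f j)) i) {z | z ∘ Sum.inr ≠ 0}) :
    ∃ y ℓ ν μ, ℓ ≠ 0 ∧ (ν = 0 → μ ≠ 0) ∧
      IsCritical f (fun m c => A m (colIdx n i c)) y ℓ ν μ := by
  classical
  unfold IsRegularValueOn at h
  push Not at h
  obtain ⟨z, hz, hzero, hrank⟩ := h
  have hli : ¬ LinearIndependent ℂ (jacEval (hSys (fun j => changeVars A (f j)) i) z).row := by
    intro hli
    exact hrank hli.rank_matrix
  obtain ⟨v, hv, b, hb⟩ := Fintype.not_linearIndependent_iff.1 hli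
  have hren : ∀ g : MvPolynomial (Fin n) ℂ, eval z (rename Sum.inl (changeVars A g)) =
      eval (A.mulVec (z ∘ Sum.inl)) g := fun g => by rw [eval_rename, eval_changeVars]
  have hcol : ∀ k, ∑ j, v (Sum.inl j) * eval z (pderiv k (rename Sum.inl (changeVars A (f j)))) +
      ∑ c, v (Sum.inr c) * eval z (pderiv k (lagEntry (fun j => changeVars A (f j)) i c)) = 0 := by
    intro k
    have := congrFun hv k
    simpa [jacEval, Matrix.row, Fintype.sum_sum_type, hSys] using this
  refine ⟨A.mulVec (z ∘ Sum.inl), z ∘ Sum.inr, v ∘ Sum.inr, v ∘ Sum.inl, hz, fun hν hμ => hb ?_,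
    fun j => ?_, fun c => ?_, fun j => ?_, ?_⟩
  · obtain b | b := b
    · exact congrFun hμ b
    · exact congrFun hν b
  · rw [← hren]
    exact hzero (Sum.inl j)
  · have := hzero (Sum.inr c)
    simp only [hSys, Sum.elim_inr, lagEntry, pderiv_changeVars, map_sum, map_mul, rename_C, eval_C,
      hren, eval_X, Finset.mul_sum] at this
    simpa only [Function.comp_apply, mul_assoc] using this
  · have := hcol (Sum.inr j)
    simp only [pderiv_inr_rename_inl, pderiv_inr_lagEntry, pderiv_changeVars, map_zero, mul_zero,
      Finset.sum_const_zero, zero_add, map_sum, map_mul, rename_C, eval_C, hren,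
      Finset.mul_sum] at this
    simpa only [Function.comp_apply, mul_assoc] using this
  · set y := A.mulVec (z ∘ Sum.inl)
    let w : Fin n → ℂ := fun m' => ∑ j, v (Sum.inl j) * eval y (pderiv m' (f j)) +
      ∑ j, ∑ c, ∑ m, z (Sum.inr j) * v (Sum.inr c) * A m (colIdx n i c) *
        eval y (pderiv m' (pderiv m (f j)))
    have hw : A.transpose.mulVec w = 0 := by
      ext k
      have := hcol (Sum.inl k)
      have hlag : ∀ c, pderiv (Sum.inl k) (lagEntry (fun j => changeVars A (f j)) i c) =
          ∑ j, X (Sum.inr j) * rename Sum.inl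
            (pderiv k (pderiv (colIdx n i c) (changeVars A (f j)))) := by
        intro c
        simp only [lagEntry, map_sum, Derivation.leibniz, smul_eq_mul,
          pderiv_rename Sum.inl_injective]
        refine Finset.sum_congr rfl fun j _ => ?_
        rw [pderiv_X_of_ne (by simp), mul_zero, add_zero]
      rw [Pi.zero_apply, ← this]
      simp only [hlag, pderiv_rename Sum.inl_injective, pderiv_changeVars, map_sum, map_mul,
        Derivation.leibniz, pderiv_C, smul_eq_mul, mul_zero, add_zero, rename_C, eval_C, eval_X,
        hren, Matrix.mulVec, dotProduct, Matrix.transpose_apply, w, mul_add,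
        Finset.sum_add_distrib, Finset.mul_sum]
      congr 1
      · rw [Finset.sum_comm]
        exact Finset.sum_congr rfl fun j _ => Finset.sum_congr rfl fun m _ => by ring
      · rw [Finset.sum_comm, Finset.sum_comm (s := (Finset.univ : Finset (Fin (n - i))))]
        refine Finset.sum_congr rfl fun j _ => ?_
        rw [Finset.sum_comm]
        refine Finset.sum_congr rfl fun c _ => ?_
        rw [Finset.sum_comm]
        exact Finset.sum_congr rfl fun m _ => Finset.sum_congr rfl fun m' _ => by ring
    have hw0 : w = 0 := by
      refine Matrix.mulVec_injective_iff_isUnit.2 ?_ (hw.trans (Matrix.mulVec_zero _).symm)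
      rwa [Matrix.isUnit_transpose]
    exact congrFun hw0

theorem totalDegree_det_le {ι : Type*} {s : ℕ} (B : Matrix (Fin s) (Fin s) (MvPolynomial ι ℂ))
    (hB : ∀ u v, (B u v).totalDegree ≤ 1) : B.det.totalDegree ≤ s := by
  rw [Matrix.det_apply']
  refine totalDegree_finsetSum_le fun π _ => ?_
  refine (totalDegree_mul _ _).trans ?_
  rw [← map_intCast (C : ℂ →+* MvPolynomial ι ℂ), totalDegree_C, zero_add]
  refine (totalDegree_finsetProd _ _).trans ((Finset.sum_le_sum fun u _ => hB (π u) u).trans ?_)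
  simp

/-- A minor of the product of `J` with the generic `n × r` matrix. -/
def genericMinor {n p r s : ℕ} (J : Matrix (Fin p) (Fin n) ℂ) (e₁ : Fin s → Fin p)
    (e₂ : Fin s → Fin r) : MvPolynomial (Fin n × Fin r) ℂ :=
  (Matrix.of fun u v => ∑ m, C (J (e₁ u) m) * X (m, e₂ v)).det

theorem eval_genericMinor {n p r s : ℕ} (J : Matrix (Fin p) (Fin n) ℂ) (e₁ : Fin s → Fin p)
    (e₂ : Fin s → Fin r) (a : Matrix (Fin n) (Fin r) ℂ) :
    eval (fun t => a t.1 t.2) (genericMinor J e₁ e₂) = ((J * a).submatrix e₁ e₂).det := by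
  rw [genericMinor, RingHom.map_det]
  congr 1
  ext u v
  simp [Matrix.mul_apply]

theorem totalDegree_genericMinor_le {n p r s : ℕ} (J : Matrix (Fin p) (Fin n) ℂ)
    (e₁ : Fin s → Fin p) (e₂ : Fin s → Fin r) : (genericMinor J e₁ e₂).totalDegree ≤ s := by
  refine totalDegree_det_le _ fun u v => ?_
  rw [Matrix.of_apply]
  refine totalDegree_finsetSum_le fun m _ => ?_
  refine (totalDegree_mul _ _).trans ?_
  rw [totalDegree_C, totalDegree_X]

theorem genericMinor_ne_zero {n p r s : ℕ} {J : Matrix (Fin p) (Fin n) ℂ} (hJ : J.rank = p)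
    {e₁ : Fin s → Fin p} (h₁ : Function.Injective e₁) {e₂ : Fin s → Fin r}
    (h₂ : Function.Injective e₂) : genericMinor J e₁ e₂ ≠ 0 := by
  classical
  have hsurj : Function.Surjective J.mulVec := by
    have : LinearMap.range J.mulVecLin = ⊤ :=
      Submodule.eq_top_of_finrank_eq (by rw [← Matrix.rank, hJ]; simp)
    exact LinearMap.range_eq_top.1 this
  obtain ⟨K, hK⟩ := Matrix.mulVec_surjective_iff_exists_right_inverse.1 hsurj
  let a : Matrix (Fin n) (Fin r) ℂ :=
    Matrix.of fun m => Function.extend e₂ (fun v => K m (e₁ v)) 0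
  intro h0
  have h := eval_genericMinor J e₁ e₂ a
  rw [h0, map_zero, show (J * a).submatrix e₁ e₂ = 1 from ?_, Matrix.det_one] at h
  · exact zero_ne_one h
  ext u v
  have := congrFun (congrFun hK (e₁ u)) (e₁ v)
  simp only [Matrix.mul_apply, Matrix.submatrix_apply, a, Matrix.of_apply, h₂.extend_apply] at this ⊢
  rw [this, Matrix.one_apply, Matrix.one_apply]
  simp [h₁.eq_iff]

theorem exists_affine_eliminant {n p r : ℕ} (hr : r ≤ n) {J : Matrix (Fin p) (Fin n) ℂ}
    (hJ : J.rank = p) :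
    ∃ Δ : MvPolynomial (Fin n × Fin r) ℂ, Δ ≠ 0 ∧ Δ.totalDegree ≤ n ∧
      ∀ (a : Matrix (Fin n) (Fin r) ℂ) (ℓ : Fin p → ℂ) (ν : Fin r → ℂ), ℓ ≠ 0 → ν ≠ 0 →
        Matrix.vecMul ℓ (J * a) = 0 → (J * a).mulVec ν = 0 →
        eval (fun t => a t.1 t.2) Δ = 0 := by
  obtain hpr | hpr := le_total p r
  · refine ⟨genericMinor J id (Fin.castLE hpr), genericMinor_ne_zero hJ Function.injective_id
      (Fin.castLE_injective hpr), (totalDegree_genericMinor_le _ _ _).trans (hpr.trans hr), ?_⟩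
    intro a ℓ ν hℓ hν h₁ h₂
    rw [eval_genericMinor]
    refine Matrix.exists_vecMul_eq_zero_iff.1 ⟨ℓ, hℓ, ?_⟩
    ext v
    exact congrFun h₁ (Fin.castLE hpr v)
  · refine ⟨genericMinor J (Fin.castLE hpr) id, genericMinor_ne_zero hJ (Fin.castLE_injective hpr)
      Function.injective_id, (totalDegree_genericMinor_le _ _ _).trans hr, ?_⟩
    intro a ℓ ν hℓ hν h₁ h₂
    rw [eval_genericMinor]
    refine Matrix.exists_mulVec_eq_zero_iff.1 ⟨ν, hν, ?_⟩
    ext u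
    exact congrFun h₂ (Fin.castLE hpr u)

theorem exists_eliminant_isCritical {n p d i : ℕ} (hd : 0 < d) (hi : 1 ≤ i)
    (f : Fin p → MvPolynomial (Fin n) ℂ) (hdeg : ∀ j, (f j).totalDegree ≤ d)
    (hsm : ∀ x : Fin n → ℂ, (∀ j, eval x (f j) = 0) → (jacEval f x).rank = p) :
    ∃ Δ : MvPolynomial (Fin n × Fin (n - i)) ℂ, Δ ≠ 0 ∧ Δ.totalDegree ≤ n * d ^ (5 * n) ∧
      ∀ A : Matrix (Fin n) (Fin n) ℂ, IsUnit A → ∀ y ℓ ν μ, ℓ ≠ 0 → (ν = 0 → μ ≠ 0) →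
        IsCritical f (fun m c => A m (colIdx n i c)) y ℓ ν μ →
        eval (fun t => A t.1 (colIdx n i t.2)) Δ = 0 := by
  classical
  have hker : ∀ y, (∀ j, eval y (f j) = 0) → ∀ μ : Fin p → ℂ,
      (∀ m, ∑ j, μ j * eval y (pderiv m (f j)) = 0) → μ = 0 := by
    intro y hy μ hμ
    have hli : LinearIndependent ℂ (jacEval f y).row := by
      rw [linearIndependent_iff_card_eq_finrank_span, Fintype.card_fin]
      exact (hsm y hy).symm.trans (Matrix.rank_eq_finrank_span_row _)
    funext j
    refine Fintype.linearIndependent_iff.1 hli μ ?_ j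
    ext m
    simpa [jacEval, Matrix.row] using hμ m
  have hν0 : ∀ {a : Fin n → Fin (n - i) → ℂ} {y ℓ ν μ}, (ν = 0 → μ ≠ 0) →
      IsCritical f a y ℓ ν μ → ν ≠ 0 := by
    rintro a y ℓ ν μ hνμ h rfl
    exact hνμ rfl (hker y h.zero μ fun m => by simpa using h.hess m)
  have htriv : (∀ A : Matrix (Fin n) (Fin n) ℂ, IsUnit A → ∀ y ℓ ν μ, (ν = 0 → μ ≠ 0) →
        ¬ IsCritical f (fun m c => A m (colIdx n i c)) y ℓ ν μ) →
      ∃ Δ : MvPolynomial (Fin n × Fin (n - i)) ℂ, Δ ≠ 0 ∧ Δ.totalDegree ≤ n * d ^ (5 * n) ∧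
      ∀ A : Matrix (Fin n) (Fin n) ℂ, IsUnit A → ∀ y ℓ ν μ, ℓ ≠ 0 → (ν = 0 → μ ≠ 0) →
        IsCritical f (fun m c => A m (colIdx n i c)) y ℓ ν μ →
        eval (fun t => A t.1 (colIdx n i t.2)) Δ = 0 := fun hno =>
    ⟨1, one_ne_zero, by simp, fun A hA y ℓ ν μ _ hνμ h => absurd h (hno A hA y ℓ ν μ hνμ)⟩
  by_cases hzero : ∃ x : Fin n → ℂ, ∀ j, eval x (f j) = 0
  swap
  · exact htriv fun A _ y ℓ ν μ _ h => hzero ⟨y, h.zero⟩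
  obtain ⟨x, hx⟩ := hzero
  obtain hr | hr := Nat.eq_zero_or_pos (n - i)
  · refine htriv fun A _ y ℓ ν μ hνμ h => hν0 hνμ h ?_
    funext c
    exact absurd c.isLt (by omega)
  have hpn : p ≤ n := by
    rw [← hsm x hx]
    exact (Matrix.rank_le_card_width _).trans (by simp)
  obtain rfl | hpn := hpn.eq_or_lt
  · refine htriv fun A hA y ℓ ν μ hνμ h => hν0 hνμ h ?_
    have hJ : IsUnit (jacEval f y) := by
      rw [← Matrix.linearIndependent_rows_iff_isUnit,
        linearIndependent_iff_card_eq_finrank_span, Fintype.card_fin]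
      exact (hsm y h.zero).symm.trans (Matrix.rank_eq_finrank_span_row _)
    have hcol : Function.Injective (colIdx p i) := fun c c' hc => by
      simpa [colIdx, Fin.ext_iff] using hc
    have hinj : Function.Injective (A.submatrix id (colIdx p i)).mulVec := by
      rw [Matrix.mulVec_injective_iff]
      exact (Matrix.linearIndependent_cols_iff_isUnit.2 hA).comp _ hcol
    refine hinj ((Matrix.mulVec_injective_iff_isUnit.2 hJ) ?_)
    rw [Matrix.mulVec_zero, Matrix.mulVec_zero]
    ext j
    rw [Pi.zero_apply, ← h.ker j, Finset.sum_comm]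
    simp only [Matrix.mulVec, dotProduct, jacEval, Matrix.of_apply, Matrix.submatrix_apply, id,
      Finset.mul_sum]
    exact Finset.sum_congr rfl fun m _ => Finset.sum_congr rfl fun c _ => by ring
  obtain rfl | hd2 : d = 1 ∨ 2 ≤ d := by omega
  · have hconst : ∀ y j m, eval y (pderiv m (f j)) = jacEval f x j m := by
      intro y j m
      have h0 : (pderiv m (f j)).totalDegree = 0 := by
        have := totalDegree_pderiv_le (f j) m
        have := hdeg j
        omega
      rw [totalDegree_eq_zero_iff_eq_C] at h0
      rw [jacEval, Matrix.of_apply, h0, eval_C, eval_C]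
    obtain ⟨Δ, h0, hΔdeg, hΔ⟩ := exists_affine_eliminant (r := n - i) (Nat.sub_le n i) (hsm x hx)
    refine ⟨Δ, h0, by simpa using hΔdeg, fun A hA y ℓ ν μ hℓ hνμ h =>
      hΔ (Matrix.of fun m c => A m (colIdx n i c)) ℓ ν hℓ (hν0 hνμ h) ?_ ?_⟩
    · ext c
      have := h.lag c
      simp only [hconst] at this
      rw [Pi.zero_apply, ← this]
      simp only [Matrix.vecMul, dotProduct, Matrix.mul_apply, Matrix.of_apply, Finset.mul_sum]
      exact Finset.sum_congr rfl fun m _ => Finset.sum_congr rfl fun c _ => by ring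
    · ext j
      have := h.ker j
      simp only [hconst] at this
      rw [Pi.zero_apply, ← this]
      simp only [Matrix.mulVec, dotProduct, Matrix.mul_apply, Matrix.of_apply, Finset.sum_mul]
      exact Finset.sum_congr rfl fun m _ => Finset.sum_congr rfl fun c _ => by ring
  · obtain ⟨Δ, h0, hΔdeg, hΔ⟩ := exists_critSys_eliminant (n := n) (by omega) hr hd2 f hdeg
    refine ⟨Δ, h0, hΔdeg.trans (critical_degree_bound hpn (by omega) hr hd2), ?_⟩
    intro A hA y ℓ ν μ hℓ hνμ h
    obtain ⟨c, hc⟩ := Function.ne_iff.1 (hν0 hνμ h)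
    obtain ⟨b, hb⟩ : ∃ b, ∑ j, ℓ j * eval y (pderiv b (f j)) ≠ 0 := by
      by_contra! hcon
      exact hℓ (hker y h.zero ℓ hcon)
    refine hΔ (critPoint (fun m c => A m (colIdx n i c)) y ℓ ν μ) (fun k => h.eval_critSys k)
      ⟨c, b, ?_⟩
    simp only [map_mul, map_sum, eval_critLift, eval_critN, eval_critL]
    exact mul_ne_zero hc hb

theorem idealHeightEq_of_isRegularValueOn {n p i : ℕ} {G : Fin p → MvPolynomial (Fin n) ℂ}
    (hreg : IsRegularValueOn (hSys G i) {z | z ∘ Sum.inr ≠ 0}) (hi : p ≤ n - i + 1)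
    {P : Ideal (MvPolynomial (Fin n) ℂ)} (hP : P ∈ (polarIdeal G i).minimalPrimes) :
    IdealHeightEq P (n - i + 1) := by
  have hPp : P.IsPrime := hP.1.1
  refine ⟨hPp, ?_⟩
  rw [← PrimeSpectrum.height_eq_orderHeight]
  exact le_antisymm (height_le_of_mem_minimalPrimes_polarIdeal G i hi hP)
    (le_height_of_isRegularValueOn G i hreg P hP.1.2)

/-- genericity of properties `H_i(1)` and `H_i(2)`: there is a nonzero
polynomial `Δ_{i,1}` in the `n²` entries of a generic matrix, of degree at most
`n(d^{5n}+1)`, such that whenever `Δ_{i,1}(A) ≠ 0`: `A` is invertible, the polar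
variety `W(i, F^A)` is empty or `(i−1)`-equidimensional (every minimal prime over
`⟨𝔍(i,F^A)⟩` has height `n−i+1`), and `0` is a regular value of
`(F^A, [L₁ ⋯ L_p]·jac(F^A,i))` on the set where `(L₁,…,L_p) ≠ 0`. -/
theorem genericity_Hi1_Hi2
    (n p d : ℕ) (hn : 0 < n) (hp : 0 < p) (hd : 0 < d)
    (F : Fin p → MvPolynomial (Fin n) ℤ)
    (hdeg : ∀ j, (toC (F j)).totalDegree ≤ d)
    (hrad : (Ideal.span (Set.range fun j => toC (F j))).IsRadical)
    (hequi : ∀ P ∈ (Ideal.span (Set.range fun j => toC (F j))).minimalPrimes,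
      IdealHeightEq P p)
    (hsm : ∀ x : Fin n → ℂ, (∀ j, eval x (toC (F j)) = 0) →
      (jacEval (fun j => toC (F j)) x).rank = p)
    (i : ℕ) (hi1 : 1 ≤ i) (hi2 : i ≤ n - p + 1) :
    ∃ Δ : MvPolynomial (Fin n × Fin n) ℂ, Δ ≠ 0 ∧
      Δ.totalDegree ≤ n * (d ^ (5 * n) + 1) ∧
      ∀ A : Matrix (Fin n) (Fin n) ℂ,
        eval (fun km : Fin n × Fin n => A km.1 km.2) Δ ≠ 0 →
        IsUnit A ∧
        (∀ P ∈ (polarIdeal (fun j => changeVars A (toC (F j))) i).minimalPrimes,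
          IdealHeightEq P (n - i + 1)) ∧
        IsRegularValueOn (hSys (fun j => changeVars A (toC (F j))) i)
          {z | z ∘ Sum.inr ≠ 0} := by
  classical
  obtain ⟨Δ, h0, hΔdeg, hΔ⟩ := exists_eliminant_isCritical hd hi1 (fun j => toC (F j)) hdeg hsm
  let φ : Fin n × Fin (n - i) → Fin n × Fin n := Prod.map id (colIdx n i)
  have hφ : Function.Injective φ := Function.injective_id.prodMap fun c c' hc => by
    simpa [colIdx, Fin.ext_iff] using hc
  refine ⟨(Matrix.mvPolynomialX (Fin n) (Fin n) ℂ).det * rename φ Δ,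
    mul_ne_zero (Matrix.det_mvPolynomialX_ne_zero _ _) ?_, ?_, fun A hA => ?_⟩
  · exact fun h => h0 (rename_injective φ hφ (by simpa using h))
  · refine (totalDegree_mul _ _).trans ?_
    rw [mul_add, mul_one, add_comm]
    refine add_le_add ((totalDegree_rename_le _ _).trans hΔdeg) (totalDegree_det_le _ fun u v => ?_)
    rw [Matrix.mvPolynomialX_apply, totalDegree_X]
  · rw [map_mul, mul_ne_zero_iff, RingHom.map_det, eval_rename] at hA
    have hunit : IsUnit A := by
      rw [Matrix.isUnit_iff_isUnit_det, isUnit_iff_ne_zero]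
      convert hA.1
      ext u v
      simp
    have hreg : IsRegularValueOn (hSys (fun j => changeVars A (toC (F j))) i)
        {z | z ∘ Sum.inr ≠ 0} := by
      by_contra hreg
      obtain ⟨y, ℓ, ν, μ, hℓ, hνμ, hcrit⟩ :=
        exists_isCritical_of_not_isRegularValueOn (fun j => toC (F j)) hunit hreg
      exact hA.2 (hΔ A hunit y ℓ ν μ hℓ hνμ hcrit)
    refine ⟨hunit, fun P hP => idealHeightEq_of_isRegularValueOn hreg ?_ hP, hreg⟩
    have hPp : P.IsPrime := hP.1.1
    obtain ⟨x, hx, -⟩ := exists_zero_of_notMem_prime P (P.ne_top_iff_one.1 hPp.ne_top)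
    have hpn := hsm (A.mulVec x) fun j => by
      rw [← eval_changeVars]
      exact hx _ (hP.1.2 (Ideal.subset_span (Or.inl ⟨j, rfl⟩)))
    have hle := (jacEval (fun j => toC (F j)) (A.mulVec x)).rank_le_card_width
    rw [hpn, Fintype.card_fin] at hle
    omega

end
end

section
/- Let F = (f₁,…,f_p) ∈ ℂ[X₁,…,X_n]^p and fix i ∈ {1,…,n−p+1}. Suppose that 0 is a regular value of the n+p−i polynomials (f₁,…,f_p, the n−i entries of [L₁ ⋯ L_p]·jac(F,i)) on the open set {(x,ℓ) ∈ ℂⁿ × ℂ^p : ℓ ≠ 0}. Then for every u = (u₁,…,u_p) ∈ ℂ^p, the ideal generated by the n+p−i+1 polynomials 𝔏(i,F,u) in ℂ[X₁,…,X_n,L₁,…,L_p] is radical, and it is either the unit ideal or every minimal prime over it has height n+p−i+1 (i.e., its zero set in ℂ^{n+p} is (i−1)-equidimensional). -/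
open MvPolynomial

noncomputable section

/-- The ideal generated by the `n+p−i+1` polynomials
`𝔏(i,G,u) = (G, [L₁ ⋯ L_p]·jac(G,i), u₁L₁+⋯+u_pL_p−1)` in `ℂ[X₁,…,X_n,L₁,…,L_p]`. -/
def lagIdeal {n p : ℕ} (G : Fin p → MvPolynomial (Fin n) ℂ) (i : ℕ) (u : Fin p → ℂ) :
    Ideal (MvPolynomial (Fin n ⊕ Fin p) ℂ) :=
  Ideal.span ((Set.range fun j : Fin p => rename Sum.inl (G j)) ∪
    (Set.range fun c : Fin (n - i) => lagEntry G i c) ∪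
    {(∑ k : Fin p, C (u k) * X (Sum.inr k)) - 1})

open IsLocalRing Matrix

/-- In a finite generating set of the maximal ideal, some generator can be exchanged for a given
element outside the square of the maximal ideal. -/
theorem IsLocalRing.exists_span_insert_erase_eq_maximalIdeal {R : Type*} [CommRing R]
    [IsLocalRing R] [DecidableEq R] {t : Finset R} (ht : Ideal.span (t : Set R) = maximalIdeal R)
    {x : R}
    (hx : x ∈ maximalIdeal R) (hx2 : x ∉ maximalIdeal R ^ 2) :
    ∃ a ∈ t, Ideal.span (insert x ((t.erase a : Finset R) : Set R)) = maximalIdeal R := by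
  rw [← ht] at hx
  obtain ⟨c, hc⟩ := Submodule.mem_span_finset'.mp hx
  have hunit : ∃ a : t, IsUnit (c a) := by
    by_contra! hcon
    refine hx2 (hc ▸ Ideal.sum_mem _ fun a _ => ?_)
    rw [pow_two, smul_eq_mul]
    exact Ideal.mul_mem_mul ((mem_maximalIdeal _).mpr (hcon a))
      (ht ▸ Ideal.subset_span a.2)
  obtain ⟨a, ha⟩ := hunit
  refine ⟨a, a.2, le_antisymm ?_ ?_⟩
  · rw [← ht, Ideal.span_le]
    rintro y (rfl | hy)
    · exact hx
    · exact Ideal.subset_span (Finset.mem_of_mem_erase hy)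
  · rw [← ht, Ideal.span_le]
    intro y hy
    by_cases hya : y = a
    · subst hya
      rw [SetLike.mem_coe, ← Ideal.unit_mul_mem_iff_mem _ ha]
      rw [← Finset.add_sum_erase _ _ (Finset.mem_univ a), smul_eq_mul, ← eq_sub_iff_add_eq] at hc
      rw [hc]
      refine Ideal.sub_mem _ (Ideal.subset_span (Set.mem_insert _ _)) (Ideal.sum_mem _ ?_)
      intro b hb
      refine Ideal.mul_mem_left _ _ (Ideal.subset_span (Set.mem_insert_of_mem _ ?_))
      exact Finset.mem_coe.mpr (Finset.mem_erase.mpr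
        ⟨fun h => (Finset.mem_erase.mp hb).1 (Subtype.ext h), b.2⟩)
    · exact Ideal.subset_span (Set.mem_insert_of_mem _ (Finset.mem_erase.mpr ⟨hya, hy⟩))

theorem IsLocalRing.ringKrullDim_le_card_of_span_eq {R : Type*} [CommRing R] [IsLocalRing R]
    [IsNoetherianRing R] {t : Finset R} (ht : Ideal.span (t : Set R) = maximalIdeal R) :
    ringKrullDim R ≤ t.card := by
  rw [← maximalIdeal_height_eq_ringKrullDim]
  have := Ideal.height_le_card_of_mem_minimalPrimes_span_finset (p := maximalIdeal R) (s := t)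
    (by rw [ht, Ideal.minimalPrimes_eq_subsingleton_self]; rfl)
  exact_mod_cast this

theorem IsLocalRing.span_image_mk_eq_maximalIdeal {R : Type*} [CommRing R] [IsLocalRing R]
    {s t : Set R} [IsLocalRing (R ⧸ Ideal.span s)]
    (h : Ideal.span (s ∪ t) = maximalIdeal R) :
    Ideal.span (Ideal.Quotient.mk (Ideal.span s) '' t) = maximalIdeal (R ⧸ Ideal.span s) := by
  rw [← map_maximalIdeal_of_surjective (Ideal.Quotient.mk (Ideal.span s))
    Ideal.Quotient.mk_surjective, ← h, Ideal.span_union, Ideal.map_sup, Ideal.map_quotient_self,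
    bot_sup_eq, Ideal.map_span]

/-- A Noetherian local ring whose maximal ideal is generated by at most `dim R` elements is a
domain. -/
theorem IsLocalRing.isDomain_of_span_eq_maximalIdeal {R : Type*} [CommRing R] [IsLocalRing R]
    [IsNoetherianRing R] (t : Finset R) (ht : Ideal.span (t : Set R) = maximalIdeal R)
    (hdim : (t.card : WithBot ℕ∞) ≤ ringKrullDim R) : IsDomain R := by
  classical
  induction hn : t.card generalizing R with
  | zero =>
    rw [Finset.card_eq_zero] at hn
    subst hn
    have : IsField R := by
      rw [isField_iff_maximalIdeal_eq, ← ht]; simp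
    exact this.isDomain
  | succ n ih =>
    have hpos : maximalIdeal R ∉ minimalPrimes R := by
      rw [← Ideal.height_eq_zero_iff]
      intro h0
      rw [← maximalIdeal_height_eq_ringKrullDim, h0, hn] at hdim
      norm_cast at hdim
    have hex : ∃ x ∈ maximalIdeal R, x ∉ maximalIdeal R ^ 2 ∧ ∀ q ∈ minimalPrimes R, x ∉ q := by
      by_contra! hcon
      have hfin := minimalPrimes.finite_of_isNoetherianRing R
      have key := (Ideal.subset_union_prime (s := insert (maximalIdeal R ^ 2) hfin.toFinset)
        (f := id) (maximalIdeal R ^ 2) (maximalIdeal R ^ 2) (I := maximalIdeal R) ?_).mp ?_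
      · obtain ⟨q, hq, hle⟩ := key
        rcases Finset.mem_insert.mp hq with rfl | hq
        · have h0 : maximalIdeal R ≤ ⊥ := by
            refine Submodule.le_of_le_smul_of_le_jacobson_bot (I := maximalIdeal R)
              (IsNoetherian.noetherian _) (maximalIdeal_le_jacobson _) ?_
            rw [bot_sup_eq, smul_eq_mul, ← pow_two]; exact hle
          apply hpos
          rw [le_bot_iff.mp h0]
          have : (⊥ : Ideal R).IsPrime := le_bot_iff.mp h0 ▸ inferInstance
          exact ⟨⟨this, le_rfl⟩, fun _ _ _ => bot_le⟩
        · rw [Set.Finite.mem_toFinset] at hq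
          have : q.IsPrime := hq.isPrime
          exact hpos (le_antisymm hle (le_maximalIdeal this.ne_top) ▸ hq)
      · intro q hq hne _
        rw [Finset.mem_insert, Set.Finite.mem_toFinset] at hq
        exact (hq.resolve_left hne).isPrime
      · intro x hx
        simp only [Finset.coe_insert, Set.mem_iUnion, id]
        by_cases h2 : x ∈ maximalIdeal R ^ 2
        · exact ⟨_, Set.mem_insert _ _, h2⟩
        · obtain ⟨q, hq, hxq⟩ := hcon x hx h2
          exact ⟨q, Set.mem_insert_of_mem _ (by simpa using hq), hxq⟩
    obtain ⟨x, hx, hx2, hxq⟩ := hex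
    obtain ⟨a, hat, hspan⟩ := IsLocalRing.exists_span_insert_erase_eq_maximalIdeal ht hx hx2
    have hne : Ideal.span {x} ≠ ⊤ := fun h =>
      (maximalIdeal.isMaximal R).ne_top (top_le_iff.mp
        (h ▸ (Ideal.span_singleton_le_iff_mem _).mpr hx))
    have : Nontrivial (R ⧸ Ideal.span {x}) := Ideal.Quotient.nontrivial_iff.mpr hne
    have : IsLocalRing (R ⧸ Ideal.span {x}) :=
      .of_surjective' (Ideal.Quotient.mk _) Ideal.Quotient.mk_surjective
    have hgen := IsLocalRing.span_image_mk_eq_maximalIdeal (s := {x}) hspan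
    rw [← Finset.coe_image] at hgen
    have hcard : ((t.erase a).image (Ideal.Quotient.mk (Ideal.span {x}))).card ≤ n :=
      Finset.card_image_le.trans (by rw [Finset.card_erase_of_mem hat, hn]; simp)
    have hdim' : (n : WithBot ℕ∞) ≤ ringKrullDim (R ⧸ Ideal.span {x}) := by
      have := ringKrullDim_le_ringKrullDim_quotient_add_card {x}
        (by simpa [ringJacobson_eq_maximalIdeal] using hx)
      rw [Finset.coe_singleton] at this
      have := hdim.trans this
      rw [hn] at this
      exact ENat.WithBot.add_le_add_one_right_iff.mp (by simpa using this)
    have hcard' := hdim'.trans (ringKrullDim_le_card_of_span_eq hgen)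
    have hcard_eq := le_antisymm hcard (by exact_mod_cast hcard')
    have hdom := ih _ hgen (by rwa [hcard_eq]) hcard_eq
    have hprime : (Ideal.span {x}).IsPrime := (Ideal.Quotient.isDomain_iff_prime _).mp hdom
    obtain ⟨q, hq, hqx⟩ := Ideal.exists_minimalPrimes_le (bot_le : ⊥ ≤ Ideal.span {x})
    have hqp : q.IsPrime := hq.isPrime
    have hq0 : q ≤ ⊥ := by
      refine Submodule.le_of_le_smul_of_le_jacobson_bot (I := maximalIdeal R)
        (IsNoetherian.noetherian _) (maximalIdeal_le_jacobson _) ?_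
      rw [bot_sup_eq, smul_eq_mul]
      intro y hy
      obtain ⟨b, rfl⟩ := Ideal.mem_span_singleton'.mp (hqx hy)
      rw [mul_comm b x] at hy ⊢
      exact Ideal.mul_mem_mul hx ((hqp.mem_or_mem hy).resolve_left (hxq q hq))
    rw [le_bot_iff.mp hq0] at hqp
    exact IsDomain.of_bot_isPrime R

/-- Part of a regular system of parameters generates a prime ideal. -/
theorem IsLocalRing.isPrime_span_of_span_union_eq {R : Type*} [CommRing R] [IsLocalRing R]
    [IsNoetherianRing R] (s t : Finset R)
    (h : Ideal.span ((s : Set R) ∪ t) = maximalIdeal R)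
    (hdim : ((s.card + t.card : ℕ) : WithBot ℕ∞) ≤ ringKrullDim R) :
    (Ideal.span (s : Set R)).IsPrime := by
  classical
  have hs : (s : Set R) ⊆ maximalIdeal R := fun y hy =>
    h ▸ Ideal.subset_span (Set.mem_union_left _ hy)
  have hne : Ideal.span (s : Set R) ≠ ⊤ := fun h' =>
    (maximalIdeal.isMaximal R).ne_top (top_le_iff.mp (h' ▸ Ideal.span_le.mpr hs))
  have : Nontrivial (R ⧸ Ideal.span (s : Set R)) := Ideal.Quotient.nontrivial_iff.mpr hne
  have : IsLocalRing (R ⧸ Ideal.span (s : Set R)) :=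
    .of_surjective' (Ideal.Quotient.mk _) Ideal.Quotient.mk_surjective
  have hgen := IsLocalRing.span_image_mk_eq_maximalIdeal h
  rw [← Finset.coe_image] at hgen
  rw [← Ideal.Quotient.isDomain_iff_prime]
  refine isDomain_of_span_eq_maximalIdeal _ hgen ?_
  have h1 := hdim.trans (ringKrullDim_le_ringKrullDim_quotient_add_card s
    (by simpa [ringJacobson_eq_maximalIdeal] using hs))
  have h2 : ((t.image (Ideal.Quotient.mk (Ideal.span (s : Set R)))).card : WithBot ℕ∞) ≤ t.card :=
    by exact_mod_cast Finset.card_image_le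
  refine h2.trans ?_
  rw [Nat.cast_add, add_comm] at h1
  exact ENat.WithBot.add_le_add_natCast_right_iff.mp h1

/-- The ideal generated by part of a regular system of parameters has height at least the number
of the generators. -/
theorem IsLocalRing.card_le_height_span_of_span_union_eq {R : Type*} [CommRing R] [IsLocalRing R]
    [IsNoetherianRing R] (s t : Finset R)
    (h : Ideal.span ((s : Set R) ∪ t) = maximalIdeal R)
    (hdim : ((s.card + t.card : ℕ) : WithBot ℕ∞) ≤ ringKrullDim R) :
    (s.card : ℕ∞) ≤ (Ideal.span (s : Set R)).height := by
  classical
  induction s using Finset.induction_on generalizing t with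
  | empty => simp
  | insert a s has ih =>
    have hset : ((s : Set R) ∪ ((insert a t : Finset R) : Set R)) =
        ((insert a s : Finset R) : Set R) ∪ t := by
      rw [Finset.coe_insert, Finset.coe_insert, Set.union_insert, Set.insert_union]
    have hcard : s.card + (insert a t).card ≤ (insert a s).card + t.card := by
      rw [Finset.card_insert_of_notMem has]
      have := Finset.card_insert_le a t
      omega
    have h' := hset ▸ h
    have hdim' := (Nat.cast_le (α := WithBot ℕ∞)).mpr hcard |>.trans hdim
    have := isPrime_span_of_span_union_eq _ _ h hdim
    have := isPrime_span_of_span_union_eq _ _ h' hdim'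
    have hlt : Ideal.span (s : Set R) < Ideal.span ((insert a s : Finset R) : Set R) := by
      refine lt_of_le_of_ne (Ideal.span_mono (by simp)) fun heq => ?_
      rw [Ideal.span_union, ← heq, ← Ideal.span_union, ← Finset.coe_union] at h
      have h1 := hdim.trans (ringKrullDim_le_card_of_span_eq h)
      have h2 := Finset.card_union_le s t
      rw [Finset.card_insert_of_notMem has] at h1
      norm_cast at h1
      omega
    rw [Finset.card_insert_of_notMem has, Nat.cast_add, Nat.cast_one]
    exact (add_le_add_left (ih _ h' hdim') 1).trans (Ideal.height_add_one_le_of_lt_of_isPrime hlt)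

/-- Every maximal ideal of a polynomial ring in finitely many variables over a field has height
the number of variables. -/
theorem MvPolynomial.height_eq_card_of_isMaximal {K σ : Type*} [Field K] [Finite σ]
    (M : Ideal (MvPolynomial σ K)) [M.IsMaximal] : M.height = Nat.card σ := by
  induction σ using Finite.induction_empty_option with
  | of_equiv e H =>
    rw [← (renameEquiv K e).symm.toRingEquiv.height_map M, ← Nat.card_congr e]
    have : (M.map (renameEquiv K e).symm.toRingEquiv).IsMaximal := Ideal.map_isMaximal_of_equiv _
    exact H _
  | h_empty =>
    have : IsField (MvPolynomial PEmpty K) :=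
      (isEmptyRingEquiv K PEmpty).toMulEquiv.isField (Field.toIsField K)
    let := this.toField
    rw [Ideal.eq_bot_of_prime M, Ideal.height_bot]
    simp
  | @h_option α _ IH =>
    let e := (optionEquivLeft K α).toRingEquiv
    have hM : (M.map e).IsMaximal := Ideal.map_isMaximal_of_equiv e
    have : ((M.map e).under (MvPolynomial α K)).IsMaximal :=
      Polynomial.isMaximal_comap_C_of_isJacobsonRing (M.map e)
    have : (M.map e).LiesOver ((M.map e).under (MvPolynomial α K)) := ⟨rfl⟩
    rw [← e.height_map M, Polynomial.height_eq_height_add_one ((M.map e).under _) (M.map e), IH]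
    simp

/-- First order Taylor expansion of a polynomial at a point. -/
theorem MvPolynomial.sub_linear_mem_vanishingIdeal_sq {K σ : Type*} [Field K] [Fintype σ]
    (y : σ → K) (f : MvPolynomial σ K) :
    f - C (eval y f) - ∑ k, C (eval y (pderiv k f)) * (X k - C (y k)) ∈
      vanishingIdeal K {y} ^ 2 := by
  classical
  have hX (k : σ) : X k - C (y k) ∈ vanishingIdeal K {y} := by
    simp
  induction f using MvPolynomial.induction_on with
  | C a => simp
  | add f g hf hg =>
    convert Ideal.add_mem _ hf hg using 1
    simp only [map_add, add_mul, Finset.sum_add_distrib]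
    ring
  | mul_X f j hf =>
    have h1 : (X j - C (y j)) * (f - C (eval y f)) ∈ vanishingIdeal K {y} ^ 2 := by
      rw [pow_two]
      exact Ideal.mul_mem_mul (hX j) (by simp)
    convert Ideal.add_mem _ h1 (Ideal.mul_mem_left _ (C (y j)) hf) using 1
    have h2 : ∑ k, C (eval y (pderiv k (f * X j))) * (X k - C (y k)) =
        C (y j) * (∑ k, C (eval y (pderiv k f)) * (X k - C (y k))) +
          C (eval y f) * (X j - C (y j)) := by
      simp only [Derivation.leibniz, pderiv_X, smul_eq_mul, map_add, map_mul, eval_X, add_mul,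
        Finset.sum_add_distrib, Finset.mul_sum]
      rw [add_comm]
      congr 1
      · exact Finset.sum_congr rfl fun k _ => by ring
      · rw [Finset.sum_eq_single j]
        · simp
        · intro k _ hk; simp [hk]
        · simp
    rw [h2]
    simp only [map_mul, eval_X]
    ring

theorem Matrix.exists_span_union_range_row_eq_top {K ι σ : Type*} [Field K] [Fintype ι]
    [Fintype σ] (A : Matrix ι σ K) (hA : A.rank = Fintype.card ι) :
    ∃ b : Finset (σ → K), Fintype.card ι + b.card = Fintype.card σ ∧
      Submodule.span K (Set.range A.row ∪ b) = ⊤ := by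
  classical
  have hli : LinearIndependent K A.row := by
    rw [linearIndependent_iff_card_eq_finrank_span, Set.finrank, ← Matrix.rank_eq_finrank_span_row,
      hA]
  have hli' := hli.linearIndepOn_id
  obtain ⟨b, -, hsub, hspan, hb⟩ := exists_linearIndepOn_extension hli' (Set.subset_univ _)
  have hfin : b.Finite := hb.setFinite
  have htop : Submodule.span K b = ⊤ := top_le_iff.mp fun x _ => by
    simpa using hspan ⟨x, Set.mem_univ x, rfl⟩
  have hcard : hfin.toFinset.card = Fintype.card σ := by
    have := Module.finrank_eq_nat_card_basis
      (Module.Basis.mk (v := ((↑) : b → σ → K)) hb (by simp [htop]))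
    rw [Module.finrank_pi] at this
    rw [this, Nat.card_coe_set_eq, Set.ncard_eq_toFinset_card _ hfin]
  refine ⟨hfin.toFinset \ Finset.univ.image A.row, ?_, ?_⟩
  · have hs : Finset.univ.image A.row ⊆ hfin.toFinset := by
      intro x hx
      rw [Set.Finite.mem_toFinset]
      exact hsub (by simpa using hx)
    have hi : (Finset.univ.image A.row).card = Fintype.card ι := by
      rw [Finset.card_image_of_injective _ hli.injective, Finset.card_univ]
    rw [← hi, add_comm, Finset.card_sdiff_add_card_eq_card hs, hcard]
  · rw [← htop]
    congr 1
    ext x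
    have := @hsub x
    simp at this ⊢
    grind

theorem MvPolynomial.eval_pderiv_sum_C_mul_X_sub_C {K σ : Type*} [Field K] [Fintype σ]
    (y v : σ → K) (k : σ) :
    eval y (pderiv k (∑ l, C (v l) * (X l - C (y l)))) = v k := by
  classical
  simp [Derivation.leibniz, pderiv_X, Pi.single_apply]

/-- Polynomials whose gradients at `y` span the whole space generate, together with
`𝔪 ^ 2`, the maximal ideal `𝔪` of the point `y`. -/
theorem MvPolynomial.vanishingIdeal_le_span_sup_sq {K σ : Type*} [Field K] [Fintype σ]
    (y : σ → K) (S : Set (MvPolynomial σ K)) (hS : ∀ f ∈ S, eval y f = 0)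
    (hspan : Submodule.span K ((fun f k => eval y (pderiv k f)) '' S) = ⊤) :
    vanishingIdeal K {y} ≤ Ideal.span S ⊔ vanishingIdeal K {y} ^ 2 := by
  intro f hf
  have key : ∀ v : σ → K, ∑ l, C (v l) * (X l - C (y l)) ∈
      Ideal.span S ⊔ vanishingIdeal K {y} ^ 2 := by
    intro v
    have hv : v ∈ Submodule.span K ((fun f k => eval y (pderiv k f)) '' S) := hspan ▸ trivial
    induction hv using Submodule.span_induction with
    | mem v hv =>
      obtain ⟨g, hg, rfl⟩ := hv
      have h := sub_linear_mem_vanishingIdeal_sq y g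
      rw [hS g hg, C_0, sub_zero] at h
      have h' := Ideal.sub_mem _ (Ideal.mem_sup_left (T := vanishingIdeal K {y} ^ 2)
        (Ideal.subset_span hg)) (Ideal.mem_sup_right h)
      rwa [sub_sub_cancel] at h'
    | zero => simp
    | add v w _ _ hv hw =>
      convert Ideal.add_mem _ hv hw using 1
      simp [add_mul, Finset.sum_add_distrib]
    | smul a v _ hv =>
      convert Ideal.mul_mem_left _ (C a) hv using 1
      simp [Finset.mul_sum, mul_assoc]
  have hf0 : eval y f = 0 := by simpa [mem_vanishingIdeal_singleton_iff] using hf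
  have h := sub_linear_mem_vanishingIdeal_sq y f
  rw [hf0, C_0, sub_zero] at h
  convert Ideal.add_mem _ (Ideal.mem_sup_right (S := Ideal.span S) h)
    (key fun k => eval y (pderiv k f)) using 1
  rw [sub_add_cancel]

/-- Local form of the Jacobian criterion: at a common zero where the Jacobian matrix has full row
rank, the polynomials generate in the local ring a prime ideal of height their number. -/
theorem MvPolynomial.isPrime_map_span_and_height_eq {K ι σ : Type*} [Field K] [Fintype ι]
    [Fintype σ] (G : ι → MvPolynomial σ K) (y : σ → K) (hy : ∀ j, eval y (G j) = 0)
    (hrank : (Matrix.of fun j k => eval y (pderiv k (G j))).rank = Fintype.card ι) :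
    let I := (Ideal.span (Set.range G)).map
      (algebraMap _ (Localization.AtPrime (vanishingIdeal K {y} : Ideal (MvPolynomial σ K))))
    I.IsPrime ∧ (Fintype.card ι : ℕ∞) ≤ I.height := by
  classical
  intro I
  set M : Ideal (MvPolynomial σ K) := vanishingIdeal K {y} with hM
  let L := Localization.AtPrime M
  let φ := algebraMap (MvPolynomial σ K) L
  obtain ⟨b, hcard, hb⟩ := Matrix.exists_span_union_range_row_eq_top _ hrank
  let lin : (σ → K) → MvPolynomial σ K := fun v => ∑ l, C (v l) * (X l - C (y l))
  let s : Finset L := Finset.univ.image (fun j => φ (G j))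
  let t : Finset L := b.image (fun v => φ (lin v))
  have hle : M ≤ Ideal.span (Set.range G ∪ lin '' b) ⊔ M ^ 2 := by
    apply vanishingIdeal_le_span_sup_sq
    · rintro f (⟨j, rfl⟩ | ⟨v, -, rfl⟩)
      · exact hy j
      · simp [lin]
    · rw [← hb, Set.image_union, ← Set.range_comp, Set.image_image]
      congr 2
      simp only [lin, eval_pderiv_sum_C_mul_X_sub_C, Set.image_id']
  have hs : Ideal.span (s : Set L) = I := by
    simp only [s, I, Ideal.map_span, ← Set.range_comp, Finset.coe_image, Finset.coe_univ,
      Set.image_univ]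
    rfl
  have hst : Ideal.span ((s : Set L) ∪ t) = (Ideal.span (Set.range G ∪ lin '' b)).map φ := by
    rw [Ideal.map_span, Set.image_union, ← Set.range_comp, Set.image_image]
    simp [s, t, Function.comp_def]
  have hmax : M.map φ = maximalIdeal L := Localization.AtPrime.map_eq_maximalIdeal
  have h : Ideal.span ((s : Set L) ∪ t) = maximalIdeal L := by
    apply le_antisymm
    · rw [hst, ← hmax]
      refine Ideal.map_mono (Ideal.span_le.mpr ?_)
      rintro f (⟨j, rfl⟩ | ⟨v, -, rfl⟩)
      · simpa [hM, mem_vanishingIdeal_singleton_iff] using hy j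
      · simp [hM, lin]
    · refine Submodule.le_of_le_smul_of_le_jacobson_bot (I := maximalIdeal L)
        (IsNoetherian.noetherian _) (maximalIdeal_le_jacobson _) ?_
      rw [smul_eq_mul, ← pow_two, hst, ← hmax, ← Ideal.map_pow, ← Ideal.map_sup]
      exact Ideal.map_mono hle
  have hdim : ringKrullDim L = Fintype.card σ := by
    rw [IsLocalization.AtPrime.ringKrullDim_eq_height M L, height_eq_card_of_isMaximal M,
      Nat.card_eq_fintype_card]
    rfl
  have hsc : s.card ≤ Fintype.card ι := Finset.card_image_le
  have htc : t.card ≤ b.card := Finset.card_image_le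
  have hst_le : ((s.card + t.card : ℕ) : WithBot ℕ∞) ≤ ringKrullDim L := by
    rw [hdim, Nat.cast_le]; omega
  have hge : Fintype.card σ ≤ s.card + t.card := by
    rw [← Finset.coe_union] at h
    have := hdim ▸ ringKrullDim_le_card_of_span_eq h
    exact (Nat.cast_le.mp this).trans (Finset.card_union_le _ _)
  have hsc' : s.card = Fintype.card ι := by omega
  rw [← hs, ← hsc']
  exact ⟨isPrime_span_of_span_union_eq s t h hst_le,
    card_le_height_span_of_span_union_eq s t h hst_le⟩

/-- The Jacobian criterion: if the Jacobian matrix has full row rank at all common zeros,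
the polynomials generate a radical ideal, all of whose minimal primes have height the number of
polynomials. -/
theorem MvPolynomial.isRadical_span_and_height_eq {K ι σ : Type*} [Field K] [IsAlgClosed K]
    [Fintype ι] [Fintype σ] (G : ι → MvPolynomial σ K)
    (hG : ∀ y : σ → K, (∀ j, eval y (G j) = 0) →
      (Matrix.of fun j k => eval y (pderiv k (G j))).rank = Fintype.card ι) :
    (Ideal.span (Set.range G)).IsRadical ∧
      ∀ P ∈ (Ideal.span (Set.range G)).minimalPrimes, P.height = Fintype.card ι := by
  classical
  have hlocal : ∀ (M : Ideal (MvPolynomial σ K)) [M.IsMaximal],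
      Ideal.span (Set.range G) ≤ M →
      ((Ideal.span (Set.range G)).map (algebraMap _ (Localization.AtPrime M))).IsPrime ∧
        (Fintype.card ι : ℕ∞) ≤
          ((Ideal.span (Set.range G)).map (algebraMap _ (Localization.AtPrime M))).height := by
    intro M hM hle
    obtain ⟨y, rfl⟩ := isMaximal_iff_eq_vanishingIdeal_singleton.mp hM
    have hy : ∀ j, eval y (G j) = 0 := fun j => by
      simpa [mem_vanishingIdeal_singleton_iff] using hle (Ideal.subset_span ⟨j, rfl⟩)
    exact isPrime_map_span_and_height_eq G y hy (hG y hy)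
  refine ⟨fun f ⟨n, hn⟩ => Ideal.mem_of_localization_maximal fun M hM => ?_, fun P hP => ?_⟩
  · by_cases hle : Ideal.span (Set.range G) ≤ M
    · refine (hlocal M hle).1.mem_of_pow_mem n ?_
      rw [← map_pow]
      exact Ideal.mem_map_of_mem _ hn
    · rw [IsLocalization.AtPrime.map_eq_top_of_not_le _ hle]
      trivial
  · have hPp : P.IsPrime := hP.isPrime
    apply le_antisymm
    · have hP' : P ∈ (Ideal.span ((Finset.univ.image G : Finset _) : Set _)).minimalPrimes := by
        simpa using hP
      refine (Ideal.height_le_card_of_mem_minimalPrimes_span_finset hP').trans ?_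
      exact_mod_cast Finset.card_image_le
    · obtain ⟨M, hM, hPM⟩ := P.exists_le_maximal hPp.ne_top
      obtain ⟨hprime, hht⟩ := hlocal M (hP.le.trans hPM)
      refine hht.trans ?_
      have hdisj : Disjoint (M.primeCompl : Set (MvPolynomial σ K)) P :=
        Set.disjoint_left.mpr fun _ a b => a (hPM b)
      rw [← IsLocalization.height_map_of_disjoint (S := Localization.AtPrime M) M.primeCompl P
        hdisj]
      exact Ideal.height_mono (Ideal.map_mono hP.le)

theorem Matrix.rank_fromRows_replicateRow {K ι σ : Type*} [Field K] [Fintype ι] [Fintype σ]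
    (A : Matrix ι σ K) (hA : A.rank = Fintype.card ι) (r w : σ → K) (hw : A *ᵥ w = 0)
    (hr : r ⬝ᵥ w ≠ 0) :
    (Matrix.fromRows A (Matrix.replicateRow Unit r)).rank = Fintype.card (ι ⊕ Unit) := by
  have hli : LinearIndependent K A.row := by
    rw [linearIndependent_iff_card_eq_finrank_span, Set.finrank, ← Matrix.rank_eq_finrank_span_row,
      hA]
  suffices h : LinearIndependent K (Matrix.fromRows A (Matrix.replicateRow Unit r)).row by
    rw [linearIndependent_iff_card_eq_finrank_span, Set.finrank,
      ← Matrix.rank_eq_finrank_span_row] at h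
    exact h.symm
  rw [← Matrix.vecMul_injective_iff] at hli
  refine Matrix.vecMul_injective_iff.mp
    ((injective_iff_map_eq_zero (Matrix.vecMulLinear
      (Matrix.fromRows A (Matrix.replicateRow Unit r)))).mpr fun c hc => ?_)
  rw [Matrix.vecMulLinear_apply, Matrix.vecMul_fromRows] at hc
  have h1 : c (Sum.inr ()) = 0 := by
    have := congr_arg (· ⬝ᵥ w) hc
    simp only [add_dotProduct, ← Matrix.dotProduct_mulVec, hw, dotProduct_zero, zero_add,
      zero_dotProduct] at this
    refine (mul_eq_zero.mp ?_).resolve_right hr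
    simpa [Matrix.mulVec, dotProduct] using this
  have h2 : c ∘ Sum.inl = 0 := by
    apply hli
    have h3 : c ∘ Sum.inr = 0 := by ext ⟨⟩; exact h1
    simpa [h3] using hc
  ext (j | ⟨⟩)
  · exact congr_fun h2 j
  · exact h1

theorem pderiv_inr_rename_inl_s7 {R σ τ : Type*} [CommSemiring R] (g : MvPolynomial σ R) (l : τ) :
    pderiv (Sum.inr l) (rename Sum.inl g : MvPolynomial (σ ⊕ τ) R) = 0 := by
  classical
  apply pderiv_eq_zero_of_notMem_vars
  intro h
  simpa using vars_rename Sum.inl g h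

/-- Euler's relation: the derivatives of `hSys` along the multiplier direction `(0, ℓ)` vanish at
the common zeros of `hSys`. -/
theorem jacEval_hSys_mulVec_eq_zero {n p : ℕ} (F : Fin p → MvPolynomial (Fin n) ℂ) (i : ℕ)
    (y : Fin n ⊕ Fin p → ℂ) (hy : ∀ j, eval y (hSys F i j) = 0) :
    (jacEval (hSys F i) y).mulVec (Sum.elim 0 (y ∘ Sum.inr)) = 0 := by
  ext (j | c)
  · simp [jacEval, Matrix.mulVec, dotProduct, hSys, pderiv_inr_rename_inl_s7]
  · have h := hy (Sum.inr c)
    simp only [hSys, Sum.elim_inr, lagEntry, map_sum, map_mul, eval_X] at h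
    simp [jacEval, Matrix.mulVec, dotProduct, hSys, lagEntry, pderiv_inr_rename_inl_s7, pderiv_X,
      Pi.single_apply]
    rw [← h]
    refine Finset.sum_congr rfl fun k _ => ?_
    rw [← map_sum, Finset.sum_ite_eq' Finset.univ k, if_pos (Finset.mem_univ k), mul_comm]

theorem eval_pderiv_sum_C_mul_X_sub_one {n p : ℕ} (u : Fin p → ℂ) (y : Fin n ⊕ Fin p → ℂ)
    (k : Fin n ⊕ Fin p) :
    eval y (pderiv k ((∑ l : Fin p, C (u l) * X (Sum.inr l)) - 1)) =
      (Sum.elim 0 u : Fin n ⊕ Fin p → ℂ) k := by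
  rcases k with k | k <;> simp [pderiv_X, Pi.single_apply]

/-- if `0` is a regular value of `(F, [L₁ ⋯ L_p]·jac(F,i))` on the set
where `(L₁,…,L_p) ≠ 0`, then for every `u ∈ ℂ^p` the ideal generated by `𝔏(i,F,u)` is
radical, and it is either the unit ideal or all its minimal primes have height
`n+p−i+1` (its zero set is `(i−1)`-equidimensional). -/
theorem lagrange_ideal_radical_equidimensional
    (n p : ℕ) (hn : 0 < n) (hp : 0 < p)
    (F : Fin p → MvPolynomial (Fin n) ℂ)
    (i : ℕ) (hi1 : 1 ≤ i) (hi2 : i ≤ n - p + 1)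
    (hreg : IsRegularValueOn (hSys F i) {z | z ∘ Sum.inr ≠ 0}) :
    ∀ u : Fin p → ℂ,
      (lagIdeal F i u).IsRadical ∧
      (lagIdeal F i u = ⊤ ∨
        ∀ P ∈ (lagIdeal F i u).minimalPrimes, IdealHeightEq P (n + p - i + 1)) := by
  intro u
  let G : (Fin p ⊕ Fin (n - i)) ⊕ Unit → MvPolynomial (Fin n ⊕ Fin p) ℂ :=
    Sum.elim (hSys F i) fun _ => (∑ k : Fin p, C (u k) * X (Sum.inr k)) - 1
  have hspan : lagIdeal F i u = Ideal.span (Set.range G) := by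
    simp [lagIdeal, G, hSys, Set.Sum.elim_range]
  have hrank : ∀ y : Fin n ⊕ Fin p → ℂ, (∀ j, eval y (G j) = 0) →
      (Matrix.of fun j k => eval y (pderiv k (G j))).rank =
        Fintype.card ((Fin p ⊕ Fin (n - i)) ⊕ Unit) := by
    intro y hy
    have hyS : ∀ j, eval y (hSys F i j) = 0 := fun j => hy (Sum.inl j)
    have hyu : ∑ k : Fin p, u k * y (Sum.inr k) = 1 := by
      have := hy (Sum.inr ())
      simpa [G, sub_eq_zero] using this
    have hy0 : y ∘ Sum.inr ≠ 0 := by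
      intro h
      have h' : ∀ k, y (Sum.inr k) = 0 := fun k => congr_fun h k
      simp [h'] at hyu
    have hmat : (Matrix.of fun j k => eval y (pderiv k (G j))) =
        Matrix.fromRows (jacEval (hSys F i) y) (Matrix.replicateRow Unit (Sum.elim 0 u)) := by
      ext (j | ⟨⟩) k
      · rfl
      · exact eval_pderiv_sum_C_mul_X_sub_one u y k
    rw [hmat]
    refine Matrix.rank_fromRows_replicateRow _ (hreg y hy0 hyS) _ _
      (jacEval_hSys_mulVec_eq_zero F i y hyS) ?_
    simp [dotProduct, hyu]
  obtain ⟨hrad, hht⟩ := MvPolynomial.isRadical_span_and_height_eq G hrank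
  rw [hspan]
  refine ⟨hrad, Or.inr fun P hP => ⟨hP.isPrime, ?_⟩⟩
  rw [← PrimeSpectrum.height_eq_orderHeight, hht P hP]
  simp only [Fintype.card_sum, Fintype.card_fin, Fintype.card_unit]
  congr 1
  omega

end
end

section
/- Let F = (f₁,…,f_p) ∈ ℤ[X₁,…,X_n]^p such that the ideal ⟨f₁,…,f_p⟩ ⊆ ℂ[X₁,…,X_n] is radical, every minimal prime over ⟨f₁,…,f_p⟩ has height p, and jac(F)(x) has rank p at every x ∈ V(F). Let 𝔄 = (𝔄_{k,m})_{1≤k,m≤n} be an n×n matrix of independent indeterminates, let K = ℂ(𝔄_{k,m} : 1≤k,m≤n) be the field of rational functions in these n² indeterminates, and let F^𝔄 = (f₁(𝔄X),…,f_p(𝔄X)) ∈ K[X₁,…,X_n]^p. Then for every i ∈ {1,…,n−p+1} and every u = (u₁,…,u_p) ∈ ℂ^p, the ideal generated by the n+p−i+1 polynomials 𝔏(i,F^𝔄,u) in K[X₁,…,X_n,L₁,…,L_p] is radical. -/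
open MvPolynomial

noncomputable section

/-- `K = ℂ(𝔄_{k,m})`, the field of rational functions in the `n²` entries of a
generic `n × n` matrix `𝔄`. -/
abbrev GenField (n : ℕ) : Type :=
  FractionRing (MvPolynomial (Fin n × Fin n) ℂ)

/-- The generic-matrix entry `𝔄_{k,m}` as an element of `K`. -/
def genEntry (n : ℕ) (k m : Fin n) : GenField n :=
  algebraMap (MvPolynomial (Fin n × Fin n) ℂ) (GenField n) (X (k, m))

/-- A complex number, as an element of `K = ℂ(𝔄_{k,m})`. -/
def constK (n : ℕ) (c : ℂ) : GenField n :=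
  algebraMap (MvPolynomial (Fin n × Fin n) ℂ) (GenField n) (C c)

/-- `f^𝔄 = f(𝔄·X) ∈ K[X₁,…,X_n]` for an integer polynomial `f`. -/
def genChange {n : ℕ} (f : MvPolynomial (Fin n) ℤ) : MvPolynomial (Fin n) (GenField n) :=
  aeval (fun k : Fin n => ∑ m : Fin n, C (genEntry n k m) * X m)
    (map (Int.castRingHom (GenField n)) f)

/-- The `c`-th entry of the row vector `[L₁ ⋯ L_p]·jac(G, i)`, over any coefficient
field. -/
def lagEntryK {R : Type*} [CommRing R] {n p : ℕ}
    (G : Fin p → MvPolynomial (Fin n) R) (i : ℕ) (c : Fin (n - i)) :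
    MvPolynomial (Fin n ⊕ Fin p) R :=
  ∑ k : Fin p, X (Sum.inr k) * rename Sum.inl (pderiv (colIdx n i c) (G k))

/-- The ideal generated by the `n+p−i+1` polynomials
`𝔏(i,G,u) = (G, [L₁ ⋯ L_p]·jac(G,i), u₁L₁+⋯+u_pL_p−1)` in `R[X₁,…,X_n,L₁,…,L_p]`. -/
def lagIdealK {R : Type*} [CommRing R] {n p : ℕ}
    (G : Fin p → MvPolynomial (Fin n) R) (i : ℕ) (u : Fin p → R) :
    Ideal (MvPolynomial (Fin n ⊕ Fin p) R) :=
  Ideal.span ((Set.range fun j : Fin p => rename Sum.inl (G j)) ∪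
    (Set.range fun c : Fin (n - i) => lagEntryK G i c) ∪
    {(∑ k : Fin p, C (u k) * X (Sum.inr k)) - 1})

/-- If `φ` is an endomorphism congruent to the identity modulo `J` that carries the generators of
`J` into a radical ideal `I ≤ J` stable under `φ`, then `J` is radical. -/
theorem isRadical_of_retraction {R : Type*} [CommRing R] {I J : Ideal R} (φ : R →+* R)
    (hI : I.IsRadical) (hIJ : I ≤ J) (hJ : J ≤ I.comap φ) (hφ : ∀ x, x - φ x ∈ J) :
    J.IsRadical := by
  have h : J = I.comap φ := le_antisymm hJ fun x hx => by
    have := J.add_mem (hφ x) (hIJ (Ideal.mem_comap.1 hx))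
    simpa using this
  rw [h]
  exact hI.comap φ

theorem sub_mem_of_forall_X {R σ : Type*} [CommRing R]
    (φ : MvPolynomial σ R →ₐ[R] MvPolynomial σ R) (J : Ideal (MvPolynomial σ R)) (h : ∀ s, X s - φ (X s) ∈ J) (x : MvPolynomial σ R) :
    x - φ x ∈ J := by
  have key : (Ideal.Quotient.mkₐ R J) = (Ideal.Quotient.mkₐ R J).comp φ := by
    ext s
    exact Ideal.Quotient.eq.2 (h s)
  exact Ideal.Quotient.eq.1 (DFunLike.congr_fun key x)

theorem isRadical_map_C {R σ : Type*} [CommRing R] {I : Ideal R} (hI : I.IsRadical) :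
    (I.map (C : R →+* MvPolynomial σ R)).IsRadical := by
  rw [Ideal.isRadical_iff_quotient_reduced] at hI ⊢
  exact isReduced_of_injective (quotientEquivQuotientMvPolynomial (σ := σ) I).symm
    (quotientEquivQuotientMvPolynomial (σ := σ) I).symm.injective

theorem isRadical_map_ringEquiv {R S : Type*} [CommRing R] [CommRing S] (e : R ≃+* S) {I : Ideal R}
    (hI : I.IsRadical) : (I.map (e : R →+* S)).IsRadical := by
  have h : I.map (e : R →+* S) = I.comap (e.symm : S →+* R) := Ideal.map_comap_of_equiv e
  rw [h]
  exact hI.comap _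

theorem isRadical_map_rename_inl {R σ τ : Type*} [CommRing R] {I : Ideal (MvPolynomial σ R)}
    (hI : I.IsRadical) :
    (I.map (rename (Sum.inl : σ → σ ⊕ τ) :
      MvPolynomial σ R →ₐ[R] MvPolynomial (σ ⊕ τ) R)).IsRadical := by
  have h := isRadical_map_ringEquiv
    ((sumAlgEquiv R τ σ).symm.trans (renameEquiv R (Equiv.sumComm τ σ))).toRingEquiv
    (isRadical_map_C (σ := τ) hI)
  rw [Ideal.map_map] at h
  have he : ((((sumAlgEquiv R τ σ).symm.trans (renameEquiv R (Equiv.sumComm τ σ))).toRingEquiv :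
      MvPolynomial τ (MvPolynomial σ R) →+* MvPolynomial (σ ⊕ τ) R).comp C) =
      (rename (Sum.inl : σ → σ ⊕ τ) : MvPolynomial σ R →ₐ[R] _).toRingHom := by
    ext x <;> simp
  rw [he] at h
  exact h

theorem isRadical_map_map_algebraMap {R K σ : Type*} [CommRing R] [CommRing K] [Algebra R K]
    (M : Submonoid R) [IsLocalization M K] {I : Ideal (MvPolynomial σ R)} (hI : I.IsRadical) :
    (I.map (map (σ := σ) (algebraMap R K))).IsRadical := by
  let _ := algebraMvPolynomial (σ := σ) (R := R) (S := K)
  have h := IsLocalization.map_radical (M.map (C (σ := σ))) (S := MvPolynomial σ K) I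
  rw [hI.radical] at h
  have h2 : (I.map (algebraMap (MvPolynomial σ R) (MvPolynomial σ K))).IsRadical := by
    rw [h]
    exact Ideal.radical_isRadical _
  exact h2

/-- Adjoining a unimodular inhomogeneous linear equation in fresh variables preserves radicality. -/
theorem isRadical_sup_span_affine {R σ τ : Type*} [CommRing R] [Fintype τ]
    {I : Ideal (MvPolynomial σ R)} (hI : I.IsRadical) (u c : τ → R) (hu : ∑ k, u k * c k = 1) :
    (I.map (rename (Sum.inl : σ → σ ⊕ τ) : MvPolynomial σ R →ₐ[R] MvPolynomial (σ ⊕ τ) R) ⊔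
      Ideal.span {(∑ k, C (u k) * X (Sum.inr k)) - 1}).IsRadical := by
  set g : MvPolynomial (σ ⊕ τ) R := (∑ k, C (u k) * X (Sum.inr k)) - 1 with hg
  obtain ⟨φ, hφl, hφr⟩ : ∃ φ : MvPolynomial (σ ⊕ τ) R →ₐ[R] MvPolynomial (σ ⊕ τ) R,
      (∀ s, φ (X (Sum.inl s)) = X (Sum.inl s)) ∧
      ∀ k, φ (X (Sum.inr k)) = X (Sum.inr k) - C (c k) * g :=
    ⟨aeval (Sum.elim (fun s => X (Sum.inl s)) fun k => X (Sum.inr k) - C (c k) * g),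
      by simp, by simp⟩
  have hgJ : g ∈ I.map (rename (Sum.inl : σ → σ ⊕ τ) : MvPolynomial σ R →ₐ[R] _) ⊔
      Ideal.span {g} := Ideal.mem_sup_right (Ideal.subset_span rfl)
  have hφf (f : MvPolynomial σ R) : φ (rename Sum.inl f) = rename Sum.inl f := by
    have : φ.comp (rename Sum.inl) = rename (Sum.inl : σ → σ ⊕ τ) := by
      ext s; simp [hφl]
    exact DFunLike.congr_fun this f
  have hu' : ∑ k, C (u k) * (C (c k) * g) = g := by
    simp_rw [← mul_assoc, ← C_mul, ← Finset.sum_mul, ← map_sum, hu, C_1, one_mul]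
  refine isRadical_of_retraction (φ : _ →+* _) (isRadical_map_rename_inl (τ := τ) hI) le_sup_left
    (sup_le ?_ ?_) (sub_mem_of_forall_X φ _ ?_)
  · refine Ideal.map_le_iff_le_comap.2 fun f hf => ?_
    simp only [Ideal.mem_comap, RingHom.coe_coe, hφf]
    exact Ideal.mem_map_of_mem _ hf
  · rw [Ideal.span_singleton_le_iff_mem, Ideal.mem_comap]
    have : φ g = 0 := by
      conv_lhs => rw [hg]
      simp only [map_sub, map_sum, map_mul, map_one, algHom_C, algebraMap_eq]
      simp only [hφr, mul_sub, Finset.sum_sub_distrib, hu']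
      rw [hg]; ring
    simp [this]
  · rintro (s | k)
    · simp [hφl]
    · rw [hφr, sub_sub_cancel]
      exact Ideal.mul_mem_left _ _ hgJ

/-- Adjoining, for each `m ∈ S`, the linear equation with unimodular coefficient vector `w` in the
`m`-th column of a matrix of fresh variables preserves radicality. -/
theorem isRadical_sup_span_columns {R ι κ : Type*} [CommRing R] [Fintype ι] {I : Ideal R}
    (hI : I.IsRadical) (w c : ι → R) (hw : 1 - ∑ l, w l * c l ∈ I) (S : Set κ) :
    (I.map (C : R →+* MvPolynomial (ι × κ) R) ⊔
      Ideal.span ((fun m => ∑ l, C (w l) * X (l, m)) '' S)).IsRadical := by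
  classical
  set g : κ → MvPolynomial (ι × κ) R := fun m => ∑ l, C (w l) * X (l, m) with hg
  obtain ⟨φ, hφ⟩ : ∃ φ : MvPolynomial (ι × κ) R →ₐ[R] MvPolynomial (ι × κ) R,
      ∀ l m, φ (X (l, m)) = X (l, m) - if m ∈ S then C (c l) * g m else 0 :=
    ⟨aeval fun q => X q - if q.2 ∈ S then C (c q.1) * g q.2 else 0, by simp⟩
  refine isRadical_of_retraction (φ : _ →+* _) (isRadical_map_C hI) le_sup_left
    (sup_le ?_ ?_) (sub_mem_of_forall_X φ _ ?_)
  · refine Ideal.map_le_iff_le_comap.2 fun f hf => ?_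
    simp only [Ideal.mem_comap, RingHom.coe_coe, algHom_C, algebraMap_eq]
    exact Ideal.mem_map_of_mem _ hf
  · rw [Ideal.span_le]
    rintro _ ⟨m, hm, rfl⟩
    have : φ (g m) = C (1 - ∑ l, w l * c l) * g m := by
      conv_lhs => rw [hg]
      simp only [map_sum, map_mul, algHom_C, algebraMap_eq]
      simp only [hφ, hm, if_true, mul_sub, Finset.sum_sub_distrib, map_sub, map_sum,
        map_mul, map_one, sub_mul, one_mul, Finset.sum_mul, mul_assoc]
      rfl
    simp only [SetLike.mem_coe, Ideal.mem_comap, RingHom.coe_coe, this]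
    exact Ideal.mul_mem_right _ _ (Ideal.mem_map_of_mem _ hw)
  · rintro ⟨l, m⟩
    by_cases hm : m ∈ S
    · simp only [hφ, hm, if_true, sub_sub_cancel]
      exact Ideal.mul_mem_left _ _ (Ideal.mem_sup_right (Ideal.subset_span ⟨m, hm, rfl⟩))
    · simp [hφ, hm]

/-- Weak Nullstellensatz. -/
theorem eq_top_of_zeroLocus_empty {k σ : Type*} [Field k] [IsAlgClosed k] [Finite σ]
    (I : Ideal (MvPolynomial σ k)) (h : ∀ x : σ → k, ∃ f ∈ I, eval x f ≠ 0) : I = ⊤ := by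
  rw [← Ideal.radical_eq_top, ← vanishingIdeal_zeroLocus_eq_radical (K := k), Ideal.eq_top_iff_one]
  intro x hx
  obtain ⟨f, hf, hne⟩ := h x
  exact absurd (by simpa [coe_aeval_eq_eval] using hx f hf) hne

/-- The linear change of variables `X ↦ a X`. -/
def linearSubst {R ι : Type*} [CommRing R] [Fintype ι] (a : Matrix ι ι R) :
    MvPolynomial ι R →ₐ[R] MvPolynomial ι R :=
  aeval fun k => ∑ m, C (a k m) * X m

theorem linearSubst_comp {R ι : Type*} [CommRing R] [Fintype ι] (a b : Matrix ι ι R) :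
    (linearSubst b).comp (linearSubst a) = linearSubst (a * b) := by
  ext1 k
  simp only [linearSubst, AlgHom.comp_apply, aeval_X, map_sum, map_mul, algHom_C, algebraMap_eq,
    Matrix.mul_apply, Finset.mul_sum, Finset.sum_mul]
  rw [Finset.sum_comm]
  simp only [mul_assoc]

theorem linearSubst_one {R ι : Type*} [CommRing R] [Fintype ι] [DecidableEq ι] :
    linearSubst (1 : Matrix ι ι R) = AlgHom.id R _ := by
  ext1 k
  simp [linearSubst, Matrix.one_apply]

theorem pderiv_linearSubst {R ι : Type*} [CommRing R] [Fintype ι] (a : Matrix ι ι R) (m : ι)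
    (f : MvPolynomial ι R) :
    pderiv m (linearSubst a f) = ∑ l, C (a l m) * linearSubst a (pderiv l f) := by
  classical
  induction f using MvPolynomial.induction_on with
  | C r => simp
  | add f g hf hg => simp [hf, hg, mul_add, Finset.sum_add_distrib]
  | mul_X f k hf =>
    have hX : pderiv m (linearSubst a (X k)) = C (a k m) := by
      simp [linearSubst, pderiv_X, Pi.single_apply]
    simp only [map_mul, Derivation.leibniz, smul_eq_mul, map_add, hf, hX, mul_add,
      Finset.sum_add_distrib, pderiv_X, Finset.mul_sum]
    congr 1
    · simp [Pi.single_apply, apply_ite, mul_comm]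
    · exact Finset.sum_congr rfl fun l _ => by ring

/-- The linear change of variables `X ↦ a X`, fixing the second group of variables. -/
def linearSubstInl {R ι τ : Type*} [CommRing R] [Fintype ι] (a : Matrix ι ι R) :
    MvPolynomial (ι ⊕ τ) R →ₐ[R] MvPolynomial (ι ⊕ τ) R :=
  aeval (Sum.elim (fun k => ∑ m, C (a k m) * X (Sum.inl m)) fun k => X (Sum.inr k))

theorem linearSubstInl_X_inr {R ι τ : Type*} [CommRing R] [Fintype ι] (a : Matrix ι ι R) (k : τ) :
    linearSubstInl a (X (Sum.inr k) : MvPolynomial (ι ⊕ τ) R) = X (Sum.inr k) := by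
  simp [linearSubstInl]

theorem linearSubstInl_rename {R ι τ : Type*} [CommRing R] [Fintype ι] (a : Matrix ι ι R)
    (f : MvPolynomial ι R) :
    linearSubstInl a (rename (Sum.inl : ι → ι ⊕ τ) f) = rename Sum.inl (linearSubst a f) := by
  have : (linearSubstInl a).comp (rename (Sum.inl : ι → ι ⊕ τ)) =
      (rename Sum.inl).comp (linearSubst a) := by
    ext1 k
    simp [linearSubstInl, linearSubst]
  exact DFunLike.congr_fun this f

theorem linearSubstInl_comp_of_mul_eq_one {R ι τ : Type*} [CommRing R] [Fintype ι] [DecidableEq ι]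
    {a b : Matrix ι ι R} (h : a * b = 1) :
    (linearSubstInl (τ := τ) b).comp (linearSubstInl a) = AlgHom.id R _ := by
  ext1 (k | k)
  · have hk : (X (Sum.inl k) : MvPolynomial (ι ⊕ τ) R) = rename Sum.inl (X k) := by simp
    have := DFunLike.congr_fun (linearSubst_comp a b) (X k)
    rw [h, linearSubst_one] at this
    rw [AlgHom.comp_apply] at this
    rw [AlgHom.comp_apply, hk, linearSubstInl_rename, linearSubstInl_rename, this]
    rfl
  · simp [linearSubstInl_X_inr]

theorem isRadical_map_linearSubstInl {R ι τ : Type*} [CommRing R] [Fintype ι] [DecidableEq ι]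
    {a : Matrix ι ι R} (ha : IsUnit a.det) {I : Ideal (MvPolynomial (ι ⊕ τ) R)}
    (hI : I.IsRadical) : (I.map (linearSubstInl a : _ →ₐ[R] _).toRingHom).IsRadical :=
  isRadical_map_ringEquiv (AlgEquiv.ofAlgHom (linearSubstInl a) (linearSubstInl a⁻¹)
    (linearSubstInl_comp_of_mul_eq_one (Matrix.nonsing_inv_mul a ha))
    (linearSubstInl_comp_of_mul_eq_one (Matrix.mul_nonsing_inv a ha))).toRingEquiv hI

theorem vecMul_eq_zero_of_rank_eq_card {K ι κ : Type*} [Field K] [Fintype ι] [Fintype κ]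
    {A : Matrix ι κ K} (hA : A.rank = Fintype.card ι) {v : ι → K} (hv : A.vecMul v = 0) :
    v = 0 := by
  have h : LinearIndependent K A.row := by
    rw [linearIndependent_iff_card_eq_finrank_span, ← hA, Matrix.rank_eq_finrank_span_row]
    rfl
  exact Matrix.vecMul_injective_iff.2 h (by simpa using hv)

/-- The `l`-th entry of the row vector `[L₁ ⋯ L_p]·jac(G)`. -/
def lagCoeff {R : Type*} [CommRing R] {n p : ℕ} (G : Fin p → MvPolynomial (Fin n) R) (l : Fin n) :
    MvPolynomial (Fin n ⊕ Fin p) R :=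
  ∑ k : Fin p, X (Sum.inr k) * rename Sum.inl (pderiv l (G k))

/-- If `jac(G)` has full row rank along `V(G)`, the entries of `[L₁ ⋯ L_p]·jac(G)` are unimodular
modulo `G` and `u₁L₁ + ⋯ + u_pL_p - 1`. -/
theorem exists_lagCoeff_unimodular {n p : ℕ} (G : Fin p → MvPolynomial (Fin n) ℂ)
    (hsm : ∀ x : Fin n → ℂ, (∀ j, eval x (G j) = 0) → (jacEval G x).rank = p) (u : Fin p → ℂ) :
    ∃ c : Fin n → MvPolynomial (Fin n ⊕ Fin p) ℂ,
      1 - ∑ l, lagCoeff G l * c l ∈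
        (Ideal.span (Set.range G)).map (rename Sum.inl : MvPolynomial (Fin n) ℂ →ₐ[ℂ] _) ⊔
        Ideal.span {(∑ k, C (u k) * X (Sum.inr k)) - 1} := by
  set J : Ideal (MvPolynomial (Fin n ⊕ Fin p) ℂ) :=
    (Ideal.span (Set.range G)).map (rename Sum.inl : MvPolynomial (Fin n) ℂ →ₐ[ℂ] _) ⊔
        Ideal.span {(∑ k, C (u k) * X (Sum.inr k)) - 1} with hJ
  have htop : J ⊔ Ideal.span (Set.range (lagCoeff G)) = ⊤ := by
    refine eq_top_of_zeroLocus_empty _ fun x => ?_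
    by_contra! hx
    have hG (j) : eval (x ∘ Sum.inl) (G j) = 0 := by
      have := hx (rename Sum.inl (G j)) (Ideal.mem_sup_left (Ideal.mem_sup_left
        (Ideal.mem_map_of_mem _ (Ideal.subset_span ⟨j, rfl⟩))))
      rwa [eval_rename] at this
    have hu := hx _ (Ideal.mem_sup_left (Ideal.mem_sup_right (Ideal.subset_span rfl)))
    have hw (l) := hx (lagCoeff G l) (Ideal.mem_sup_right (Ideal.subset_span ⟨l, rfl⟩))
    have hL : (x ∘ Sum.inr) = 0 := by
      refine vecMul_eq_zero_of_rank_eq_card (A := jacEval G (x ∘ Sum.inl))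
        (by simpa using hsm _ hG) ?_
      ext l
      simpa [lagCoeff, eval_rename, Matrix.vecMul, dotProduct, jacEval] using hw l
    have hL' (k) : x (Sum.inr k) = 0 := congrFun hL k
    simp [hL'] at hu
  have h1 : (1 : MvPolynomial (Fin n ⊕ Fin p) ℂ) ∈ J ⊔ Ideal.span (Set.range (lagCoeff G)) := by
    rw [htop]; trivial
  obtain ⟨y, hy, z, hz, hyz⟩ := Submodule.mem_sup.1 h1
  obtain ⟨c, rfl⟩ := Ideal.mem_span_range_iff_exists_fun.1 hz
  refine ⟨c, ?_⟩
  rw [← hyz]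
  simpa [mul_comm] using hy

theorem isUnit_det_genEntry (n : ℕ) : IsUnit (Matrix.of (genEntry n)).det := by
  have h : Matrix.of (genEntry n) = (algebraMap (MvPolynomial (Fin n × Fin n) ℂ)
      (GenField n)).mapMatrix (Matrix.mvPolynomialX (Fin n) (Fin n) ℂ) := by
    ext k m
    simp [genEntry]
  rw [h, ← RingHom.map_det, isUnit_iff_ne_zero, Ne,
    FaithfulSMul.algebraMap_eq_zero_iff]
  exact Matrix.det_mvPolynomialX_ne_zero _ _

/-- The specialization `ℂ[Y, L][𝔄] → K[X, L]` sending `Y` to `𝔄 X`. -/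
def genSpecialize (n p : ℕ) : MvPolynomial (Fin n × Fin n) (MvPolynomial (Fin n ⊕ Fin p) ℂ) →+*
    MvPolynomial (Fin n ⊕ Fin p) (GenField n) :=
  (linearSubstInl (Matrix.of (genEntry n))).toRingHom.comp
    ((map (algebraMap (MvPolynomial (Fin n × Fin n) ℂ) (GenField n))).comp
      (commAlgEquiv ℂ (Fin n × Fin n) (Fin n ⊕ Fin p)).toRingEquiv)

theorem isRadical_map_genSpecialize {n p : ℕ}
    {I : Ideal (MvPolynomial (Fin n × Fin n) (MvPolynomial (Fin n ⊕ Fin p) ℂ))}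
    (hI : I.IsRadical) : (I.map (genSpecialize n p)).IsRadical := by
  rw [genSpecialize, ← Ideal.map_map, ← Ideal.map_map]
  exact isRadical_map_linearSubstInl (isUnit_det_genEntry n)
    (isRadical_map_map_algebraMap (nonZeroDivisors _) (isRadical_map_ringEquiv _ hI))

theorem genSpecialize_C {n p : ℕ} (f : MvPolynomial (Fin n ⊕ Fin p) ℂ) :
    genSpecialize n p (C f) = linearSubstInl (Matrix.of (genEntry n))
      (map ((algebraMap (MvPolynomial (Fin n × Fin n) ℂ) (GenField n)).comp C) f) := by
  simp [genSpecialize, map_map]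

theorem genSpecialize_C_X_inr {n p : ℕ} (k : Fin p) :
    genSpecialize n p (C (X (Sum.inr k))) = X (Sum.inr k) := by
  rw [genSpecialize_C, map_X, linearSubstInl_X_inr]

theorem genSpecialize_C_C {n p : ℕ} (c : ℂ) :
    genSpecialize n p (C (C c)) = C (constK n c) := by
  simp [genSpecialize_C, constK]

theorem genSpecialize_X {n p : ℕ} (l m : Fin n) :
    genSpecialize n p (X (l, m)) = C (genEntry n l m) := by
  simp [genSpecialize, genEntry]

theorem genSpecialize_C_rename {n p : ℕ} (f : MvPolynomial (Fin n) ℂ) :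
    genSpecialize n p (C (rename Sum.inl f)) = rename Sum.inl
      (linearSubst (Matrix.of (genEntry n))
        (map ((algebraMap (MvPolynomial (Fin n × Fin n) ℂ) (GenField n)).comp C) f)) := by
  rw [genSpecialize_C, map_rename, linearSubstInl_rename]

theorem genChange_eq {n : ℕ} (f : MvPolynomial (Fin n) ℤ) :
    genChange f = linearSubst (Matrix.of (genEntry n))
      (map ((algebraMap (MvPolynomial (Fin n × Fin n) ℂ) (GenField n)).comp C) (toC f)) := by
  rw [genChange, toC, map_map, RingHom.ext_int (Int.castRingHom (GenField n))]
  rfl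

theorem genSpecialize_lagCoeff_column {n p : ℕ} (F : Fin p → MvPolynomial (Fin n) ℤ) (i : ℕ)
    (c : Fin (n - i)) :
    genSpecialize n p (∑ l, C (lagCoeff (fun j => toC (F j)) l) * X (l, colIdx n i c)) =
      lagEntryK (fun j => genChange (F j)) i c := by
  simp only [lagEntryK, lagCoeff, genChange_eq, pderiv_linearSubst, map_sum, map_mul,
    genSpecialize_C_X_inr, genSpecialize_C_rename, genSpecialize_X, pderiv_map, rename_C,
    Finset.sum_mul, Finset.mul_sum, Matrix.of_apply]
  rw [Finset.sum_comm]
  exact Finset.sum_congr rfl fun k _ => Finset.sum_congr rfl fun l _ => by ring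

theorem map_genSpecialize {n p : ℕ} (F : Fin p → MvPolynomial (Fin n) ℤ) (i : ℕ) (u : Fin p → ℂ) :
    (((Ideal.span (Set.range fun j => toC (F j))).map
          (rename Sum.inl : MvPolynomial (Fin n) ℂ →ₐ[ℂ] MvPolynomial (Fin n ⊕ Fin p) ℂ) ⊔
        Ideal.span {(∑ k, C (u k) * X (Sum.inr k)) - 1}).map C ⊔
      Ideal.span ((fun m => ∑ l, C (lagCoeff (fun j => toC (F j)) l) * X (l, m)) ''
        Set.range (colIdx n i))).map (genSpecialize n p) =
      lagIdealK (fun j => genChange (F j)) i (fun k => constK n (u k)) := by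
  simp only [Ideal.map_sup, Ideal.map_span, lagIdealK, Ideal.span_union, ← Set.range_comp,
    Set.image_singleton, Function.comp_def, genSpecialize_lagCoeff_column]
  simp only [genSpecialize_C_rename,
    ← genChange_eq, map_sub, map_sum, map_mul, map_one, genSpecialize_C_C, genSpecialize_C_X_inr]
  rw [sup_right_comm]

/-- under the assumptions on `F` (radical ideal, equidimensional of
codimension `p`, smooth), for every `i ∈ {1,…,n−p+1}` and every `u ∈ ℂ^p`, the
Lagrange ideal `⟨𝔏(i, F^𝔄, u)⟩` is radical in `K[X₁,…,X_n,L₁,…,L_p]`, where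
`K = ℂ(𝔄_{k,m})` and `𝔄` is a generic `n × n` matrix. -/
theorem generic_lagrange_ideal_radical
    (n p : ℕ) (hn : 0 < n) (hp : 0 < p)
    (F : Fin p → MvPolynomial (Fin n) ℤ)
    (hrad : (Ideal.span (Set.range fun j => toC (F j))).IsRadical)
    (hequi : ∀ P ∈ (Ideal.span (Set.range fun j => toC (F j))).minimalPrimes,
      IdealHeightEq P p)
    (hsm : ∀ x : Fin n → ℂ, (∀ j, eval x (toC (F j)) = 0) →
      (jacEval (fun j => toC (F j)) x).rank = p)
    (i : ℕ) (hi1 : 1 ≤ i) (hi2 : i ≤ n - p + 1) (u : Fin p → ℂ) :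
    (lagIdealK (fun j => genChange (F j)) i (fun k => constK n (u k))).IsRadical := by
  rw [← map_genSpecialize]
  obtain ⟨c, hc⟩ := exists_lagCoeff_unimodular (fun j => toC (F j)) hsm u
  refine isRadical_map_genSpecialize (isRadical_sup_span_columns ?_ _ c hc _)
  by_cases hu : ∃ k, u k ≠ 0
  · obtain ⟨k, hk⟩ := hu
    exact isRadical_sup_span_affine hrad u (Pi.single k (u k)⁻¹)
      (by simp [Pi.single_apply, hk])
  · push Not at hu
    have htop : Ideal.span {(∑ k, C (u k) * X (Sum.inr k)) - 1} =
        (⊤ : Ideal (MvPolynomial (Fin n ⊕ Fin p) ℂ)) := by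
      simp [hu]
    rw [htop, sup_top_eq]
    exact fun _ _ => trivial

end
end
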